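/- There is a constant c with 0 < c < 1 and an absolute constant A such that for all sufficiently large y and all natural numbers ℓ with 2 ≤ ℓ ≤ (c/9)√(log y)/log log y, one has |(1/y) ∫₀^y R̃(u)^ℓ du − M_R(ℓ)| ≤ A exp(−(c/8)√(log y)), where M_R(ℓ) = Σ_{n₁,…,n_ℓ ≥ 1} μ(n₁)⋯μ(n_ℓ) B(n₁,…,n_ℓ)/(n₁⋯n_ℓ) and μ is the Möbius function. Moreover M_R(ℓ) = 0 for odd ℓ, M_R(2) = 1/(2π²), and there is an absolute constant A' such that M_R(ℓ) ≤ ((3e^γ/π²) log ℓ + A')^ℓ for all even ℓ ≥ 4, where γ is the Euler–Mascheroni constant. -/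

import Mathlib

open scoped Classical Real
open Complex MeasureTheory

/-- The sawtooth function `ψ`. -/
noncomputable def saw (x : ℝ) : ℝ := if Int.fract x = 0 then 0 else Int.fract x - 1/2

/-- The correlation `B(n₁, …, n_ℓ)` of sawtooth functions. -/
noncomputable def Bcorr {l : ℕ} (n : Fin l → ℕ) : ℝ :=
  (1 / ∏ j, (n j : ℝ)) * ∫ x in (0 : ℝ)..(∏ j, (n j : ℝ)), ∏ j, saw (x / n j)

/-- `M_R(ℓ) = ∑_{n₁,…,n_ℓ ≥ 1} μ(n₁)⋯μ(n_ℓ) B(n₁,…,n_ℓ)/(n₁⋯n_ℓ)`. -/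
noncomputable def MR (l : ℕ) : ℝ :=
  ∑' n : Fin l → ℕ+,
    (∏ j, (ArithmeticFunction.moebius (n j) : ℝ)) * Bcorr (fun j => (n j : ℕ)) /
      ∏ j, ((n j : ℕ) : ℝ)

/-- The error term `R(x)` defined by `∑_{n ≤ x} φ(n) = (3/π²) x² + R(x)`. -/
noncomputable def Rerr (x : ℝ) : ℝ :=
  (∑ n ∈ Finset.range (⌊x⌋₊ + 1), (Nat.totient n : ℝ)) - 3 / Real.pi ^ 2 * x ^ 2

/-- `R̃(x) = R(x)/x - φ(x)/(2x)`, with the convention `φ(x) = 0` when `x` is not a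
positive integer. -/
noncomputable def Rtilde (x : ℝ) : ℝ :=
  Rerr x / x - (if Int.fract x = 0 then (Nat.totient ⌊x⌋₊ : ℝ) else 0) / (2 * x)

/-- The fractional part cut off to `(1, ∞)`. -/
noncomputable def fractCut (t : ℝ) : ℂ := if 1 < t then ((Int.fract t : ℝ) : ℂ) else 0

lemma measurable_fractCut : Measurable fractCut := by
  unfold fractCut
  exact Measurable.ite measurableSet_Ioi (Complex.measurable_ofReal.comp measurable_fract) measurable_const

lemma norm_fractCut_le (t : ℝ) : ‖fractCut t‖ ≤ 1 := by
  unfold fractCut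
  split_ifs
  · rw [Complex.norm_real, Real.norm_of_nonneg (Int.fract_nonneg t)]
    exact (Int.fract_lt_one t).le
  · simp

lemma differentiableAt_mellin_fractCut {s : ℂ} (hs : 0 < s.re) :
    DifferentiableAt ℂ (mellin fractCut) (-s) := by
  refine mellin_differentiableAt_of_isBigO_rpow (a := 0) (b := -s.re - 1) ?_ ?_ (by simpa) ?_ (by simp)
  · apply LocallyIntegrable.locallyIntegrableOn
    refine (locallyIntegrable_const (1:ℝ)).mono measurable_fractCut.aestronglyMeasurable ?_
    filter_upwards with t
    simpa using norm_fractCut_le t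
  · refine Asymptotics.IsBigO.of_bound 1 ?_
    filter_upwards [Filter.eventually_gt_atTop 0] with t ht
    simpa using norm_fractCut_le t
  · refine Asymptotics.IsBigO.of_bound 1 ?_
    have : ∀ᶠ t : ℝ in nhdsWithin 0 (Set.Ioi 0), t < 1 :=
      (Filter.Tendsto.eventually_lt_const (by norm_num : (0:ℝ) < 1) Filter.tendsto_id).filter_mono nhdsWithin_le_nhds
    filter_upwards [this] with t ht
    simp [fractCut, ht.le.not_gt]

lemma mellin_fractCut_eq (s : ℂ) :
    mellin fractCut (-s) = ∫ t in Set.Ioi (1:ℝ), ((Int.fract t : ℝ) : ℂ) * (t:ℂ) ^ (-(s+1)) := by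
  unfold mellin
  rw [← MeasureTheory.integral_indicator measurableSet_Ioi, ← MeasureTheory.integral_indicator measurableSet_Ioi]
  congr 1
  ext t
  by_cases h1 : 1 < t
  · have h0 : 0 < t := by linarith
    simp [Set.indicator, h0, h1, fractCut]
    rw [mul_comm]; ring_nf
  · simp [Set.indicator, h1, fractCut]

lemma integrableOn_fract_mul_cpow {s : ℂ} (hs : 0 < s.re) :
    IntegrableOn (fun t : ℝ => ((Int.fract t : ℝ) : ℂ) * (t:ℂ) ^ (-(s+1))) (Set.Ioi 1) := by
  have h1 : IntegrableOn (fun t : ℝ => (t:ℂ) ^ (-(s+1))) (Set.Ioi 1) :=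
    integrableOn_Ioi_cpow_of_lt (by simp; linarith) one_pos
  refine Integrable.mono h1 ?_ ?_
  · exact ((Complex.measurable_ofReal.comp measurable_fract).aestronglyMeasurable).mul h1.1
  · filter_upwards with t
    rw [norm_mul, Complex.norm_real, Real.norm_of_nonneg (Int.fract_nonneg t)]
    exact mul_le_of_le_one_left (norm_nonneg _) (Int.fract_lt_one t).le

lemma norm_mellin_fractCut_le {s : ℂ} (hs : 1/2 ≤ s.re) : ‖mellin fractCut (-s)‖ ≤ 2 := by
  rw [mellin_fractCut_eq]
  calc _ ≤ ∫ t in Set.Ioi (1:ℝ), t ^ (-(3/2) : ℝ) := by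
        refine norm_integral_le_of_norm_le (integrableOn_Ioi_rpow_of_lt (by norm_num) one_pos) ?_
        filter_upwards [ae_restrict_mem measurableSet_Ioi] with t ht
        have ht : 1 < t := ht
        rw [norm_mul, Complex.norm_real, Real.norm_of_nonneg (Int.fract_nonneg t),
          Complex.norm_cpow_eq_rpow_re_of_pos (by linarith)]
        refine (mul_le_of_le_one_left (by positivity) (Int.fract_lt_one t).le).trans ?_
        refine Real.rpow_le_rpow_of_exponent_le ht.le ?_
        simp; linarith
    _ = 2 := by
        rw [integral_Ioi_rpow_of_lt (by norm_num) one_pos]; norm_num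

lemma riemannZeta_eq_of_one_lt {s : ℂ} (hs : 1 < s.re) :
    riemannZeta s = s / (s - 1) - s * mellin fractCut (-s) := by
  have hO : (fun n : ℕ ↦ ∑ k ∈ Finset.Icc 1 n, ‖(1 : ℕ → ℂ) k‖) =O[Filter.atTop] fun n ↦ (n : ℝ) ^ (1:ℝ) := by
    refine Asymptotics.IsBigO.of_bound 1 ?_
    filter_upwards with n
    simp
  have := LSeries_eq_mul_integral' (1 : ℕ → ℂ) zero_le_one hs hO
  rw [LSeries_one_eq_riemannZeta hs] at this
  rw [this, mellin_fractCut_eq]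
  have hI : IntegrableOn (fun t : ℝ => (t:ℂ) ^ (-s)) (Set.Ioi 1) :=
    integrableOn_Ioi_cpow_of_lt (by simpa) one_pos
  have h2 : ∫ t in Set.Ioi (1:ℝ), (t:ℂ) ^ (-s) = 1 / (s - 1) := by
    rw [integral_Ioi_cpow_of_lt (by simpa) one_pos]
    simp only [ofReal_one, one_cpow]
    rw [show -s + 1 = -(s-1) by ring, neg_div_neg_eq]
  have h3 : ∫ t in Set.Ioi (1:ℝ), (∑ k ∈ Finset.Icc 1 ⌊t⌋₊, (1 : ℕ → ℂ) k) * (t:ℂ) ^ (-(s+1)) =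
      ∫ t in Set.Ioi (1:ℝ), ((t:ℂ) ^ (-s) - ((Int.fract t : ℝ) : ℂ) * (t:ℂ) ^ (-(s+1))) := by
    refine setIntegral_congr_fun measurableSet_Ioi fun t ht => ?_
    have ht : 1 < t := ht
    have ht0 : (t:ℂ) ≠ 0 := by exact_mod_cast (by linarith : t ≠ 0)
    have : (t:ℂ) ^ (-s) = t * (t:ℂ) ^ (-(s+1)) := by
      rw [show -s = 1 + -(s+1) by ring, Complex.cpow_add _ _ ht0, Complex.cpow_one]
    simp only [Pi.one_apply, Finset.sum_const, Nat.card_Icc, this, ← sub_mul]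
    congr 1
    simp only [add_tsub_cancel_right, nsmul_eq_mul, mul_one]
    have : (⌊t⌋₊ : ℝ) = t - Int.fract t := by
      rw [natCast_floor_eq_intCast_floor (by linarith), Int.self_sub_fract]
    exact_mod_cast congrArg (fun x : ℝ => (x : ℂ)) this
  rw [h3, integral_sub hI (integrableOn_fract_mul_cpow (by linarith)), h2]
  ring

lemma riemannZeta₁_eq {s : ℂ} (hs : 0 < s.re) :
    riemannZeta₁ s = s - s * (s - 1) * mellin fractCut (-s) := by
  have hopen : IsOpen {s : ℂ | 0 < s.re} := isOpen_lt continuous_const Complex.continuous_re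
  have hd : DifferentiableOn ℂ (fun s => s - s * (s - 1) * mellin fractCut (-s)) {s : ℂ | 0 < s.re} := by
    intro s hs
    have : DifferentiableAt ℂ (fun s => mellin fractCut (-s)) s :=
      (differentiableAt_mellin_fractCut hs).comp s differentiableAt_id.neg
    exact (by fun_prop : DifferentiableAt ℂ _ s).differentiableWithinAt
  have h1 : AnalyticOnNhd ℂ (fun s => s - s * (s - 1) * mellin fractCut (-s)) {s : ℂ | 0 < s.re} :=
    hd.analyticOnNhd hopen
  have h2 : AnalyticOnNhd ℂ riemannZeta₁ {s : ℂ | 0 < s.re} :=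
    differentiable_riemannZeta₁.differentiableOn.analyticOnNhd hopen
  have hpre : IsPreconnected {s : ℂ | 0 < s.re} := (convex_halfSpace_re_gt 0).isPreconnected
  refine h2.eqOn_of_preconnected_of_eventuallyEq h1 hpre (z₀ := 2) (by simp) ?_ hs
  have : ∀ᶠ z : ℂ in nhds 2, 1 < z.re :=
    (isOpen_lt continuous_const Complex.continuous_re).mem_nhds (by simp)
  filter_upwards [this] with z hz
  have hz1 : z ≠ 1 := by rintro rfl; simp at hz
  have hz1' : z - 1 ≠ 0 := sub_ne_zero.2 hz1
  have := riemannZeta_eq_of_one_lt hz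
  rw [riemannZeta_eq_inv_sub_mul hz1] at this
  field_simp at this
  rw [this]; ring

lemma norm_riemannZeta₁_le {s : ℂ} (hs : 1/2 ≤ s.re) : ‖riemannZeta₁ s‖ ≤ 3 * (‖s‖ + 1) ^ 2 := by
  rw [riemannZeta₁_eq (by linarith)]
  have h1 := norm_mellin_fractCut_le hs
  have h2 : ‖s - 1‖ ≤ ‖s‖ + 1 := by simpa using norm_sub_le s 1
  calc _ ≤ ‖s‖ + ‖s‖ * ‖s - 1‖ * ‖mellin fractCut (-s)‖ := by
        refine (norm_sub_le _ _).trans ?_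
        rw [norm_mul, norm_mul]
    _ ≤ ‖s‖ + ‖s‖ * (‖s‖ + 1) * 2 := by gcongr
    _ ≤ _ := by nlinarith [norm_nonneg s]

lemma exists_log_on_ball {f : ℂ → ℂ} {r : ℝ} (hr : 0 < r)
    (hf : DifferentiableOn ℂ f (Metric.ball 0 r)) (h0 : ∀ z ∈ Metric.ball (0:ℂ) r, f z ≠ 0) :
    ∃ g : ℂ → ℂ, DifferentiableOn ℂ g (Metric.ball 0 r) ∧ g 0 = 0 ∧
      (∀ z ∈ Metric.ball (0:ℂ) r, deriv g z = deriv f z / f z) ∧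
      ∀ z ∈ Metric.ball (0:ℂ) r, f z = f 0 * Complex.exp (g z) := by
  have hd : DifferentiableOn ℂ (fun z => deriv f z / f z) (Metric.ball 0 r) :=
    (hf.deriv Metric.isOpen_ball).div hf h0
  obtain ⟨g, hg0, hg⟩ := hd.isExactOn_ball.with_val_at 0 0
  have hgd : DifferentiableOn ℂ g (Metric.ball 0 r) := fun z hz =>
    (hg z hz).differentiableAt.differentiableWithinAt
  refine ⟨g, hgd, hg0, fun z hz => (hg z hz).deriv, fun z hz => ?_⟩
  have hmem : (0:ℂ) ∈ Metric.ball (0:ℂ) r := Metric.mem_ball_self hr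
  have hF : DifferentiableOn ℂ (fun z => f z * Complex.exp (-g z)) (Metric.ball 0 r) := by fun_prop
  have := Metric.isOpen_ball.is_const_of_deriv_eq_zero (convex_ball (0:ℂ) r).isPreconnected hF
    (fun w hw => ?_) hz hmem
  · simp only [hg0, neg_zero, Complex.exp_zero, mul_one] at this
    rw [← this, mul_assoc, ← Complex.exp_add]; simp
  · have h1 := (hf.differentiableAt (Metric.isOpen_ball.mem_nhds hw)).hasDerivAt
    have h2 := h1.mul ((hg w hw).neg.cexp)
    rw [show (fun z => f z * Complex.exp (-g z)) = f * (fun z => Complex.exp ((-g) z)) from rfl, h2.deriv]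
    have := h0 w hw
    simp; field_simp; ring

/-- Borel–Carathéodory for the logarithm of a nonvanishing function. -/
lemma norm_log_le_of_bound {f g : ℂ → ℂ} {r M : ℝ} (hr : 0 < r) (hM : 0 < M)
    (hf0 : f 0 ≠ 0) (hg : DifferentiableOn ℂ g (Metric.ball 0 r)) (hg0 : g 0 = 0)
    (hfg : ∀ z ∈ Metric.ball (0:ℂ) r, f z = f 0 * Complex.exp (g z))
    (hb : ∀ z ∈ Metric.ball (0:ℂ) r, ‖f z‖ ≤ Real.exp M * ‖f 0‖) {z : ℂ}
    (hz : z ∈ Metric.ball (0:ℂ) r) : ‖g z‖ ≤ 2 * M * ‖z‖ / (r - ‖z‖) := by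
  refine Complex.borelCaratheodory_zero hM hg (fun w hw => ?_) hr hz hg0
  have h := hb w hw
  rw [hfg w hw, norm_mul, mul_comm, Complex.norm_exp] at h
  have := le_of_mul_le_mul_right h (norm_pos_iff.2 hf0)
  exact Real.exp_le_exp.1 this

lemma norm_logDeriv_le_of_bound {f : ℂ → ℂ} {r M : ℝ} (hr : 0 < r) (hM : 0 < M)
    (hf : DifferentiableOn ℂ f (Metric.ball 0 r)) (h0 : ∀ z ∈ Metric.ball (0:ℂ) r, f z ≠ 0)
    (hb : ∀ z ∈ Metric.ball (0:ℂ) r, ‖f z‖ ≤ Real.exp M * ‖f 0‖) :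
    ‖deriv f 0 / f 0‖ ≤ 4 * M / r := by
  have hmem : (0:ℂ) ∈ Metric.ball (0:ℂ) r := Metric.mem_ball_self hr
  obtain ⟨g, hg, hg0, hgd, hfg⟩ := exists_log_on_ball hr hf h0
  rw [← hgd 0 hmem]
  have hsub : Metric.closedBall (0:ℂ) (r/2) ⊆ Metric.ball 0 r :=
    Metric.closedBall_subset_ball (by linarith)
  have := Complex.norm_deriv_le_of_forall_mem_sphere_norm_le (c := 0) (R := r/2) (C := 2 * M) (f := g)
    (by linarith) (hg.mono (by rw [closure_ball _ (by linarith)]; exact hsub)).diffContOnCl ?_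
  · convert this using 1; field_simp; ring
  · intro z hz
    have hzn : ‖z‖ = r/2 := by simpa using hz
    have := norm_log_le_of_bound hr hM (h0 0 hmem) hg hg0 hfg hb (hsub (Metric.sphere_subset_closedBall hz))
    rw [hzn] at this
    convert this using 1; field_simp; ring

/-- Dividing out a zero by a Blaschke factor. -/
lemma exists_divide_blaschke {f : ℂ → ℂ} {R K : ℝ} (hR : 0 < R) (hf : Differentiable ℂ f)
    (hf0 : f 0 ≠ 0) (hb : ∀ z : ℂ, ‖z‖ = R → ‖f z‖ ≤ K * ‖f 0‖) {ρ : ℂ} (hρ : ‖ρ‖ < R / 2)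
    (hρ0 : f ρ = 0) :
    ∃ g : ℂ → ℂ, Differentiable ℂ g ∧ g 0 ≠ 0 ∧ (∀ z : ℂ, ‖z‖ = R → ‖g z‖ ≤ K / 2 * ‖g 0‖) ∧
      (∀ z : ℂ, ‖z‖ < R / 2 → g z = 0 → f z = 0) ∧
      deriv g 0 / g 0 = deriv f 0 / f 0 + 1 / ρ - (starRingEnd ℂ) ρ / R ^ 2 := by
  have hρn : ρ ≠ 0 := by rintro rfl; exact hf0 hρ0
  have hRc : (R:ℂ) ≠ 0 := by exact_mod_cast hR.ne'
  have hd : Differentiable ℂ (dslope f ρ) := by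
    rw [← differentiableOn_univ]
    exact (Complex.differentiableOn_dslope Filter.univ_mem).2 hf.differentiableOn
  have hfd : ∀ z, f z = (z - ρ) * dslope f ρ z := fun z => by
    have := sub_smul_dslope f ρ z
    rw [hρ0, sub_zero, smul_eq_mul] at this
    exact this.symm
  set g : ℂ → ℂ := fun z => dslope f ρ z * ((R^2 - (starRingEnd ℂ) ρ * z) / R) with hgdef
  have hgdiff : Differentiable ℂ g := by fun_prop
  have hg0 : g 0 * (-ρ) = f 0 * R := by
    rw [hfd 0, hgdef]; simp; field_simp
  have hKnn : 0 ≤ K * ‖f 0‖ := by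
    have h := hb (R:ℂ) (by simp [abs_of_pos hR])
    exact (norm_nonneg _).trans h
  have hg0n : ‖g 0‖ * ‖ρ‖ = ‖f 0‖ * R := by
    have := congrArg norm hg0
    simpa [abs_of_pos hR] using this
  refine ⟨g, hgdiff, ?_, ?_, ?_, ?_⟩
  · intro h
    rw [h, zero_mul] at hg0
    exact mul_ne_zero hf0 hRc hg0.symm
  · intro z hz
    have hzz : z * (starRingEnd ℂ) z = R^2 := by
      rw [Complex.mul_conj, Complex.normSq_eq_norm_sq, hz]; push_cast; ring
    have e1 : ‖(R:ℂ)^2 - (starRingEnd ℂ) ρ * z‖ = R * ‖z - ρ‖ := by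
      rw [← hzz, show z * (starRingEnd ℂ) z - (starRingEnd ℂ) ρ * z = z * (starRingEnd ℂ) (z - ρ) by
        rw [map_sub]; ring, norm_mul, hz, Complex.norm_conj]
    have e2 : ‖g z‖ = ‖f z‖ := by
      rw [hfd z, hgdef]
      simp only [norm_mul, norm_div, e1]
      rw [Complex.norm_real, Real.norm_of_nonneg hR.le]
      field_simp
    rw [e2]
    refine (hb z hz).trans ?_
    have hK : 0 ≤ K := by
      by_contra hneg
      push Not at hneg
      have := mul_neg_of_neg_of_pos hneg (norm_pos_iff.2 hf0)
      linarith
    have : ‖f 0‖ * 2 ≤ ‖g 0‖ := by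
      have h3 : ‖f 0‖ * R ≤ ‖g 0‖ * (R/2) := by
        rw [← hg0n]; gcongr
      nlinarith
    nlinarith
  · intro z hz hgz
    rcases mul_eq_zero.1 hgz with h | h
    · rw [hfd, h, mul_zero]
    · exfalso
      rw [div_eq_zero_iff] at h
      rcases h with h | h
      · have : (R:ℂ)^2 = (starRingEnd ℂ) ρ * z := sub_eq_zero.1 h
        have := congrArg norm this
        rw [norm_pow, norm_mul, Complex.norm_conj, Complex.norm_real, Real.norm_of_nonneg hR.le] at this
        have : ‖ρ‖ * ‖z‖ ≤ R/2 * (R/2) := by gcongr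
        nlinarith
      · exact hRc h
  · have hE : (fun z => g z * (z - ρ)) = fun z => f z * ((R^2 - (starRingEnd ℂ) ρ * z) / R) := by
      ext z; rw [hfd z, hgdef]; ring
    have h1 : HasDerivAt (fun z => g z * (z - ρ)) (deriv g 0 * (0 - ρ) + g 0 * 1) 0 :=
      (hgdiff 0).hasDerivAt.mul ((hasDerivAt_id (0:ℂ)).sub_const ρ)
    have h2 : HasDerivAt (fun z => f z * ((R^2 - (starRingEnd ℂ) ρ * z) / R))
        (deriv f 0 * ((R^2 - (starRingEnd ℂ) ρ * 0) / R) + f 0 * ((0 - (starRingEnd ℂ) ρ * 1) / R)) 0 :=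
      (hf 0).hasDerivAt.mul (((hasDerivAt_const _ _).sub ((hasDerivAt_id (0:ℂ)).const_mul _)).div_const _)
    rw [hE] at h1
    have h3 := h1.unique h2
    have hg0' : g 0 = - (f 0 * R / ρ) := by field_simp; linear_combination -hg0
    have hg1 : deriv g 0 = (g 0 - (deriv f 0 * R - f 0 * (starRingEnd ℂ) ρ / R)) / ρ := by
      field_simp at h3 ⊢
      linear_combination (-1 : ℂ) * h3
    rw [hg1, hg0']
    field_simp
    ring

lemma re_blaschke_term (ρ : ℂ) (R : ℝ) :
    (1 / ρ - (starRingEnd ℂ) ρ / (R:ℂ) ^ 2).re = ρ.re * (1 / ‖ρ‖^2 - 1 / R^2) := by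
  have h : (1 / ρ - (starRingEnd ℂ) ρ / (R:ℂ) ^ 2) =
      ((1 / ‖ρ‖^2 - 1 / R^2 : ℝ) : ℂ) * (starRingEnd ℂ) ρ := by
    rw [one_div, Complex.inv_def, Complex.normSq_eq_norm_sq]; push_cast; ring
  rw [h, Complex.re_ofReal_mul, Complex.conj_re]; ring

lemma re_logDeriv_ge_aux (R M : ℝ) (hR : 0 < R) (hM : 0 < M) (n : ℕ) :
    ∀ (f : ℂ → ℂ) (K : ℝ), K < 2 ^ n → Real.log K ≤ M → Differentiable ℂ f → f 0 ≠ 0 →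
      (∀ z : ℂ, ‖z‖ = R → ‖f z‖ ≤ K * ‖f 0‖) →
      (∀ z : ℂ, ‖z‖ < R / 2 → f z = 0 → z.re ≤ 0) → -(8 * M / R) ≤ (deriv f 0 / f 0).re := by
  have key : ∀ (f : ℂ → ℂ) (K : ℝ), Differentiable ℂ f → f 0 ≠ 0 →
      (∀ z : ℂ, ‖z‖ = R → ‖f z‖ ≤ K * ‖f 0‖) → (∀ z : ℂ, ‖z‖ ≤ R → ‖f z‖ ≤ K * ‖f 0‖) ∧ 1 ≤ K := by
    intro f K hf hf0 hb
    have h1 : ∀ z : ℂ, ‖z‖ ≤ R → ‖f z‖ ≤ K * ‖f 0‖ := by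
      intro z hz
      refine Complex.norm_le_of_forall_mem_frontier_norm_le (U := Metric.ball 0 R) Metric.isBounded_ball
        hf.diffContOnCl (fun w hw => hb w ?_) ?_
      · rw [frontier_ball _ hR.ne'] at hw; simpa using hw
      · rw [closure_ball _ hR.ne']; simpa using hz
    refine ⟨h1, ?_⟩
    have h2 := h1 0 (by simpa using hR.le)
    have := norm_pos_iff.2 hf0
    by_contra h
    push Not at h
    nlinarith
  induction n with
  | zero =>
    intro f K hK _ hf hf0 hb _
    have := (key f K hf hf0 hb).2
    simp at hK; linarith
  | succ n ih =>
    intro f K hK hKM hf hf0 hb hz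
    obtain ⟨hbb, hK1⟩ := key f K hf hf0 hb
    by_cases hex : ∃ ρ : ℂ, ‖ρ‖ < R / 2 ∧ f ρ = 0
    · obtain ⟨ρ, hρ, hρ0⟩ := hex
      obtain ⟨g, hg, hg0, hgb, hgz, hgd⟩ := exists_divide_blaschke hR hf hf0 hb hρ hρ0
      have hK2 := (key g (K/2) hg hg0 hgb).2
      have h1 := ih g (K/2) (by rw [pow_succ] at hK; linarith)
        ((Real.log_le_log (by linarith) (by linarith)).trans hKM) hg hg0 hgb
        (fun z hz1 hz2 => hz z hz1 (hgz z hz1 hz2))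
      have h2 : (deriv g 0 / g 0).re = (deriv f 0 / f 0).re + ρ.re * (1 / ‖ρ‖^2 - 1 / R^2) := by
        rw [hgd, ← re_blaschke_term]; simp; ring
      have hρn : 0 < ‖ρ‖ := norm_pos_iff.2 (by rintro rfl; exact hf0 hρ0)
      have h3 : 0 ≤ 1 / ‖ρ‖^2 - 1 / R^2 := by
        rw [sub_nonneg]; gcongr; linarith
      have h4 : ρ.re * (1 / ‖ρ‖^2 - 1 / R^2) ≤ 0 := mul_nonpos_of_nonpos_of_nonneg (hz ρ hρ hρ0) h3
      linarith
    · push Not at hex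
      have := norm_logDeriv_le_of_bound (f := f) (r := R/2) (by linarith) hM hf.differentiableOn
        (fun z hz => hex z (by simpa using hz)) (fun z hz => ?_)
      · have h5 := (abs_le.1 (Complex.abs_re_le_norm (deriv f 0 / f 0))).1
        have h6 : 4 * M / (R/2) = 8 * M / R := by field_simp; ring
        rw [h6] at this
        linarith
      · have hz' : ‖z‖ < R/2 := by simpa using hz
        refine (hbb z (by linarith)).trans ?_
        gcongr
        exact (Real.log_le_iff_le_exp (by linarith)).1 hKM

/-- If `f` is entire, `‖f‖ ≤ K ‖f 0‖` on the circle of radius `R`, and `f` has no zeros with positive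
real part in the disc of radius `R/2`, then `logDeriv f` has real part bounded below at `0`. -/
lemma re_logDeriv_ge {f : ℂ → ℂ} {R M : ℝ} (hR : 0 < R) (hM : 0 < M)
    (hf : Differentiable ℂ f) (hf0 : f 0 ≠ 0)
    (hb : ∀ z : ℂ, ‖z‖ = R → ‖f z‖ ≤ Real.exp M * ‖f 0‖)
    (hz : ∀ z : ℂ, ‖z‖ < R / 2 → f z = 0 → z.re ≤ 0) : -(8 * M / R) ≤ (deriv f 0 / f 0).re := by
  obtain ⟨n, hn⟩ := pow_unbounded_of_one_lt (Real.exp M) (one_lt_two : (1:ℝ) < 2)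
  exact re_logDeriv_ge_aux R M hR hM n f _ hn (by simp) hf hf0 hb hz

lemma re_logDeriv_ge_of_zero {f : ℂ → ℂ} {R M d : ℝ} (hR : 0 < R) (hM : 0 < M)
    (hf : Differentiable ℂ f) (hf0 : f 0 ≠ 0)
    (hb : ∀ z : ℂ, ‖z‖ = R → ‖f z‖ ≤ Real.exp M * ‖f 0‖)
    (hz : ∀ z : ℂ, ‖z‖ < R / 2 → f z = 0 → z.re ≤ 0)
    (hd : 0 < d) (hdR : d < R / 2) (hd0 : f (-(d:ℂ)) = 0) :
    -(8 * M / R) + (1 / d - d / R ^ 2) ≤ (deriv f 0 / f 0).re := by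
  have hnd : ‖-(d:ℂ)‖ = d := by simp [abs_of_pos hd]
  obtain ⟨g, hg, hg0, hgb, hgz, hgd⟩ := exists_divide_blaschke hR hf hf0 hb (ρ := -(d:ℂ))
    (by rwa [hnd]) hd0
  have h1 := re_logDeriv_ge (f := g) hR hM hg hg0 (fun z hz => (hgb z hz).trans ?_)
    (fun z hz1 hz2 => hz z hz1 (hgz z hz1 hz2))
  · have h2 : (deriv g 0 / g 0).re = (deriv f 0 / f 0).re +
        (-(d:ℂ)).re * (1 / ‖-(d:ℂ)‖^2 - 1 / R^2) := by
      rw [hgd, ← re_blaschke_term]; simp; ring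
    rw [hnd] at h2
    have h3 : (-(d:ℂ)).re * (1 / d^2 - 1 / R^2) = -(1 / d - d / R ^ 2) := by
      simp; field_simp; ring
    rw [h3] at h2
    linarith
  · gcongr
    linarith [Real.exp_pos M]

lemma three_four_one_of_norm_one {w : ℂ} (hw : ‖w‖ = 1) : 0 ≤ 3 + 4 * w.re + (w ^ 2).re := by
  have h : w.re ^ 2 + w.im ^ 2 = 1 := by
    have := Complex.normSq_eq_norm_sq w
    rw [hw, Complex.normSq_apply] at this
    linarith
  have : (w^2).re = w.re^2 - w.im^2 := by rw [pow_two, Complex.mul_re]; ring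
  rw [this]
  nlinarith [sq_nonneg (1 + w.re)]

/-- The `3-4-1` inequality for the von Mangoldt Dirichlet series. -/
lemma three_four_one_vonMangoldt {σ : ℝ} (hσ : 1 < σ) (t : ℝ) :
    0 ≤ 3 * (LSeries (fun n => (ArithmeticFunction.vonMangoldt n : ℂ)) σ).re +
      4 * (LSeries (fun n => (ArithmeticFunction.vonMangoldt n : ℂ)) (σ + t * I)).re +
      (LSeries (fun n => (ArithmeticFunction.vonMangoldt n : ℂ)) (σ + (2 * t : ℝ) * I)).re := by
  set f : ℕ → ℂ := fun n => (ArithmeticFunction.vonMangoldt n : ℂ) with hf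
  have hs : ∀ u : ℝ, Summable fun n => LSeries.term f (σ + u * I) n := fun u =>
    ArithmeticFunction.LSeriesSummable_vonMangoldt (s := σ + u * I) (by simpa using hσ)
  have h0 : LSeries f σ = LSeries f (σ + (0:ℝ) * I) := by simp
  rw [h0]
  have hre : ∀ u : ℝ, (LSeries f (σ + u * I)).re = ∑' n, (LSeries.term f (σ + u * I) n).re := fun u =>
    Complex.re_tsum (hs u)
  have hsre : ∀ u : ℝ, Summable fun n => (LSeries.term f (σ + u * I) n).re := fun u =>
    (Complex.hasSum_re (hs u).hasSum).summable
  rw [hre, hre, hre, ← tsum_mul_left, ← tsum_mul_left,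
    ← Summable.tsum_add ((hsre 0).mul_left 3) ((hsre t).mul_left 4),
    ← Summable.tsum_add (((hsre 0).mul_left 3).add ((hsre t).mul_left 4)) (hsre (2*t))]
  refine tsum_nonneg fun n => ?_
  rcases Nat.eq_zero_or_pos n with rfl | hn
  · simp
  have hn0 : (n:ℂ) ≠ 0 := by exact_mod_cast hn.ne'
  have key : ∀ u : ℝ, LSeries.term f (σ + u * I) n =
      ((ArithmeticFunction.vonMangoldt n * (n:ℝ) ^ (-σ) : ℝ) : ℂ) * (n:ℂ) ^ (-(u * I)) := by
    intro u
    rw [LSeries.term_of_ne_zero hn.ne', div_eq_mul_inv, ← Complex.cpow_neg,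
      show -(σ + u * I : ℂ) = ((-σ : ℝ) : ℂ) + -(u * I) by push_cast; ring, Complex.cpow_add _ _ hn0,
      Complex.ofReal_mul, Complex.ofReal_cpow (by positivity)]
    simp only [hf, Complex.ofReal_natCast]; ring
  set w : ℂ := (n:ℂ) ^ (-(t * I)) with hw
  have hw1 : ‖w‖ = 1 := by
    rw [hw, ← Complex.ofReal_natCast, Complex.norm_cpow_eq_rpow_re_of_pos (by exact_mod_cast hn)]
    simp
  have e2 : (n:ℂ) ^ (-(((2 * t : ℝ) : ℂ) * I)) = w ^ 2 := by
    rw [hw, ← Complex.cpow_nat_mul]; congr 1; push_cast; ring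
  rw [key, key, key, e2, Complex.re_ofReal_mul, Complex.re_ofReal_mul, Complex.re_ofReal_mul, ← hw]
  have : (n:ℂ) ^ (-(((0:ℝ):ℂ) * I)) = 1 := by simp
  rw [this]
  have hnn : 0 ≤ ArithmeticFunction.vonMangoldt n * (n:ℝ) ^ (-σ) :=
    mul_nonneg ArithmeticFunction.vonMangoldt_nonneg (by positivity)
  have := mul_nonneg hnn (three_four_one_of_norm_one hw1)
  simp only [Complex.one_re]
  linarith

lemma logDeriv_riemannZeta₁ {s : ℂ} (hs : 1 < s.re) :
    deriv riemannZeta₁ s / riemannZeta₁ s = 1 / (s - 1) -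
      LSeries (fun n => (ArithmeticFunction.vonMangoldt n : ℂ)) s := by
  have hs1 : s ≠ 1 := by rintro rfl; simp at hs
  have hs1' : s - 1 ≠ 0 := sub_ne_zero.2 hs1
  have hz := riemannZeta_ne_zero_of_one_lt_re hs
  rw [ArithmeticFunction.LSeries_vonMangoldt_eq_deriv_riemannZeta_div hs,
    deriv_riemannZeta_eq_neg_inv_sub_sq_mul_add hs1]
  rw [riemannZeta_eq_inv_sub_mul hs1] at hz ⊢
  have : riemannZeta₁ s ≠ 0 := right_ne_zero_of_mul hz
  field_simp
  ring

lemma riemannZeta₁_ne_zero_of_one_le_re {s : ℂ} (hs : 1 ≤ s.re) : riemannZeta₁ s ≠ 0 := by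
  by_cases h : s = 1
  · subst h; simp
  · have := riemannZeta_ne_zero_of_one_le_re hs
    rw [riemannZeta_eq_inv_sub_mul h] at this
    exact right_ne_zero_of_mul this

lemma norm_riemannZeta_ofReal_le {σ : ℝ} (h1 : 1 < σ) (h2 : σ ≤ 2) :
    ‖riemannZeta σ‖ ≤ 6 / (σ - 1) := by
  rw [riemannZeta_eq_of_one_lt (by simpa using h1)]
  refine (norm_sub_le _ _).trans ?_
  have hm := norm_mellin_fractCut_le (s := (σ:ℂ)) (by simp; linarith)
  rw [norm_mul, norm_div, ← Complex.ofReal_one, ← Complex.ofReal_sub, Complex.norm_real,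
    Complex.norm_real, Real.norm_of_nonneg (by linarith), Real.norm_of_nonneg (by linarith)]
  have : σ * ‖mellin fractCut (-(σ:ℂ))‖ ≤ 2 * 2 := by gcongr
  have h3 : (0:ℝ) < σ - 1 := by linarith
  rw [div_add' _ _ _ h3.ne']
  gcongr
  nlinarith

lemma norm_LSeries_moebius_le {s : ℂ} (hs : 1 < s.re) (h2 : s.re ≤ 2) :
    ‖LSeries (fun n => (ArithmeticFunction.moebius n : ℂ)) s‖ ≤ 6 / (s.re - 1) := by
  have hsm := ArithmeticFunction.LSeriesSummable_moebius_iff.2 hs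
  have h1 : LSeriesSummable 1 (s.re : ℂ) := LSeriesSummable_one_iff.2 (by simpa)
  have hσ := norm_riemannZeta_ofReal_le hs h2
  rw [← LSeries_one_eq_riemannZeta (by simpa)] at hσ
  refine le_trans ?_ hσ
  have hz : LSeries 1 (s.re:ℂ) = ((∑' n, ‖LSeries.term 1 (s.re:ℂ) n‖ : ℝ) : ℂ) := by
    rw [LSeries, Complex.ofReal_tsum]
    refine tsum_congr fun n => ?_
    rcases Nat.eq_zero_or_pos n with rfl | hn
    · simp
    · rw [LSeries.norm_term_eq, if_neg hn.ne', LSeries.term_of_ne_zero hn.ne']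
      simp [Complex.ofReal_cpow]
  rw [hz, Complex.norm_real]
  refine le_trans ?_ (Real.le_norm_self _)
  refine (norm_tsum_le_tsum_norm hsm.norm).trans ?_
  refine Summable.tsum_le_tsum (fun n => ?_) hsm.norm h1.norm
  rw [LSeries.norm_term_eq, LSeries.norm_term_eq]
  split_ifs
  · rfl
  · simp only [Pi.one_apply, norm_one, Complex.ofReal_re]
    gcongr
    rw [Complex.norm_intCast]
    exact_mod_cast ArithmeticFunction.abs_moebius_le_one

lemma LSeries_moebius_eq {s : ℂ} (hs : 1 < s.re) :
    LSeries (fun n => (ArithmeticFunction.moebius n : ℂ)) s = (s - 1) / riemannZeta₁ s := by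
  have h := LSeries_one_mul_Lseries_moebius hs
  have hs1 : s ≠ 1 := by rintro rfl; simp at hs
  have hs1' : s - 1 ≠ 0 := sub_ne_zero.2 hs1
  have hz := riemannZeta₁_ne_zero_of_one_le_re hs.le
  rw [LSeries_one_eq_riemannZeta hs, riemannZeta_eq_inv_sub_mul hs1] at h
  field_simp at h ⊢
  linear_combination h

lemma norm_riemannZeta₁_ge {s : ℂ} (hs : 1 < s.re) (h2 : s.re ≤ 2) :
    ‖s - 1‖ * (s.re - 1) / 6 ≤ ‖riemannZeta₁ s‖ := by
  have h := norm_LSeries_moebius_le hs h2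
  rw [LSeries_moebius_eq hs, norm_div] at h
  have hz : 0 < ‖riemannZeta₁ s‖ := norm_pos_iff.2 (riemannZeta₁_ne_zero_of_one_le_re hs.le)
  have h3 : (0:ℝ) < s.re - 1 := by linarith
  rw [div_le_div_iff₀ hz h3] at h
  linarith

lemma riemannZeta₁_growth {s : ℂ} (hs : 1 < s.re) (h2 : s.re ≤ 2) {z : ℂ} (hz : ‖z‖ ≤ 1/2) :
    ‖riemannZeta₁ (s + z)‖ ≤ 18 * (|s.im| + 5) ^ 2 / (s.re - 1) ^ 2 * ‖riemannZeta₁ s‖ := by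
  have h3 : (0:ℝ) < s.re - 1 := by linarith
  have h1 := norm_riemannZeta₁_ge hs h2
  have hre : s.re - 1 ≤ ‖s - 1‖ := by
    simpa using (Complex.re_le_norm (s - 1))
  have hzre := (abs_le.1 ((Complex.abs_re_le_norm z).trans hz)).1
  have hu := norm_riemannZeta₁_le (s := s + z) (by simp; linarith)
  have hn : ‖s + z‖ + 1 ≤ |s.im| + 5 := by
    have := norm_add_le s z
    have h4 := Complex.norm_le_abs_re_add_abs_im s
    rw [abs_of_pos (by linarith : 0 < s.re)] at h4
    linarith
  have hp : (‖s + z‖ + 1)^2 ≤ (|s.im| + 5)^2 := by gcongr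
  have h5 : (s.re - 1)^2 / 6 ≤ ‖riemannZeta₁ s‖ := by
    refine le_trans ?_ h1
    rw [pow_two]; gcongr
  calc _ ≤ 3 * (|s.im| + 5)^2 := by linarith
    _ = 18 * (|s.im| + 5) ^ 2 / (s.re - 1) ^ 2 * ((s.re - 1)^2 / 6) := by field_simp; norm_num
    _ ≤ _ := by gcongr

lemma deriv_shift_zero (f : ℂ → ℂ) (s : ℂ) : deriv (fun z => f (s + z)) 0 = deriv f s := by
  rw [deriv_comp_const_add]; simp

lemma re_logDeriv_riemannZeta₁_ge {s : ℂ} (hs : 1 < s.re) (h2 : s.re ≤ 2) {M : ℝ}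
    (hM0 : 0 < M) (hM : Real.log (18 * (|s.im| + 5) ^ 2 / (s.re - 1) ^ 2) ≤ M) :
    -(16 * M) ≤ (deriv riemannZeta₁ s / riemannZeta₁ s).re ∧
    ∀ d : ℝ, 0 < d → d < 1/4 → riemannZeta₁ (s - d) = 0 →
      -(16 * M) + (1 / d - 4 * d) ≤ (deriv riemannZeta₁ s / riemannZeta₁ s).re := by
  have h3 : (0:ℝ) < s.re - 1 := by linarith
  set f : ℂ → ℂ := fun z => riemannZeta₁ (s + z) with hf
  have hfd : Differentiable ℂ f := by
    have := differentiable_riemannZeta₁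
    fun_prop
  have hf0 : f 0 = riemannZeta₁ s := by simp [hf]
  have hfn : f 0 ≠ 0 := by rw [hf0]; exact riemannZeta₁_ne_zero_of_one_le_re hs.le
  have hb : ∀ z : ℂ, ‖z‖ = 1/2 → ‖f z‖ ≤ Real.exp M * ‖f 0‖ := fun z hz => by
    rw [hf0]
    refine (riemannZeta₁_growth hs h2 hz.le).trans ?_
    gcongr
    exact (Real.log_le_iff_le_exp (by positivity)).1 hM
  have hz : ∀ z : ℂ, ‖z‖ < (1/2)/2 → f z = 0 → z.re ≤ 0 := by
    intro z _ hz
    by_contra hre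
    push Not at hre
    exact riemannZeta₁_ne_zero_of_one_le_re (s := s + z) (by simp; linarith) hz
  have hd : deriv f 0 = deriv riemannZeta₁ s := deriv_shift_zero _ _
  rw [← hd, ← hf0]
  constructor
  · have := re_logDeriv_ge (by norm_num : (0:ℝ) < 1/2) hM0 hfd hfn hb hz
    convert this using 1; ring
  · intro d hd0 hd1 hzero
    have := re_logDeriv_ge_of_zero (by norm_num : (0:ℝ) < 1/2) hM0 hfd hfn hb hz hd0
      (by linarith) (by rw [hf]; simpa [sub_eq_add_neg] using hzero)
    convert this using 1; ring

lemma one_le_log_abs_add_five (t : ℝ) : 1 ≤ Real.log (|t| + 5) := by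
  rw [Real.le_log_iff_exp_le (by positivity)]
  have := Real.exp_one_lt_d9
  linarith [abs_nonneg t]

lemma log_growth_le {t u L δ : ℝ} (hL : L = Real.log (|t| + 5)) (hδ : 0 < δ) (hδ1 : δ ≤ 1)
    (hu : |u| ≤ 2 * |t|) :
    Real.log (18 * (|u| + 5) ^ 2 / (δ / L) ^ 2) ≤ (9 + 2 * Real.log (1/δ)) * L := by
  have hL1 : 1 ≤ L := hL ▸ one_le_log_abs_add_five t
  have hL0 : 0 < L := by linarith
  have h1 : Real.log (|u| + 5) ≤ 2 * L := by
    rw [hL, ← Real.log_rpow (by positivity)]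
    refine Real.log_le_log (by positivity) ?_
    rw [Real.rpow_two]
    nlinarith [abs_nonneg t]
  have h18 : Real.log 18 ≤ 3 := by
    rw [Real.log_le_iff_le_exp (by norm_num)]
    have h := Real.exp_one_gt_d9
    rw [show (3:ℝ) = 1 + 1 + 1 by norm_num, Real.exp_add, Real.exp_add]
    nlinarith [mul_pos (Real.exp_pos 1) (Real.exp_pos 1)]
  have hlogL : Real.log L ≤ L := (Real.log_le_sub_one_of_pos hL0).trans (by linarith)
  have hlδ : 0 ≤ Real.log (1/δ) := Real.log_nonneg (by rw [le_div_iff₀ hδ]; linarith)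
  have e : Real.log (18 * (|u| + 5) ^ 2 / (δ / L) ^ 2) =
      Real.log 18 + 2 * Real.log (|u| + 5) + 2 * Real.log L + 2 * Real.log (1/δ) := by
    have : (|u| + 5) ≠ 0 := by positivity
    rw [Real.log_div (by positivity) (by positivity), Real.log_mul (by norm_num) (by positivity),
      Real.log_pow, Real.log_pow, Real.log_div hδ.ne' hL0.ne', one_div, Real.log_inv]
    push_cast; ring
  rw [e]
  nlinarith

lemma zero_free_large {t β : ℝ} (ht : 1 ≤ |t|) (hz : riemannZeta₁ (β + t * I) = 0) :
    β ≤ 1 - 1 / 70000 / Real.log (|t| + 5) := by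
  set L := Real.log (|t| + 5) with hL
  have hL1 : 1 ≤ L := one_le_log_abs_add_five t
  have hL0 : 0 < L := by linarith
  have hβ1 : β < 1 := by
    by_contra h
    exact riemannZeta₁_ne_zero_of_one_le_re (s := β + t * I) (by simp; linarith) hz
  by_cases hβ : β ≤ 7/8
  · have : 1 / 70000 / L ≤ 1/8 := by
      rw [div_le_iff₀ hL0]; nlinarith
    linarith
  push Not at hβ
  set δ : ℝ := 1/10000 with hδ
  set σ : ℝ := 1 + δ / L with hσ
  have hδL : 0 < δ / L := by positivity
  have hδL' : δ / L ≤ 1/10000 := by rw [div_le_iff₀ hL0]; nlinarith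
  have hlog : Real.log (1/δ) ≤ 10 := by
    rw [Real.log_le_iff_le_exp (by positivity), hδ]
    have h := Real.exp_one_gt_d9
    have h2 : (2.7:ℝ)^10 ≤ (Real.exp 1)^10 := by gcongr; linarith
    rw [← Real.exp_nat_mul] at h2
    norm_num at h2 ⊢
    linarith
  set M := (9 + 2 * Real.log (1/δ)) * L with hM
  have hM29 : M ≤ 29 * L := by rw [hM]; nlinarith
  have hlδ : 0 ≤ Real.log (1/δ) := Real.log_nonneg (by norm_num [hδ])
  have hM0 : 0 < M := by positivity
  have bound : ∀ u : ℝ, |u| ≤ 2 * |t| → _ := fun u hu =>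
    re_logDeriv_riemannZeta₁_ge (s := σ + u * I) (by simp; linarith) (by simp; linarith) hM0
      (by
        have := log_growth_le hL (by positivity : 0 < δ) (by norm_num [hδ]) hu
        rw [← hM] at this
        simpa [hσ] using this)
  have b0 := (bound 0 (by simp)).1
  have b1 := (bound t (by linarith)).2 (σ - β) (by linarith) (by linarith) (by
    convert hz using 2; push_cast; ring)
  have b2 := (bound (2 * t) (by rw [abs_mul]; norm_num)).1
  have h341 := three_four_one_vonMangoldt (σ := σ) (by linarith) t
  have e0 : LSeries (fun n => (ArithmeticFunction.vonMangoldt n : ℂ)) σ =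
      LSeries (fun n => (ArithmeticFunction.vonMangoldt n : ℂ)) (σ + (0:ℝ) * I) := by simp
  rw [e0] at h341
  have hld : ∀ u : ℝ, (LSeries (fun n => (ArithmeticFunction.vonMangoldt n : ℂ)) (σ + u * I)).re =
      (1 / ((σ:ℂ) + u * I - 1)).re - (deriv riemannZeta₁ (σ + u * I) / riemannZeta₁ (σ + u * I)).re := by
    intro u
    rw [logDeriv_riemannZeta₁ (by simp; linarith)]
    simp
  have hinv : ∀ u : ℝ, (1 / ((σ:ℂ) + u * I - 1)).re = (δ/L) / ((δ/L)^2 + u^2) := by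
    intro u
    rw [one_div, Complex.inv_re, Complex.normSq_apply]
    simp [hσ, pow_two]
  rw [hld 0, hld t, hld (2*t), hinv, hinv, hinv] at h341
  set d := σ - β with hd
  have hd0 : 0 < d := by linarith
  have f0 : (δ/L) / ((δ/L)^2 + 0^2) = L / δ := by field_simp; ring
  have ht2 : 1 ≤ t^2 := by rw [← sq_abs]; nlinarith
  have f1 : (δ/L) / ((δ/L)^2 + t^2) ≤ 1 := by
    rw [div_le_one (by positivity)]; nlinarith [sq_nonneg (δ/L)]
  have f2 : (δ/L) / ((δ/L)^2 + (2*t)^2) ≤ 1 := by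
    rw [div_le_one (by positivity)]; nlinarith [sq_nonneg (δ/L)]
  rw [f0] at h341
  have hfin : 4 * (1/d) ≤ 35000 * L := by
    have : L / δ = 10000 * L := by rw [hδ]; field_simp
    rw [this] at h341
    have : d < 1/4 := by linarith
    nlinarith
  have h4 : 4 ≤ 35000 * L * d := by
    have := mul_le_mul_of_nonneg_right hfin hd0.le
    rwa [mul_assoc, one_div_mul_cancel hd0.ne', mul_one] at this
  have h5 : 4 / (35000 * L) ≤ d := by
    rw [div_le_iff₀ (by positivity)]; linarith
  have h6 : 4 / (35000 * L) = δ / L + 1/70000/L := by rw [hδ]; field_simp; norm_num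
  linarith

lemma exists_zero_free_small : ∃ a : ℝ, 0 < a ∧ ∀ s : ℂ, |s.im| ≤ 1 → 1 - a < s.re → riemannZeta₁ s ≠ 0 := by
  have hc : Continuous riemannZeta₁ := differentiable_riemannZeta₁.continuous
  set S : Set ℂ := {s | riemannZeta₁ s = 0} ∩ (Set.Icc 0 1 ×ℂ Set.Icc (-1) 1) with hS
  have hcomp : IsCompact S :=
    (isCompact_Icc.reProdIm isCompact_Icc).inter_left (isClosed_eq hc continuous_const)
  have hmem : ∀ s : ℂ, |s.im| ≤ 1 → 0 ≤ s.re → riemannZeta₁ s = 0 → s ∈ S := by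
    intro s h1 h2 h3
    refine ⟨h3, ?_⟩
    rw [Complex.mem_reProdIm]
    refine ⟨⟨h2, ?_⟩, abs_le.1 h1⟩
    by_contra h
    exact riemannZeta₁_ne_zero_of_one_le_re (by linarith) h3
  by_cases hne : S.Nonempty
  · obtain ⟨s0, hs0, hmax⟩ := hcomp.exists_isMaxOn hne Complex.continuous_re.continuousOn
    have h1 : s0.re < 1 := by
      by_contra h
      exact riemannZeta₁_ne_zero_of_one_le_re (by linarith) hs0.1
    refine ⟨min (1 - s0.re) 1, by simp [h1], fun s him hre hz => ?_⟩
    have h2 := min_le_left (1 - s0.re) 1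
    have h3 := min_le_right (1 - s0.re) 1
    have : s.re ≤ s0.re := hmax (hmem s him (by linarith) hz)
    linarith
  · refine ⟨1, one_pos, fun s him hre hz => hne ⟨s, hmem s him (by linarith) hz⟩⟩

/-- The classical zero-free region. -/
lemma exists_zero_free_region : ∃ a : ℝ, 0 < a ∧ a ≤ 1/4 ∧ ∀ s : ℂ,
    1 - a / Real.log (|s.im| + 5) < s.re → riemannZeta₁ s ≠ 0 := by
  obtain ⟨a, ha, h⟩ := exists_zero_free_small
  refine ⟨min a (1/70000), by positivity, (min_le_right _ _).trans (by norm_num), fun s hs hz => ?_⟩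
  have hL1 := one_le_log_abs_add_five s.im
  by_cases him : |s.im| ≤ 1
  · refine h s him ?_ hz
    have : min a (1/70000) / Real.log (|s.im| + 5) ≤ a := by
      rw [div_le_iff₀ (by linarith)]
      have := min_le_left a (1/70000)
      nlinarith
    linarith
  · push Not at him
    have := zero_free_large (t := s.im) (β := s.re) him.le (by rwa [Complex.re_add_im])
    have h2 : min a (1/70000) / Real.log (|s.im| + 5) ≤ 1 / 70000 / Real.log (|s.im| + 5) := by
      gcongr
      exact min_le_right _ _
    linarith

lemma log_growth_le' {t L δ : ℝ} (hL : L = Real.log (|t| + 5)) (hδ : 0 < δ) :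
    Real.log (18 * (|t| + 5) ^ 2 / (δ / L) ^ 2) ≤ 4 * L + 3 + 2 * Real.log (1/δ) := by
  have hL1 : 1 ≤ L := hL ▸ one_le_log_abs_add_five t
  have hL0 : 0 < L := by linarith
  have h18 : Real.log 18 ≤ 3 := by
    rw [Real.log_le_iff_le_exp (by norm_num)]
    have h := Real.exp_one_gt_d9
    rw [show (3:ℝ) = 1 + 1 + 1 by norm_num, Real.exp_add, Real.exp_add]
    nlinarith [mul_pos (Real.exp_pos 1) (Real.exp_pos 1)]
  have hlogL : Real.log L ≤ L := (Real.log_le_sub_one_of_pos hL0).trans (by linarith)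
  have e : Real.log (18 * (|t| + 5) ^ 2 / (δ / L) ^ 2) =
      Real.log 18 + 2 * Real.log (|t| + 5) + 2 * Real.log L + 2 * Real.log (1/δ) := by
    have : (|t| + 5) ≠ 0 := by positivity
    rw [Real.log_div (by positivity) (by positivity), Real.log_mul (by norm_num) (by positivity),
      Real.log_pow, Real.log_pow, Real.log_div hδ.ne' hL0.ne', one_div, Real.log_inv]
    push_cast; ring
  rw [e, ← hL]
  linarith

lemma exists_inv_riemannZeta₁_bound : ∃ b C : ℝ, 0 < b ∧ 0 < C ∧ ∀ s : ℂ, 1 < s.re → s.re ≤ 2 →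
    ∀ z : ℂ, ‖z‖ < b / Real.log (|s.im| + 5) → riemannZeta₁ (s + z) ≠ 0 ∧
      ‖(s + z - 1) / riemannZeta₁ (s + z)‖ ≤ C * Real.exp (Real.log (|s.im| + 5) / 4) := by
  obtain ⟨a, ha, ha4, hfree⟩ := exists_zero_free_region
  set δ : ℝ := a / 512 with hδ
  have hδ0 : 0 < δ := by positivity
  set C1 : ℝ := (3 + 2 * Real.log (1/δ)) / 32 with hC1
  refine ⟨δ, 144 / δ * Real.exp C1, hδ0, by positivity, fun s hs hs2 z hz => ?_⟩
  set L := Real.log (|s.im| + 5) with hL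
  have hL1 : 1 ≤ L := one_le_log_abs_add_five _
  have hL0 : 0 < L := by linarith
  set r : ℝ := a / 2 / L with hr
  have hr0 : 0 < r := by positivity
  have hr8 : r ≤ 1/8 := by rw [hr, div_le_iff₀ hL0]; nlinarith
  have hδr : δ / L = r / 256 := by rw [hδ, hr]; field_simp; norm_num
  set σ : ℝ := max s.re (1 + δ / L) with hσ
  have hσ1 : s.re ≤ σ := le_max_left _ _
  have hσ2 : 1 + δ / L ≤ σ := le_max_right _ _
  have hσ3 : σ ≤ s.re + δ / L := max_le (by linarith [div_pos hδ0 hL0]) (by linarith)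
  have hδL : 0 < δ / L := div_pos hδ0 hL0
  have hσ4 : σ ≤ 2 := max_le hs2 (by linarith)
  set s1 : ℂ := σ + s.im * I with hs1
  have hs1re : s1.re = σ := by simp [hs1]
  have hs1im : s1.im = s.im := by simp [hs1]
  have hdiff : ‖s - s1‖ ≤ δ / L := by
    have : s - s1 = ((s.re - σ : ℝ) : ℂ) := by
      apply Complex.ext <;> simp [hs1]
    rw [this, Complex.norm_real, Real.norm_eq_abs, abs_le]
    constructor <;> linarith
  set w : ℂ := s - s1 + z with hw
  have hwn : ‖w‖ ≤ r / 128 := by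
    refine (norm_add_le _ _).trans ?_
    linarith
  have hsw : s + z = s1 + w := by rw [hw]; ring
  set f : ℂ → ℂ := fun u => riemannZeta₁ (s1 + u) with hf
  have hfd : Differentiable ℂ f := by
    have := differentiable_riemannZeta₁
    fun_prop
  have hfn : ∀ u ∈ Metric.ball (0:ℂ) r, f u ≠ 0 := by
    intro u hu
    have hu' : ‖u‖ < r := by simpa using hu
    apply hfree
    have h1 : |(s1 + u).im| + 5 ≤ (|s.im| + 5)^2 := by
      have h2 : |(s1 + u).im| ≤ |s.im| + ‖u‖ := by
        rw [Complex.add_im, hs1im]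
        exact (abs_add_le _ _).trans (by gcongr; exact Complex.abs_im_le_norm u)
      nlinarith [abs_nonneg s.im]
    have h3 : Real.log (|(s1 + u).im| + 5) ≤ 2 * L := by
      rw [hL]
      have := Real.log_le_log (by positivity) h1
      rwa [Real.log_pow] at this
    have h4 : r ≤ a / Real.log (|(s1 + u).im| + 5) := by
      rw [hr, div_div]
      have := one_le_log_abs_add_five (s1 + u).im
      gcongr
    have h5 := (abs_le.1 (Complex.abs_re_le_norm u)).1
    rw [Complex.add_re, hs1re]
    linarith
  have hf0 : f 0 = riemannZeta₁ s1 := by simp [hf]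
  have hmem : (0:ℂ) ∈ Metric.ball (0:ℂ) r := Metric.mem_ball_self hr0
  set M : ℝ := 4 * L + 3 + 2 * Real.log (1/δ) with hM
  have hlδ : 0 ≤ Real.log (1/δ) := Real.log_nonneg (by rw [le_div_iff₀ hδ0]; linarith)
  have hM0 : 0 < M := by positivity
  have hb : ∀ u ∈ Metric.ball (0:ℂ) r, ‖f u‖ ≤ Real.exp M * ‖f 0‖ := by
    intro u hu
    have hu' : ‖u‖ < r := by simpa using hu
    rw [hf0]
    refine (riemannZeta₁_growth (by rw [hs1re]; linarith) (by rwa [hs1re]) (by linarith : ‖u‖ ≤ 1/2)).trans ?_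
    gcongr
    rw [← Real.log_le_iff_le_exp (by rw [hs1re]; have : 0 < σ - 1 := by linarith
                                     positivity)]
    refine le_trans ?_ (log_growth_le' hL hδ0)
    rw [hs1re, hs1im]
    refine Real.log_le_log (by have : 0 < σ - 1 := by linarith
                               positivity) ?_
    gcongr
    linarith
  obtain ⟨g, hg, hg0, -, hfg⟩ := exists_log_on_ball hr0 hfd.differentiableOn hfn
  have hwmem : w ∈ Metric.ball (0:ℂ) r := by simp; linarith
  have hgw := norm_log_le_of_bound hr0 hM0 (hfn 0 hmem) hg hg0 hfg hb hwmem
  have hgw2 : ‖g w‖ ≤ L / 8 + C1 := by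
    refine hgw.trans ?_
    have h1 : 2 * M * ‖w‖ / (r - ‖w‖) ≤ M / 32 := by
      rw [div_le_iff₀ (by linarith)]
      nlinarith
    refine h1.trans (le_of_eq ?_)
    rw [hM, hC1]; ring
  have hfw : f w = riemannZeta₁ (s + z) := by rw [hsw]
  rw [← hfw]
  refine ⟨hfn w hwmem, ?_⟩
  have hlow : Real.exp (-(L / 8 + C1)) * ‖riemannZeta₁ s1‖ ≤ ‖f w‖ := by
    rw [hfg w hwmem, norm_mul, Complex.norm_exp, mul_comm, hf0]
    gcongr
    have := (abs_le.1 (Complex.abs_re_le_norm (g w))).1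
    linarith
  have hs1low := norm_riemannZeta₁_ge (s := s1) (by rw [hs1re]; linarith) (by rwa [hs1re])
  rw [hs1re] at hs1low
  have hs1n : σ - 1 ≤ ‖s1 - 1‖ := by
    have := Complex.re_le_norm (s1 - 1)
    simpa [hs1re] using this
  have hs1pos : 0 < ‖s1 - 1‖ := by linarith
  have hnum : ‖s + z - 1‖ ≤ 3 * ‖s1 - 1‖ := by
    have : s + z - 1 = (s1 - 1) + w := by rw [hw]; ring
    rw [this]
    refine (norm_add_le _ _).trans ?_
    linarith
  have hlow2 : Real.exp (-(L / 8 + C1)) * (‖s1 - 1‖ * (δ / L) / 6) ≤ ‖f w‖ := by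
    refine le_trans ?_ hlow
    gcongr
    refine le_trans ?_ hs1low
    gcongr
    linarith
  have hfwpos : 0 < ‖f w‖ := norm_pos_iff.2 (hfn w hwmem)
  rw [norm_div, div_le_iff₀ hfwpos]
  have hLexp : L ≤ 8 * Real.exp (L / 8) := by
    have := Real.add_one_le_exp (L/8); linarith
  have hexp : Real.exp (L/4) = Real.exp (L/8) * Real.exp (L/8) := by rw [← Real.exp_add]; ring_nf
  have hexp2 : Real.exp C1 * Real.exp (L/8) * Real.exp (-(L / 8 + C1)) = 1 := by
    rw [← Real.exp_add, ← Real.exp_add, ← Real.exp_zero]; ring_nf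
  calc ‖s + z - 1‖ ≤ 3 * ‖s1 - 1‖ := hnum
    _ = 3 * ‖s1 - 1‖ * L / L := by field_simp
    _ ≤ 3 * ‖s1 - 1‖ * (8 * Real.exp (L / 8)) / L := by gcongr
    _ = 144 / δ * (Real.exp (L/8) ) * (‖s1 - 1‖ * (δ / L) / 6) * 1 := by field_simp; norm_num
    _ = 144 / δ * (Real.exp (L/8) ) * (‖s1 - 1‖ * (δ / L) / 6) *
        (Real.exp C1 * Real.exp (L/8) * Real.exp (-(L / 8 + C1))) := by rw [hexp2]
    _ = 144 / δ * Real.exp C1 * Real.exp (L / 4) * (Real.exp (-(L / 8 + C1)) * (‖s1 - 1‖ * (δ / L) / 6)) := by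
        rw [hexp]; ring
    _ ≤ _ := by gcongr

/-- Bounds for all derivatives of `1/ζ` to the right of the line `Re s = 1`. -/
lemma exists_LSeries_log_moebius_bound : ∃ B C : ℝ, 0 < B ∧ 0 < C ∧ ∀ (k : ℕ) (s : ℂ), 1 < s.re → s.re ≤ 2 →
    ‖LSeries (LSeries.logMul^[k] (fun n => (ArithmeticFunction.moebius n : ℂ))) s‖ ≤
      C * B ^ k * (k.factorial : ℝ) ^ 2 * Real.exp (Real.log (|s.im| + 5) / 2) := by
  obtain ⟨b, C, hb, hC, h⟩ := exists_inv_riemannZeta₁_bound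
  refine ⟨8 / b, C, by positivity, hC, fun k s hs hs2 => ?_⟩
  set L := Real.log (|s.im| + 5) with hL
  have hL1 : 1 ≤ L := one_le_log_abs_add_five _
  have hL0 : 0 < L := by linarith
  set f : ℕ → ℂ := fun n => (ArithmeticFunction.moebius n : ℂ) with hf
  set g : ℂ → ℂ := fun s => (s - 1) / riemannZeta₁ s with hg
  have habs : LSeries.abscissaOfAbsConv f < s.re := by
    rw [hf, ArithmeticFunction.abscissaOfAbsConv_moebius]; exact_mod_cast hs
  have h1 := LSeries_iteratedDeriv k habs
  have h2 : iteratedDeriv k (LSeries f) s = iteratedDeriv k g s := by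
    apply Filter.EventuallyEq.iteratedDeriv_eq
    filter_upwards [(isOpen_lt continuous_const Complex.continuous_re).mem_nhds hs] with u hu
    exact LSeries_moebius_eq hu
  set r : ℝ := b / 2 / L with hr
  have hr0 : 0 < r := by positivity
  have hrb : r < b / L := by rw [hr]; gcongr; linarith
  have hin : ∀ u ∈ Metric.closedBall s r, riemannZeta₁ u ≠ 0 ∧ ‖g u‖ ≤ C * Real.exp (L / 4) := by
    intro u hu
    have := h s hs hs2 (u - s) (by
      have : ‖u - s‖ ≤ r := by simpa [dist_eq_norm] using hu
      linarith)
    rwa [add_sub_cancel] at this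
  have hcont : DiffContOnCl ℂ g (Metric.ball s r) := by
    apply DifferentiableOn.diffContOnCl
    rw [closure_ball _ hr0.ne']
    have hd := differentiable_riemannZeta₁
    intro u hu
    have := (hin u hu).1
    exact (by fun_prop (disch := assumption) : DifferentiableAt ℂ g u).differentiableWithinAt
  have h3 := Complex.norm_iteratedDeriv_le_of_forall_mem_sphere_norm_le k hr0 hcont
    (fun u hu => (hin u (Metric.sphere_subset_closedBall hu)).2)
  rw [← h2, h1, norm_mul, norm_pow, norm_neg, norm_one, one_pow, one_mul] at h3
  refine h3.trans ?_
  have hpow : (L / 4) ^ k / k.factorial ≤ Real.exp (L / 4) := Real.pow_div_factorial_le_exp _ (by positivity) _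
  have hexp : Real.exp (L/2) = Real.exp (L/4) * Real.exp (L/4) := by rw [← Real.exp_add]; ring_nf
  have hfac : (0:ℝ) < k.factorial := by positivity
  have e1 : (1:ℝ) / r ^ k = (8 / b)^k * (L/4)^k := by
    rw [← mul_pow, hr, one_div, ← inv_pow]; congr 1; field_simp; norm_num
  calc _ = k.factorial * (C * Real.exp (L/4)) * (1 / r^k) := by ring
    _ = C * (8/b)^k * (k.factorial:ℝ)^2 * Real.exp (L/4) * ((L/4)^k / k.factorial) := by
        rw [e1]; field_simp
    _ ≤ C * (8/b)^k * (k.factorial:ℝ)^2 * Real.exp (L/4) * Real.exp (L/4) := by gcongr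
    _ = _ := by rw [hexp]; ring

noncomputable def cesaroKernel (v : ℝ) : ℂ :=
  Set.indicator (Set.Ioc 0 1) (fun _ => (1:ℂ)) v -
    Set.indicator (Set.Ioc 0 1) (fun t : ℝ => (t:ℂ) ^ (1:ℂ)) v

lemma cesaroKernel_eq {v : ℝ} (hv : 0 < v) : cesaroKernel v = ((max (1 - v) 0 : ℝ) : ℂ) := by
  unfold cesaroKernel
  by_cases h : v ≤ 1
  · have : v ∈ Set.Ioc (0:ℝ) 1 := ⟨hv, h⟩
    rw [Set.indicator_of_mem this, Set.indicator_of_mem this, cpow_one, max_eq_left (by linarith)]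
    push_cast; ring
  · have : v ∉ Set.Ioc (0:ℝ) 1 := fun h' => h h'.2
    rw [Set.indicator_of_notMem this, Set.indicator_of_notMem this, max_eq_right (by linarith)]
    simp

lemma hasMellin_cesaroKernel {s : ℂ} (hs : 0 < s.re) :
    HasMellin cesaroKernel s (1 / s - 1 / (s + 1)) := by
  have h1 := hasMellin_one_Ioc hs
  have h2 := hasMellin_cpow_Ioc 1 (s := s) (by simp; linarith)
  have := hasMellin_sub h1.1 h2.1
  rw [h1.2, h2.2] at this
  exact this

lemma continuousAt_cesaroKernel {v : ℝ} (hv : 0 < v) : ContinuousAt cesaroKernel v := by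
  have : ContinuousAt (fun v : ℝ => ((max (1 - v) 0 : ℝ) : ℂ)) v := by fun_prop
  exact this.congr (by filter_upwards [lt_mem_nhds hv] with u hu using (cesaroKernel_eq hu).symm)

lemma norm_inv_sub_inv_le {σ : ℝ} (hσ : 1 ≤ σ) (t : ℝ) :
    ‖(1 : ℂ) / (σ + t * I) - 1 / (σ + t * I + 1)‖ ≤ (1 + t ^ 2)⁻¹ := by
  have key : ∀ r : ℝ, 1 ≤ r → Real.sqrt (1 + t^2) ≤ ‖(r : ℂ) + t * I‖ := by
    intro r hr
    rw [Complex.norm_add_mul_I]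
    apply Real.sqrt_le_sqrt; nlinarith
  have h1 := key σ hσ
  have h2 := key (σ + 1) (by linarith)
  have h0 : 0 < Real.sqrt (1 + t^2) := Real.sqrt_pos.mpr (by positivity)
  have e2 : (σ : ℂ) + t * I + 1 = ((σ + 1 : ℝ) : ℂ) + t * I := by push_cast; ring
  rw [e2]
  have n1 : (σ : ℂ) + t * I ≠ 0 := norm_pos_iff.mp (h0.trans_le h1)
  have n2 : ((σ + 1 : ℝ) : ℂ) + t * I ≠ 0 := norm_pos_iff.mp (h0.trans_le h2)
  have e3 : (1 : ℂ) / (σ + t * I) - 1 / (((σ + 1 : ℝ) : ℂ) + t * I) =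
      1 / ((σ + t * I) * (((σ + 1 : ℝ) : ℂ) + t * I)) := by
    field_simp; push_cast; ring
  rw [e3, norm_div, norm_one, norm_mul, one_div]
  apply inv_anti₀ (by positivity)
  calc 1 + t^2 = Real.sqrt (1+t^2) * Real.sqrt (1+t^2) := (Real.mul_self_sqrt (by positivity)).symm
    _ ≤ _ := by gcongr

lemma continuous_inv_sub_inv {σ : ℝ} (hσ : 1 ≤ σ) :
    Continuous (fun t : ℝ => (1 : ℂ) / (σ + t * I) - 1 / (σ + t * I + 1)) := by
  refine Continuous.sub (Continuous.div₀ continuous_const (by fun_prop) ?_)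
    (Continuous.div₀ continuous_const (by fun_prop) ?_)
  · intro t h; have := congrArg Complex.re h; simp at this; linarith
  · intro t h; have := congrArg Complex.re h; simp at this; linarith

lemma cesaroKernel_eq_integral {σ v : ℝ} (hσ : 1 ≤ σ) (hv : 0 < v) :
    ((max (1 - v) 0 : ℝ) : ℂ) = (1 / (2 * π) : ℝ) • ∫ t : ℝ, (v : ℂ) ^ (-(σ + t * I)) *
      (1 / (σ + t * I) - 1 / (σ + t * I + 1)) := by
  have hm : ∀ t : ℝ, mellin cesaroKernel (σ + t * I) = 1 / (σ + t * I) - 1 / (σ + t * I + 1) :=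
    fun t => (hasMellin_cesaroKernel (by simp; linarith)).2
  have hc : MellinConvergent cesaroKernel (σ : ℂ) :=
    (hasMellin_cesaroKernel (by simp; linarith)).1
  have hV : VerticalIntegrable (mellin cesaroKernel) σ := by
    unfold VerticalIntegrable
    simp_rw [hm]
    exact integrable_inv_one_add_sq.mono' (continuous_inv_sub_inv hσ).aestronglyMeasurable
      (Filter.Eventually.of_forall fun t => norm_inv_sub_inv_le hσ t)
  have := mellinInv_mellin_eq σ cesaroKernel hv hc hV (continuousAt_cesaroKernel hv)
  rw [← cesaroKernel_eq hv, ← this]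
  simp only [mellinInv, hm, smul_eq_mul]

lemma norm_sum_cesaro_le {f : ℕ → ℂ} {σ : ℝ} (hσ : 1 ≤ σ) (hf : LSeriesSummable f σ)
    {x : ℝ} (hx : 0 < x) {H : ℝ → ℝ} (hH : Integrable fun t => H t * (1 + t ^ 2)⁻¹)
    (hL : ∀ t : ℝ, ‖LSeries f (σ + t * I)‖ ≤ H t) :
    ‖∑ n ∈ Finset.Icc 1 ⌊x⌋₊, f n * ((1 - n / x : ℝ) : ℂ)‖ ≤
      x ^ σ * ∫ t : ℝ, H t * (1 + t ^ 2)⁻¹ := by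
  set K : ℝ → ℂ := fun t => 1 / (σ + t * I) - 1 / (σ + t * I + 1) with hK
  have hKi : Integrable K := integrable_inv_one_add_sq.mono'
      (continuous_inv_sub_inv hσ).aestronglyMeasurable
      (Filter.Eventually.of_forall fun t => norm_inv_sub_inv_le hσ t)
  set F : ℕ → ℝ → ℂ := fun n t => (x : ℂ) ^ (σ + t * I) * LSeries.term f (σ + t * I) n * K t with hF
  have hterm : ∀ (n : ℕ) (t : ℝ), ‖LSeries.term f (σ + t * I) n‖ = ‖LSeries.term f σ n‖ := by
    intro n t
    rw [LSeries.norm_term_eq, LSeries.norm_term_eq]; simp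
  have hxn : ∀ t : ℝ, ‖(x : ℂ) ^ ((σ : ℂ) + t * I)‖ = x ^ σ := by
    intro t; rw [norm_cpow_eq_rpow_re_of_pos hx]; simp
  have hnorm : ∀ n t, ‖F n t‖ = x ^ σ * ‖LSeries.term f σ n‖ * ‖K t‖ := by
    intro n t
    rw [hF]; simp only [norm_mul, hterm, hxn]
  have hFc : ∀ n, AEStronglyMeasurable (F n) := by
    intro n
    refine (Continuous.mul (Continuous.mul ?_ ?_) (continuous_inv_sub_inv hσ)).aestronglyMeasurable
    · exact Continuous.const_cpow (by fun_prop) (Or.inl (by exact_mod_cast hx.ne'))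
    · rcases Nat.eq_zero_or_pos n with rfl | hn
      · simp [LSeries.term_zero]; fun_prop
      · simp only [LSeries.term_of_ne_zero hn.ne']
        refine Continuous.div₀ continuous_const
          (Continuous.const_cpow (by fun_prop) (Or.inl (by exact_mod_cast hn.ne'))) ?_
        intro t; rw [cpow_def_of_ne_zero (by exact_mod_cast hn.ne')]; exact Complex.exp_ne_zero _
  have hFi : ∀ n, Integrable (F n) := by
    intro n
    refine (hKi.norm.const_mul (x ^ σ * ‖LSeries.term f σ n‖)).mono' (hFc n) ?_
    exact Filter.Eventually.of_forall fun t => (hnorm n t).le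
  have hsum : Summable fun n => ∫ t, ‖F n t‖ := by
    simp_rw [hnorm, integral_const_mul]
    exact (hf.norm.mul_left _).mul_right _
  have h1 := hasSum_integral_of_summable_integral_norm hFi hsum
  have h2 : ∀ t, ∑' n, F n t = (x : ℂ) ^ (σ + t * I) * LSeries f (σ + t * I) * K t := by
    intro t
    simp only [hF]
    rw [tsum_mul_right, tsum_mul_left]; rfl
  have h3 : ∀ n, (1 / (2 * π) : ℝ) • ∫ t, F n t =
      if n = 0 then 0 else f n * ((max (1 - n / x) 0 : ℝ) : ℂ) := by
    intro n
    rcases Nat.eq_zero_or_pos n with rfl | hn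
    · simp [hF]
    rw [if_neg hn.ne', cesaroKernel_eq_integral hσ (by positivity : (0:ℝ) < n / x), mul_smul_comm,
      ← integral_const_mul]
    congr 2
    funext t
    simp only [hF, LSeries.term_of_ne_zero hn.ne']
    have : (((n / x : ℝ)) : ℂ) ^ (-((σ:ℂ) + t * I)) = (x : ℂ) ^ ((σ:ℂ) + t * I) / (n : ℂ) ^ ((σ:ℂ) + t * I) := by
      rw [cpow_neg]
      push_cast
      rw [show ((n : ℂ)) = ((n : ℝ) : ℂ) by simp, div_cpow_ofReal_nonneg (by positivity) hx.le, inv_div]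
    rw [this]; ring
  have h4 := h1.const_smul (1 / (2 * π) : ℝ)
  simp_rw [h3] at h4
  have h5 : (∑ n ∈ Finset.Icc 1 ⌊x⌋₊, f n * ((1 - n / x : ℝ) : ℂ)) =
      (1 / (2 * π) : ℝ) • ∫ t, ∑' n, F n t := by
    rw [← h4.tsum_eq, tsum_eq_sum (s := Finset.Icc 1 ⌊x⌋₊)]
    · apply Finset.sum_congr rfl
      intro n hn
      rw [Finset.mem_Icc] at hn
      rw [if_neg (by omega), max_eq_left]
      have : (n : ℝ) ≤ x := (Nat.le_floor_iff hx.le).mp hn.2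
      rw [sub_nonneg, div_le_one hx]; exact this
    · intro n hn
      split_ifs with h0
      · rfl
      rw [max_eq_right]; · simp
      rw [Finset.mem_Icc, not_and_or] at hn
      have : x < n := by
        rcases hn with h | h
        · omega
        · exact (Nat.floor_lt hx.le).mp (by omega)
      rw [sub_nonpos, one_le_div hx]; exact this.le
  rw [h5, norm_smul]
  have h6 : ‖∫ t, ∑' n, F n t‖ ≤ ∫ t, x ^ σ * (H t * (1 + t^2)⁻¹) := by
    refine norm_integral_le_of_norm_le (hH.const_mul _) (Filter.Eventually.of_forall fun t => ?_)
    rw [h2, norm_mul, norm_mul, hxn, mul_assoc]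
    gcongr
    · exact (norm_nonneg _).trans (hL t)
    · exact hL t
    · exact norm_inv_sub_inv_le hσ t
  rw [integral_const_mul] at h6
  have h7 : ‖(1 / (2 * π) : ℝ)‖ ≤ 1 := by
    rw [Real.norm_of_nonneg (by positivity), div_le_one (by positivity)]
    linarith [Real.pi_gt_three]
  calc _ ≤ 1 * ‖∫ t, ∑' n, F n t‖ := by gcongr
    _ ≤ _ := by rw [one_mul]; exact h6

lemma exp_log_abs_half_le (t : ℝ) :
    Real.exp (Real.log (|t| + 5) / 2) ≤ 3 * (1 + t ^ 2) ^ (1 / 4 : ℝ) := by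
  have h0 : 0 < 1 + t ^ 2 := by positivity
  have h1 : Real.exp (Real.log (|t| + 5) / 2) = (|t| + 5) ^ (1 / 2 : ℝ) := by
    rw [Real.rpow_def_of_pos (by positivity)]; ring_nf
  have h2 : |t| + 5 ≤ 9 * (1 + t ^ 2) ^ (1 / 2 : ℝ) := by
    rw [← Real.sqrt_eq_rpow]
    have : |t| ≤ Real.sqrt (1 + t^2) := Real.abs_le_sqrt (by linarith)
    have : 1 ≤ Real.sqrt (1 + t^2) := Real.one_le_sqrt.mpr (by nlinarith [sq_nonneg t])
    linarith
  rw [h1]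
  calc (|t| + 5) ^ (1 / 2 : ℝ) ≤ (9 * (1 + t ^ 2) ^ (1 / 2 : ℝ)) ^ (1/2 : ℝ) :=
        Real.rpow_le_rpow (by positivity) h2 (by norm_num)
    _ = 3 * (1 + t ^ 2) ^ (1 / 4 : ℝ) := by
        rw [Real.mul_rpow (by norm_num) (by positivity), ← Real.rpow_mul h0.le, ← Real.sqrt_eq_rpow,
          show (9:ℝ) = 3 ^ 2 by norm_num, Real.sqrt_sq (by norm_num)]
        norm_num

lemma integrable_exp_log_mul :
    Integrable fun t : ℝ => Real.exp (Real.log (|t| + 5) / 2) * (1 + t ^ 2)⁻¹ := by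
  have h := integrable_rpow_neg_one_add_norm_sq (E := ℝ) (μ := volume) (r := 3 / 2) (by norm_num)
  refine (h.const_mul 3).mono' ?_ (Filter.Eventually.of_forall fun t => ?_)
  · refine Continuous.aestronglyMeasurable (Continuous.mul ?_ ?_)
    · refine Real.continuous_exp.comp ((Continuous.log (by fun_prop) ?_).div_const _)
      intro t; positivity
    · refine Continuous.inv₀ (by fun_prop) fun t => by positivity
  · have h0 : 0 < 1 + t ^ 2 := by positivity
    rw [Real.norm_of_nonneg (by positivity), Real.norm_eq_abs, sq_abs]
    calc _ ≤ 3 * (1 + t ^ 2) ^ (1 / 4 : ℝ) * (1 + t^2)⁻¹ := by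
          gcongr; exact exp_log_abs_half_le t
      _ = _ := by
        rw [mul_assoc, ← Real.rpow_neg_one, ← Real.rpow_add h0]; norm_num

/-- The log-weighted Cesàro mean of the Möbius function. -/
lemma exists_cesaro_moebius_bound : ∃ B C : ℝ, 0 < B ∧ 0 < C ∧ ∀ (k N : ℕ), 3 ≤ N →
    |∑ n ∈ Finset.Icc 1 N, (ArithmeticFunction.moebius n : ℝ) * Real.log n ^ k * (N - n)| ≤
      C * B ^ k * (k.factorial : ℝ) ^ 2 * N ^ 2 := by
  obtain ⟨B, C, hB, hC, h⟩ := exists_LSeries_log_moebius_bound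
  set J := ∫ t : ℝ, Real.exp (Real.log (|t| + 5) / 2) * (1 + t ^ 2)⁻¹ with hJ
  have hJ0 : 0 ≤ J := integral_nonneg fun t => by positivity
  refine ⟨B, C * Real.exp 1 * (J + 1), hB, by positivity, fun k N hN => ?_⟩
  have hN0 : (0:ℝ) < N := by positivity
  have hlog : 1 ≤ Real.log N := by
    rw [Real.le_log_iff_exp_le hN0]
    have : (3:ℝ) ≤ N := by exact_mod_cast hN
    linarith [Real.exp_one_lt_d9]
  set σ : ℝ := 1 + 1 / Real.log N with hσ
  have hinv : 1 / Real.log N ≤ 1 := by rw [div_le_one (by linarith)]; exact hlog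
  have hinv0 : 0 < 1 / Real.log N := by positivity
  set f : ℕ → ℂ := fun n => (ArithmeticFunction.moebius n : ℂ) with hf
  have hlm : ∀ (k n : ℕ), (LSeries.logMul^[k] f) n = (Real.log n : ℂ) ^ k * f n := by
    intro k
    induction k with
    | zero => simp
    | succ k ih =>
      intro n
      rw [Function.iterate_succ', Function.comp_apply, LSeries.logMul, ih, pow_succ', mul_assoc,
        ← Complex.natCast_log]
  have hsum : LSeriesSummable (LSeries.logMul^[k] f) (σ : ℂ) := by
    apply LSeriesSummable_of_abscissaOfAbsConv_lt_re
    rw [LSeries.absicssaOfAbsConv_logPowMul, hf, ArithmeticFunction.abscissaOfAbsConv_moebius]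
    rw [Complex.ofReal_re]
    have : (1:ℝ) < σ := by linarith
    exact_mod_cast this
  set G : ℝ := C * B ^ k * (k.factorial : ℝ) ^ 2 with hG
  have hG0 : 0 < G := by positivity
  have h1 := norm_sum_cesaro_le (σ := σ) (by linarith) hsum hN0
    (H := fun t => G * Real.exp (Real.log (|t| + 5) / 2))
    (by simp_rw [mul_assoc]; exact integrable_exp_log_mul.const_mul _)
    (fun t => by
      have := h k (σ + t * I) (by simp; linarith) (by simp; linarith)
      simpa using this)
  simp_rw [mul_assoc, integral_const_mul] at h1
  rw [← hJ, Nat.floor_natCast] at h1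
  have h2 : ((∑ n ∈ Finset.Icc 1 N, (ArithmeticFunction.moebius n : ℝ) * Real.log n ^ k * (N - n) : ℝ) : ℂ)
      = N * ∑ n ∈ Finset.Icc 1 N, (LSeries.logMul^[k] f) n * ((1 - n / (N : ℝ) : ℝ) : ℂ) := by
    rw [Finset.mul_sum]
    push_cast
    refine Finset.sum_congr rfl fun n _ => ?_
    rw [hlm, hf]
    have : (N : ℂ) ≠ 0 := by exact_mod_cast hN0.ne'
    field_simp
    push_cast
    ring
  have h3 : (N:ℝ) ^ σ = N * Real.exp 1 := by
    rw [hσ, Real.rpow_add hN0, Real.rpow_one, Real.rpow_def_of_pos hN0, mul_one_div_cancel (by positivity)]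
  rw [← Real.norm_eq_abs, ← Complex.norm_real, h2, norm_mul, Complex.norm_natCast]
  calc _ ≤ (N:ℝ) * ((N:ℝ) ^ σ * (G * J)) := by gcongr
    _ = N ^ 2 * Real.exp 1 * G * J := by rw [h3]; ring
    _ ≤ N ^ 2 * Real.exp 1 * G * (J + 1) := by gcongr; linarith
    _ = _ := by rw [hG]; ring

lemma abs_moebius_le_one_real (n : ℕ) : |(ArithmeticFunction.moebius n : ℝ)| ≤ 1 := by
  exact_mod_cast ArithmeticFunction.abs_moebius_le_one

lemma abs_sum_moebius_log_le {G : ℝ} {k : ℕ} (hG0 : 0 ≤ G)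
    (hG : ∀ N : ℕ, 3 ≤ N →
      |∑ n ∈ Finset.Icc 1 N, (ArithmeticFunction.moebius n : ℝ) * Real.log n ^ k * (N - n)| ≤ G * N ^ 2)
    {N j h : ℕ} (hj : 3 ≤ j) (hjN : j ≤ N) (hh : 1 ≤ h) (hhN : h ≤ N) :
    |∑ n ∈ Finset.Icc 1 j, (ArithmeticFunction.moebius n : ℝ) * Real.log n ^ k| ≤
      5 * G * N ^ 2 / h + h * Real.log (2 * N) ^ k := by
  set a : ℕ → ℝ := fun n => (ArithmeticFunction.moebius n : ℝ) * Real.log n ^ k with ha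
  have hh0 : (0:ℝ) < h := by exact_mod_cast hh
  have hsplit : ∑ n ∈ Finset.Icc 1 (j + h), a n * ((j + h : ℕ) - n : ℝ) =
      ∑ n ∈ Finset.Icc 1 j, a n * ((j + h : ℕ) - n : ℝ) +
      ∑ n ∈ Finset.Ioc j (j + h), a n * ((j + h : ℕ) - n : ℝ) := by
    rw [← Finset.sum_union]
    · congr 1; ext n; simp only [Finset.mem_Icc, Finset.mem_union, Finset.mem_Ioc]; omega
    · rw [Finset.disjoint_left]; intro n; simp only [Finset.mem_Icc, Finset.mem_Ioc]; omega
  have e1 : (h : ℝ) * ∑ n ∈ Finset.Icc 1 j, a n =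
      ∑ n ∈ Finset.Icc 1 (j + h), a n * ((j + h : ℕ) - n : ℝ) -
      ∑ n ∈ Finset.Icc 1 j, a n * ((j : ℝ) - n) -
      ∑ n ∈ Finset.Ioc j (j + h), a n * ((j + h : ℕ) - n : ℝ) := by
    rw [hsplit, add_sub_right_comm, add_sub_cancel_right, ← Finset.sum_sub_distrib, Finset.mul_sum]
    refine Finset.sum_congr rfl fun n _ => ?_
    push_cast; ring
  have b1 := hG (j + h) (by omega)
  have b2 := hG j hj
  have b3 : |∑ n ∈ Finset.Ioc j (j + h), a n * ((j + h : ℕ) - n : ℝ)| ≤ h * (h * Real.log (2 * N) ^ k) := by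
    calc _ ≤ ∑ n ∈ Finset.Ioc j (j + h), |a n * ((j + h : ℕ) - n : ℝ)| := Finset.abs_sum_le_sum_abs _ _
      _ ≤ ∑ n ∈ Finset.Ioc j (j + h), (h * Real.log (2 * N) ^ k) := by
        refine Finset.sum_le_sum fun n hn => ?_
        rw [Finset.mem_Ioc] at hn
        have hn1 : (1:ℝ) ≤ n := by exact_mod_cast (by omega : 1 ≤ n)
        have hn2 : (n:ℝ) ≤ 2 * N := by exact_mod_cast (by omega : n ≤ 2 * N)
        have hn3 : (n:ℝ) ≤ (j + h : ℕ) := by exact_mod_cast hn.2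
        have hn4 : (j:ℝ) ≤ n := by exact_mod_cast hn.1.le
        rw [abs_mul, ha, abs_mul, abs_of_nonneg (sub_nonneg.mpr hn3),
          abs_of_nonneg (pow_nonneg (Real.log_nonneg hn1) k), mul_comm]
        have : ((j + h : ℕ) : ℝ) - n ≤ h := by push_cast; linarith
        have hlog : 0 ≤ Real.log n := Real.log_nonneg hn1
        gcongr
        calc |(ArithmeticFunction.moebius n : ℝ)| * Real.log n ^ k ≤ 1 * Real.log (2 * N) ^ k := by
              gcongr
              exact abs_moebius_le_one_real n
          _ = _ := one_mul _
      _ = _ := by simp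
  have b4 : (h:ℝ) * |∑ n ∈ Finset.Icc 1 j, a n| ≤ 5 * G * N ^ 2 + h * (h * Real.log (2 * N) ^ k) := by
    rw [← abs_of_pos hh0, ← abs_mul, abs_of_pos hh0, e1]
    refine (abs_sub _ _).trans (add_le_add ((abs_sub _ _).trans ?_) b3)
    have c1 : G * ((j + h : ℕ) : ℝ) ^ 2 ≤ G * (2 * N) ^ 2 := by
      gcongr; exact_mod_cast (by omega : j + h ≤ 2 * N)
    have c2 : G * (j : ℝ) ^ 2 ≤ G * N ^ 2 := by gcongr
    linarith
  rw [← mul_le_mul_iff_right₀ hh0]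
  refine b4.trans (le_of_eq ?_)
  field_simp

/-- Abel's inequality on an interval of integers. -/
lemma abs_sum_Ioc_mul_le_of_antitone {a c : ℕ → ℝ} {m N : ℕ} (hmN : m ≤ N) {K : ℝ}
    (hc0 : ∀ n, m < n → 0 ≤ c n) (hc : ∀ n, m < n → c (n + 1) ≤ c n)
    (hA : ∀ j, m ≤ j → j ≤ N → |∑ n ∈ Finset.Icc 1 j, a n| ≤ K) :
    |∑ n ∈ Finset.Ioc m N, a n * c n| ≤ 2 * K * c (m + 1) := by
  have hK : 0 ≤ K := (abs_nonneg _).trans (hA m le_rfl hmN)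
  set A : ℕ → ℝ := fun j => ∑ n ∈ Finset.Icc 1 j, a n with hAdef
  have hAs : ∀ j, A (j + 1) = A j + a (j + 1) := fun j => by
    rw [hAdef]; simp only; rw [Finset.sum_Icc_succ_top (by omega)]
  have key : ∀ d, m + d ≤ N → ∃ E, ∑ n ∈ Finset.Ioc m (m + d), a n * c n =
      A (m + d) * c (m + d + 1) - A m * c (m + 1) + E ∧ |E| ≤ K * (c (m + 1) - c (m + d + 1)) := by
    intro d
    induction d with
    | zero => intro _; exact ⟨0, by simp, by simp⟩
    | succ d ih =>
      intro hd
      obtain ⟨E, hE, hE'⟩ := ih (by omega)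
      refine ⟨E + A (m + d + 1) * (c (m + d + 1) - c (m + d + 2)), ?_, ?_⟩
      · rw [← add_assoc, Finset.sum_Ioc_succ_top (by omega), hE, hAs]; ring
      · refine (abs_add_le _ _).trans ?_
        have h1 : |A (m + d + 1) * (c (m + d + 1) - c (m + d + 2))| ≤ K * (c (m + d + 1) - c (m + d + 2)) := by
          have := hc (m + d + 1) (by omega)
          rw [abs_mul, abs_of_nonneg (by linarith : 0 ≤ c (m + d + 1) - c (m + d + 2))]
          gcongr
          exact hA _ (by omega) (by omega)
        have e : m + (d + 1) + 1 = m + d + 2 := by ring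
        rw [e]; linarith
  obtain ⟨E, hE, hE'⟩ := key (N - m) (by omega)
  rw [show m + (N - m) = N by omega] at hE hE'
  rw [hE]
  have h1 : |A N * c (N + 1)| ≤ K * c (N + 1) := by
    rw [abs_mul, abs_of_nonneg (hc0 _ (by omega))]
    have := hc0 (N+1) (by omega)
    gcongr; exact hA _ hmN le_rfl
  have h2 : |A m * c (m + 1)| ≤ K * c (m + 1) := by
    rw [abs_mul, abs_of_nonneg (hc0 _ (by omega))]
    have := hc0 (m+1) (by omega)
    gcongr; exact hA _ le_rfl hmN
  have h3 := abs_add_le (A N * c (N + 1) - A m * c (m + 1)) E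
  have h4 := abs_sub (A N * c (N + 1)) (A m * c (m + 1))
  linarith

lemma abs_sum_moebius_le_card (s : Finset ℕ) :
    |∑ n ∈ s, (ArithmeticFunction.moebius n : ℝ)| ≤ s.card := by
  calc _ ≤ ∑ n ∈ s, |(ArithmeticFunction.moebius n : ℝ)| := Finset.abs_sum_le_sum_abs _ _
    _ ≤ ∑ n ∈ s, (1:ℝ) := Finset.sum_le_sum fun n _ => abs_moebius_le_one_real n
    _ = _ := by simp

lemma abs_sum_moebius_le {G : ℝ} {k : ℕ} (hG0 : 0 ≤ G)
    (hG : ∀ N : ℕ, 3 ≤ N →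
      |∑ n ∈ Finset.Icc 1 N, (ArithmeticFunction.moebius n : ℝ) * Real.log n ^ k * (N - n)| ≤ G * N ^ 2)
    {N h : ℕ} (hN : 9 ≤ N) (hh : 1 ≤ h) (hhN : h ≤ N) :
    |∑ n ∈ Finset.Icc 1 N, (ArithmeticFunction.moebius n : ℝ)| ≤
      2 * Real.sqrt N + (10 * (2 ^ k * G / Real.log N ^ k) * N ^ 2 / h + 2 * 4 ^ k * h) := by
  have hN0 : (9:ℝ) ≤ N := by exact_mod_cast hN
  have hlogN : 0 < Real.log N := Real.log_pos (by linarith)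
  set m : ℕ := ⌈Real.sqrt N⌉₊ with hm
  have hsq : 3 ≤ Real.sqrt N := by
    rw [show (3:ℝ) = Real.sqrt 9 by rw [show (9:ℝ) = 3^2 by norm_num, Real.sqrt_sq (by norm_num)]]
    exact Real.sqrt_le_sqrt hN0
  have hm1 : Real.sqrt N ≤ m := Nat.le_ceil _
  have hm2 : (m : ℝ) < Real.sqrt N + 1 := Nat.ceil_lt_add_one (Real.sqrt_nonneg _)
  have hsqN : Real.sqrt N * Real.sqrt N = N := Real.mul_self_sqrt (by linarith)
  have hm3 : 3 ≤ m := by exact_mod_cast hsq.trans hm1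
  have hmN : m ≤ N := by
    have : (m:ℝ) ≤ N := by nlinarith
    exact_mod_cast this
  set c : ℕ → ℝ := fun n => (Real.log n ^ k)⁻¹ with hc
  have hlog : ∀ n : ℕ, m < n → 0 < Real.log n := fun n hn =>
    Real.log_pos (by exact_mod_cast (by omega : 1 < n))
  set K := 5 * G * N ^ 2 / h + h * Real.log (2 * N) ^ k with hK
  have hK0 : 0 ≤ K := by
    have : 0 ≤ Real.log (2 * N) := Real.log_nonneg (by linarith)
    positivity
  have h1 := abs_sum_Ioc_mul_le_of_antitone (a := fun n => (ArithmeticFunction.moebius n : ℝ) * Real.log n ^ k)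
    (c := c) hmN (K := K)
    (fun n hn => by have := hlog n hn; positivity)
    (fun n hn => by
      have := hlog n hn
      simp only [hc]
      have : (0:ℝ) < n := by exact_mod_cast (by omega : 0 < n)
      gcongr
      linarith)
    (fun j hj hjN => abs_sum_moebius_log_le hG0 hG (by omega) hjN hh hhN)
  have h2 : ∑ n ∈ Finset.Ioc m N, (ArithmeticFunction.moebius n : ℝ) * Real.log n ^ k * c n =
      ∑ n ∈ Finset.Ioc m N, (ArithmeticFunction.moebius n : ℝ) := by
    refine Finset.sum_congr rfl fun n hn => ?_
    have := hlog n (Finset.mem_Ioc.mp hn).1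
    simp only [hc]
    rw [mul_assoc, mul_inv_cancel₀ (by positivity), mul_one]
  have h3 : ∑ n ∈ Finset.Icc 1 N, (ArithmeticFunction.moebius n : ℝ) =
      ∑ n ∈ Finset.Icc 1 m, (ArithmeticFunction.moebius n : ℝ) +
      ∑ n ∈ Finset.Ioc m N, (ArithmeticFunction.moebius n : ℝ) := by
    rw [← Finset.sum_union]
    · congr 1; ext n; simp only [Finset.mem_Icc, Finset.mem_union, Finset.mem_Ioc]; omega
    · rw [Finset.disjoint_left]; intro n; simp only [Finset.mem_Icc, Finset.mem_Ioc]; omega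
  have h4 := abs_sum_moebius_le_card (Finset.Icc 1 m)
  rw [Nat.card_Icc, Nat.add_sub_cancel] at h4
  have hcm : c (m + 1) ≤ 2 ^ k / Real.log N ^ k := by
    simp only [hc]
    rw [← div_pow, ← inv_pow]
    have : Real.log N / 2 ≤ Real.log ((m + 1 : ℕ) : ℝ) := by
      rw [← Real.log_sqrt (by linarith)]
      apply Real.log_le_log (by linarith)
      push_cast; linarith
    gcongr
    rw [← inv_div]
    exact inv_anti₀ (by positivity) this
  have hlog2 : Real.log (2 * N) ≤ 2 * Real.log N := by
    rw [Real.log_mul (by norm_num) (by linarith), two_mul]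
    gcongr; linarith
  have hlog20 : 0 ≤ Real.log (2 * N) := Real.log_nonneg (by linarith)
  rw [h2] at h1
  rw [h3]
  refine (abs_add_le _ _).trans (add_le_add (by linarith) (h1.trans ?_))
  calc 2 * K * c (m + 1) ≤ 2 * (5 * G * N ^ 2 / h + h * (2 * Real.log N) ^ k) * (2 ^ k / Real.log N ^ k) := by
        rw [hK]; gcongr
    _ = _ := by
        have : (4:ℝ)^k = 2^k * 2^k := by rw [← mul_pow]; norm_num
        rw [mul_pow, this]; field_simp; ring

set_option maxHeartbeats 1000000 in
theorem exists_mertens_bound_nat : ∃ c C : ℝ, 0 < c ∧ 0 < C ∧ ∀ N : ℕ, 1 ≤ N →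
    |∑ n ∈ Finset.Icc 1 N, (ArithmeticFunction.moebius n : ℝ)| ≤
      C * N * Real.exp (-c * Real.sqrt (Real.log N)) := by
  obtain ⟨B, C, hB, hC, hmain⟩ := exists_cesaro_moebius_bound
  set θ : ℝ := min 1 (Real.sqrt (Real.exp (-3) / (2 * B))) with hθ
  have hθ0 : 0 < θ := lt_min one_pos (Real.sqrt_pos.mpr (by positivity))
  have hθ1 : θ ≤ 1 := min_le_left _ _
  have hθ2 : 2 * B * θ ^ 2 ≤ Real.exp (-3) := by
    have : θ ^ 2 ≤ Real.exp (-3) / (2 * B) := by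
      rw [← Real.sq_sqrt (by positivity : (0:ℝ) ≤ Real.exp (-3) / (2 * B))]
      exact pow_le_pow_left₀ hθ0.le (min_le_right _ _) 2
    rw [le_div_iff₀ (by positivity)] at this; linarith
  set C' := 2 * Real.exp 1 + 10 * C * Real.exp 3 + 2 + 2 * Real.exp 1 + Real.exp 2 with hC'
  refine ⟨θ / 2, C', by positivity, by positivity, fun N hN => ?_⟩
  have hN1 : (1:ℝ) ≤ N := by exact_mod_cast hN
  have hN0 : (0:ℝ) < N := by linarith
  set w := Real.sqrt (Real.log N) with hw
  have hw0 : 0 ≤ w := Real.sqrt_nonneg _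
  have hw2 : w ^ 2 = Real.log N := Real.sq_sqrt (Real.log_nonneg hN1)
  have hexpN : Real.exp (w ^ 2) = N := by rw [hw2, Real.exp_log hN0]
  have hE0 : 0 < Real.exp (-(θ / 2) * w) := Real.exp_pos _
  rcases lt_or_ge N 9 with h9 | h9
  · have h1 := abs_sum_moebius_le_card (Finset.Icc 1 N)
    rw [Nat.card_Icc, Nat.add_sub_cancel] at h1
    have hw3 : w ≤ 4 := by
      have : w ^ 2 ≤ 16 := by
        rw [hw2]
        have := Real.log_le_sub_one_of_pos hN0
        have : (N:ℝ) ≤ 9 := by exact_mod_cast h9.le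
        linarith
      nlinarith
    have h2 : 1 ≤ Real.exp 2 * Real.exp (-(θ / 2) * w) := by
      rw [← Real.exp_add]; apply Real.one_le_exp; nlinarith
    have h3 : Real.exp 2 ≤ C' := by rw [hC']; have := Real.exp_pos 1; have := Real.exp_pos 3; nlinarith
    calc _ ≤ (N:ℝ) := h1
      _ ≤ N * (Real.exp 2 * Real.exp (-(θ / 2) * w)) := by nlinarith
      _ ≤ N * (C' * Real.exp (-(θ / 2) * w)) := by gcongr
      _ = _ := by ring
  · have hwpos : 0 < w := Real.sqrt_pos.mpr (Real.log_pos (by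
      have : (9:ℝ) ≤ N := by exact_mod_cast h9
      linarith))
    set k := ⌊θ * w⌋₊ with hk
    have hk1 : (k : ℝ) ≤ θ * w := Nat.floor_le (by positivity)
    have hk2 : θ * w < k + 1 := Nat.lt_floor_add_one _
    set h := ⌈N * Real.exp (-2 * θ * w)⌉₊ with hh
    have hh1 : N * Real.exp (-2 * θ * w) ≤ h := Nat.le_ceil _
    have hh2 : (h:ℝ) < N * Real.exp (-2 * θ * w) + 1 := Nat.ceil_lt_add_one (by positivity)
    have hh3 : 1 ≤ h := Nat.ceil_pos.mpr (by positivity)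
    have hh4 : h ≤ N := by
      apply Nat.ceil_le.mpr
      have : Real.exp (-2 * θ * w) ≤ 1 := Real.exp_le_one_iff.mpr (by nlinarith [mul_pos hθ0 hwpos])
      nlinarith
    have hmn := abs_sum_moebius_le (G := C * B ^ k * (k.factorial : ℝ) ^ 2) (k := k) (by positivity)
      (hmain k) h9 hh3 hh4
    refine hmn.trans ?_
    have t1 : 2 * Real.sqrt N ≤ 2 * Real.exp 1 * (N * Real.exp (-(θ / 2) * w)) := by
      have : Real.sqrt N = Real.exp (w^2/2) := by
        rw [← hexpN, ← Real.exp_half]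
      rw [this]; nth_rewrite 1 [← hexpN]
      rw [mul_assoc, ← Real.exp_add, ← Real.exp_add]
      gcongr
      nlinarith [sq_nonneg (w-1)]
    have t2 : 2 ^ k * (C * B ^ k * (k.factorial : ℝ) ^ 2) / Real.log N ^ k ≤ C * Real.exp (3 - 3 * (θ * w)) := by
      have hf : (k.factorial : ℝ) ≤ (θ * w) ^ k := by
        calc (k.factorial : ℝ) ≤ (k:ℝ)^k := by exact_mod_cast Nat.factorial_le_pow k
          _ ≤ _ := by gcongr
      calc _ ≤ 2 ^ k * (C * B ^ k * ((θ * w) ^ k) ^ 2) / Real.log N ^ k := by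
            have : 0 ≤ Real.log N := Real.log_nonneg hN1
            gcongr
        _ = C * (2 * B * θ ^ 2) ^ k := by
            rw [← hw2]
            rw [mul_pow, mul_pow, mul_pow]
            field_simp
            rw [mul_pow]; ring
        _ ≤ C * Real.exp (-3) ^ k := by gcongr
        _ = C * Real.exp (-3 * k) := by rw [← Real.exp_nat_mul]; ring_nf
        _ ≤ _ := by gcongr; linarith
    have t3 : 10 * (2 ^ k * (C * B ^ k * (k.factorial : ℝ) ^ 2) / Real.log N ^ k) * N ^ 2 / h ≤
        10 * C * Real.exp 3 * (N * Real.exp (-(θ / 2) * w)) := by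
      calc _ ≤ 10 * (C * Real.exp (3 - 3 * (θ * w))) * N ^ 2 / (N * Real.exp (-2 * θ * w)) := by
            gcongr
        _ = 10 * C * (N * (Real.exp (3 - 3 * (θ * w)) / Real.exp (-2 * θ * w))) := by
            field_simp
        _ ≤ 10 * C * (N * (Real.exp 3 * Real.exp (-(θ / 2) * w))) := by
            rw [← Real.exp_sub, ← Real.exp_add]
            gcongr
            nlinarith [mul_pos hθ0 hwpos]
        _ = _ := by ring
    have t4 : (4:ℝ) ^ k ≤ Real.exp (3 / 2 * (θ * w)) := by
      have : (4:ℝ) ≤ Real.exp (3/2) := by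
        have h1 : Real.exp (3/2) = Real.exp 1 * Real.exp (1/2) := by rw [← Real.exp_add]; norm_num
        have h2 := Real.exp_one_gt_d9
        have h3 : 1 + 1/2 + (1/2)^2/2 ≤ Real.exp (1/2) := by
          have := Real.quadratic_le_exp_of_nonneg (x := 1/2) (by norm_num)
          linarith
        rw [h1]; nlinarith
      calc (4:ℝ)^k ≤ Real.exp (3/2) ^ k := by gcongr
        _ = Real.exp (3/2 * k) := by rw [← Real.exp_nat_mul]; ring_nf
        _ ≤ _ := by gcongr
    have t5 : 2 * 4 ^ k * (h:ℝ) ≤ (2 + 2 * Real.exp 1) * (N * Real.exp (-(θ / 2) * w)) := by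
      calc 2 * 4 ^ k * (h:ℝ) ≤ 2 * Real.exp (3 / 2 * (θ * w)) * (N * Real.exp (-2 * θ * w) + 1) := by
            gcongr
        _ = 2 * (N * (Real.exp (3 / 2 * (θ * w)) * Real.exp (-2 * θ * w))) + 2 * Real.exp (3 / 2 * (θ * w)) := by ring
        _ ≤ 2 * (N * Real.exp (-(θ / 2) * w)) + 2 * (Real.exp 1 * (N * Real.exp (-(θ / 2) * w))) := by
            rw [← Real.exp_add]
            gcongr
            · apply le_of_eq; ring
            · nth_rewrite 1 [← hexpN]
              rw [← Real.exp_add, ← Real.exp_add]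
              apply Real.exp_le_exp.mpr
              nlinarith [sq_nonneg (w-1), mul_nonneg (sub_nonneg.mpr hθ1) hwpos.le]
        _ = _ := by ring
    have hP : 0 ≤ N * Real.exp (-(θ / 2) * w) := by positivity
    have hP2 : 0 ≤ Real.exp 2 * (N * Real.exp (-(θ / 2) * w)) := by positivity
    refine (add_le_add t1 (add_le_add t3 t5)).trans ?_
    rw [mul_assoc C', hC']
    linarith

/-- The weighted sawtooth sum `∑_{d ∈ D} μ(d) ψ(u/d) / d`. -/
noncomputable def sawSum (D : Finset ℕ) (u : ℝ) : ℝ :=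
  ∑ d ∈ D, (ArithmeticFunction.moebius d : ℝ) / d * saw (u / d)

lemma sum_totient_eq (X : ℕ) : ∑ n ∈ Finset.range (X + 1), (Nat.totient n : ℝ) =
    1 / 2 * ∑ d ∈ Finset.Icc 1 X, (ArithmeticFunction.moebius d : ℝ) *
      (((X / d : ℕ) : ℝ) ^ 2 + ((X / d : ℕ) : ℝ)) := by
  set g : ArithmeticFunction ℝ := ⟨fun n => (n : ℝ), by simp⟩ with hg
  have h1 := ArithmeticFunction.sum_Ioc_mul_eq_sum_sum (ArithmeticFunction.moebius : ArithmeticFunction ℝ) g X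
  have hphi : ∀ n > 0, ((ArithmeticFunction.moebius : ArithmeticFunction ℝ) * g) n = (Nat.totient n : ℝ) := by
    intro n hn
    have := (ArithmeticFunction.sum_eq_iff_sum_mul_moebius_eq (R := ℝ) (f := fun n => (Nat.totient n : ℝ))
      (g := fun n => (n : ℝ))).mp (fun n _ => by exact_mod_cast Nat.sum_totient n) n hn
    rw [ArithmeticFunction.mul_apply, ← this]
    rfl
  have e0 : Finset.Icc 1 X = Finset.Ioc 0 X := by ext; simp; omega
  have h2 : ∑ n ∈ Finset.range (X + 1), (Nat.totient n : ℝ) = ∑ n ∈ Finset.Ioc 0 X, (Nat.totient n : ℝ) := by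
    rw [Finset.sum_range_succ', ← e0, Finset.range_eq_Ico, Finset.sum_Ico_add' (fun n => (Nat.totient n : ℝ)) 0 X 1]
    simp
    rfl
  have hgs : ∀ q : ℕ, ∑ m ∈ Finset.Ioc 0 q, g m = 1 / 2 * ((q : ℝ) ^ 2 + q) := by
    intro q
    induction q with
    | zero => simp
    | succ q ih =>
      rw [Finset.sum_Ioc_succ_top (by omega), ih]
      simp [hg]; ring
  rw [h2, e0, Finset.mul_sum]
  rw [Finset.sum_congr rfl fun n hn => (hphi n (Finset.mem_Ioc.mp hn).1).symm, h1]
  refine Finset.sum_congr rfl fun d _ => ?_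
  rw [hgs, ArithmeticFunction.intCoe_apply]; ring

/-- Abel summation against partial sums of linear growth. -/
lemma abs_sum_Ioc_mul_le_of_linear {a c : ℕ → ℝ} {N L : ℕ} (hNL : N ≤ L) {δ : ℝ}
    (hc0 : ∀ n, N < n → 0 ≤ c n) (hc : ∀ n, N < n → c (n + 1) ≤ c n)
    (hA : ∀ j, N ≤ j → |∑ n ∈ Finset.Icc 1 j, a n| ≤ δ * j) :
    |∑ n ∈ Finset.Ioc N L, a n * c n| ≤ δ * (2 * N * c (N + 1) + ∑ n ∈ Finset.Ioc N L, c n) := by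
  set A : ℕ → ℝ := fun j => ∑ n ∈ Finset.Icc 1 j, a n with hAdef
  have hAs : ∀ j, A (j + 1) = A j + a (j + 1) := fun j => by
    rw [hAdef]; simp only; rw [Finset.sum_Icc_succ_top (by omega)]
  have key : ∀ d, ∃ E, ∑ n ∈ Finset.Ioc N (N + d), a n * c n =
      A (N + d) * c (N + d + 1) - A N * c (N + 1) + E ∧
      |E| ≤ δ * (N * c (N + 1) + ∑ n ∈ Finset.Ioc N (N + d), c n - (N + d) * c (N + d + 1)) := by
    intro d
    induction d with
    | zero => exact ⟨0, by simp, by simp⟩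
    | succ d ih =>
      obtain ⟨E, hE, hE'⟩ := ih
      refine ⟨E + A (N + d + 1) * (c (N + d + 1) - c (N + d + 2)), ?_, ?_⟩
      · rw [← add_assoc, Finset.sum_Ioc_succ_top (by omega), hE, hAs]; ring
      · refine (abs_add_le _ _).trans ?_
        have h1 : |A (N + d + 1) * (c (N + d + 1) - c (N + d + 2))| ≤
            δ * (N + d + 1 : ℕ) * (c (N + d + 1) - c (N + d + 2)) := by
          have := hc (N + d + 1) (by omega)
          rw [abs_mul, abs_of_nonneg (by linarith : 0 ≤ c (N + d + 1) - c (N + d + 2))]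
          gcongr
          exact hA _ (by omega)
        have e : N + (d + 1) + 1 = N + d + 2 := by ring
        rw [e, ← add_assoc N d 1, Finset.sum_Ioc_succ_top (by omega)]
        push_cast at h1 ⊢
        linarith
  obtain ⟨E, hE, hE'⟩ := key (L - N)
  have eL : N + (L - N) = L := by omega
  have eL' : (N : ℝ) + (L - N : ℕ) = L := by exact_mod_cast eL
  rw [eL, eL'] at hE'
  rw [eL] at hE
  rw [hE]
  have h1 : |A L * c (L + 1)| ≤ δ * L * c (L + 1) := by
    rw [abs_mul, abs_of_nonneg (hc0 _ (by omega))]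
    have := hc0 (L+1) (by omega)
    gcongr; exact hA _ hNL
  have h2 : |A N * c (N + 1)| ≤ δ * N * c (N + 1) := by
    rw [abs_mul, abs_of_nonneg (hc0 _ (by omega))]
    have := hc0 (N+1) (by omega)
    gcongr; exact hA _ le_rfl
  have h3 := abs_add_le (A L * c (L + 1) - A N * c (N + 1)) E
  have h4 := abs_sub (A L * c (L + 1)) (A N * c (N + 1))
  linarith

lemma abs_sum_moebius_mul_le {N L : ℕ} (hN : 1 ≤ N) (hNL : N ≤ L) {δ T : ℝ} (hδ : 0 ≤ δ) {c : ℕ → ℝ}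
    (hc0 : ∀ n, N < n → 0 ≤ c n) (hc : ∀ n, N < n → c (n + 1) ≤ c n)
    (hT : ∀ n, N < n → c n ≤ T * ((n : ℝ) ^ 2)⁻¹) (hT0 : 0 ≤ T)
    (hA : ∀ j, N ≤ j → |∑ n ∈ Finset.Icc 1 j, (ArithmeticFunction.moebius n : ℝ)| ≤ δ * j) :
    |∑ n ∈ Finset.Ioc N L, (ArithmeticFunction.moebius n : ℝ) * c n| ≤ 3 * δ * T / N := by
  refine (abs_sum_Ioc_mul_le_of_linear hNL hc0 hc hA).trans ?_
  have hN0 : (0:ℝ) < N := by exact_mod_cast hN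
  have h1 : ∑ n ∈ Finset.Ioc N L, c n ≤ T / N := by
    calc _ ≤ ∑ n ∈ Finset.Ioc N L, T * ((n : ℝ) ^ 2)⁻¹ :=
          Finset.sum_le_sum fun n hn => hT n (Finset.mem_Ioc.mp hn).1
      _ = T * ∑ n ∈ Finset.Ioc N L, ((n : ℝ) ^ 2)⁻¹ := by rw [Finset.mul_sum]
      _ ≤ T * (N : ℝ)⁻¹ := by
          gcongr
          refine (sum_Ioc_inv_sq_le_sub (by omega) hNL).trans ?_
          have : (0:ℝ) ≤ (L : ℝ)⁻¹ := by positivity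
          linarith
      _ = _ := by rw [div_eq_mul_inv]
  have h2 : 2 * N * c (N + 1) ≤ 2 * T / N := by
    have h3 := hT (N + 1) (by omega)
    calc 2 * N * c (N + 1) ≤ 2 * N * (T * (((N + 1 : ℕ) : ℝ) ^ 2)⁻¹) := by gcongr
      _ ≤ 2 * N * (T * ((N : ℝ) ^ 2)⁻¹) := by gcongr; simp
      _ = _ := by field_simp
  calc δ * (2 * N * c (N + 1) + ∑ n ∈ Finset.Ioc N L, c n) ≤ δ * (2 * T / N + T / N) := by gcongr
    _ = _ := by ring

lemma hasSum_moebius_div_sq :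
    HasSum (fun n : ℕ => (ArithmeticFunction.moebius n : ℝ) * ((n : ℝ) ^ 2)⁻¹) (6 / π ^ 2) := by
  have hs : (1:ℝ) < (2:ℂ).re := by norm_num
  have h1 := LSeries_one_mul_Lseries_moebius hs
  rw [LSeries_one_eq_riemannZeta hs, riemannZeta_two] at h1
  have hpi : (π : ℂ) ≠ 0 := by exact_mod_cast Real.pi_ne_zero
  have h2 : LSeries (fun n => (ArithmeticFunction.moebius n : ℂ)) 2 = ((6 / π ^ 2 : ℝ) : ℂ) := by
    push_cast
    field_simp
    field_simp at h1
    linear_combination h1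
  have h3 := (ArithmeticFunction.LSeriesSummable_moebius_iff.mpr hs).LSeriesHasSum
  rw [LSeriesHasSum, h2] at h3
  rw [← Complex.hasSum_ofReal]
  convert h3 using 1
  funext n
  rcases Nat.eq_zero_or_pos n with rfl | hn
  · simp
  · rw [LSeries.term_of_ne_zero hn.ne']
    push_cast
    rw [div_eq_mul_inv]
    norm_cast

lemma abs_sum_moebius_div_sq_sub_le {N : ℕ} (hN : 1 ≤ N) {δ : ℝ} (hδ : 0 ≤ δ)
    (hA : ∀ j, N ≤ j → |∑ n ∈ Finset.Icc 1 j, (ArithmeticFunction.moebius n : ℝ)| ≤ δ * j) :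
    |∑ n ∈ Finset.Icc 1 N, (ArithmeticFunction.moebius n : ℝ) * ((n : ℝ) ^ 2)⁻¹ - 6 / π ^ 2| ≤ 3 * δ / N := by
  have h1 := hasSum_moebius_div_sq.tendsto_sum_nat
  have h2 : Filter.Tendsto (fun L => |∑ n ∈ Finset.Icc 1 N, (ArithmeticFunction.moebius n : ℝ) * ((n : ℝ) ^ 2)⁻¹ -
      ∑ n ∈ Finset.range L, (ArithmeticFunction.moebius n : ℝ) * ((n : ℝ) ^ 2)⁻¹|) Filter.atTop
      (nhds |∑ n ∈ Finset.Icc 1 N, (ArithmeticFunction.moebius n : ℝ) * ((n : ℝ) ^ 2)⁻¹ - 6 / π ^ 2|) :=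
    (tendsto_const_nhds.sub h1).abs
  refine le_of_tendsto h2 ?_
  filter_upwards [Filter.eventually_ge_atTop (N + 1)] with L hL
  obtain ⟨L, rfl⟩ : ∃ M, L = M + 1 := ⟨L - 1, by omega⟩
  have e : Finset.range (L + 1) = insert 0 (Finset.Icc 1 N ∪ Finset.Ioc N L) := by
    ext n; simp only [Finset.mem_range, Finset.mem_insert, Finset.mem_union, Finset.mem_Icc, Finset.mem_Ioc]; omega
  have e2 : ∑ n ∈ Finset.range (L + 1), (ArithmeticFunction.moebius n : ℝ) * ((n : ℝ) ^ 2)⁻¹ =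
      ∑ n ∈ Finset.Icc 1 N, (ArithmeticFunction.moebius n : ℝ) * ((n : ℝ) ^ 2)⁻¹ +
      ∑ n ∈ Finset.Ioc N L, (ArithmeticFunction.moebius n : ℝ) * ((n : ℝ) ^ 2)⁻¹ := by
    rw [e, Finset.sum_insert (by simp), Finset.sum_union]
    · simp
    · rw [Finset.disjoint_left]; intro n; simp only [Finset.mem_Icc, Finset.mem_Ioc]; omega
  rw [e2, sub_add_cancel_left, abs_neg]
  have := abs_sum_moebius_mul_le (L := L) (T := 1) hN (by omega) hδ (c := fun n => ((n : ℝ) ^ 2)⁻¹)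
    (fun n _ => by positivity) (fun n hn => by
      have : (0:ℝ) < n := by exact_mod_cast (by omega : 0 < n)
      gcongr
      simp) (fun n _ => by simp) zero_le_one hA
  simpa using this

lemma saw_of_fract_ne_zero {x : ℝ} (h : Int.fract x ≠ 0) : saw x = Int.fract x - 1 / 2 := by
  simp [saw, h]

lemma abs_saw_le (x : ℝ) : |saw x| ≤ 1 / 2 := by
  unfold saw
  split_ifs
  · simp
  · rw [abs_le]; constructor <;> linarith [Int.fract_nonneg x, Int.fract_lt_one x]

lemma fract_ne_zero_div {x : ℝ} {d : ℕ} (hd : 1 ≤ d) (h : Int.fract x ≠ 0) : Int.fract (x / d) ≠ 0 := by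
  intro h0
  apply h
  have hd0 : (d : ℝ) ≠ 0 := by positivity
  have h1 : x / d = ⌊x / d⌋ := by have := Int.self_sub_floor (x / d); rw [h0] at this; linarith
  have h2 : x = ((⌊x / d⌋ * d : ℤ) : ℝ) := by
    push_cast; rw [← h1]; field_simp
  rw [h2]; exact Int.fract_intCast _

/-- The truncated sawtooth expansion of `R̃` at non-integers. -/
lemma abs_Rtilde_add_sawSum_le {x : ℝ} {N : ℕ} (hx : Int.fract x ≠ 0) (hN : 1 ≤ N) (hNx : N ≤ ⌊x⌋₊)
    {δ : ℝ} (hδ : 0 ≤ δ)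
    (hA : ∀ j, N ≤ j → |∑ n ∈ Finset.Icc 1 j, (ArithmeticFunction.moebius n : ℝ)| ≤ δ * j) :
    |Rtilde x + sawSum (Finset.Icc 1 N) x| ≤ 5 * δ * x / N + N / (8 * x) := by
  have hN0 : (0:ℝ) < N := by exact_mod_cast hN
  have hx0 : 0 < x := by
    by_contra h
    rw [Nat.floor_of_nonpos (by linarith)] at hNx; omega
  set X := ⌊x⌋₊ with hX
  have hq : ∀ d : ℕ, X / d = ⌊x / d⌋₊ := fun d => (Nat.floor_div_natCast x d).symm
  set c : ℕ → ℝ := fun d => ((X / d : ℕ) : ℝ) ^ 2 + ((X / d : ℕ) : ℝ) with hc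
  have hsplit : ∑ d ∈ Finset.Icc 1 X, (ArithmeticFunction.moebius d : ℝ) * c d =
      ∑ d ∈ Finset.Icc 1 N, (ArithmeticFunction.moebius d : ℝ) * c d +
      ∑ d ∈ Finset.Ioc N X, (ArithmeticFunction.moebius d : ℝ) * c d := by
    rw [← Finset.sum_union]
    · congr 1; ext n; simp only [Finset.mem_Icc, Finset.mem_union, Finset.mem_Ioc]; omega
    · rw [Finset.disjoint_left]; intro n; simp only [Finset.mem_Icc, Finset.mem_Ioc]; omega
  have hcd : ∀ d ∈ Finset.Icc 1 N, (ArithmeticFunction.moebius d : ℝ) * c d =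
      x ^ 2 * ((ArithmeticFunction.moebius d : ℝ) * ((d : ℝ) ^ 2)⁻¹) -
      2 * x * ((ArithmeticFunction.moebius d : ℝ) / d * saw (x / d)) +
      (ArithmeticFunction.moebius d : ℝ) * (saw (x / d) ^ 2 - 1 / 4) := by
    intro d hd
    have hd1 := (Finset.mem_Icc.mp hd).1
    have hd0 : (0:ℝ) < d := by exact_mod_cast hd1
    have hs := saw_of_fract_ne_zero (fract_ne_zero_div hd1 hx)
    have hfl : ((X / d : ℕ) : ℝ) = x / d - saw (x / d) - 1 / 2 := by
      rw [hs, hq, natCast_floor_eq_intCast_floor (by positivity), ← Int.self_sub_fract]; ring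
    simp only [hc]
    rw [hfl]; field_simp; ring
  rw [Finset.sum_congr rfl hcd, Finset.sum_add_distrib, Finset.sum_sub_distrib, ← Finset.mul_sum,
    ← Finset.mul_sum] at hsplit
  set P := ∑ n ∈ Finset.Icc 1 N, (ArithmeticFunction.moebius n : ℝ) * ((n : ℝ) ^ 2)⁻¹ with hP
  set Q := ∑ d ∈ Finset.Icc 1 N, (ArithmeticFunction.moebius d : ℝ) * (saw (x / d) ^ 2 - 1 / 4) with hQ
  set U := ∑ d ∈ Finset.Ioc N X, (ArithmeticFunction.moebius d : ℝ) * c d with hU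
  have hPb : |P - 6 / π ^ 2| ≤ 3 * δ / N := abs_sum_moebius_div_sq_sub_le hN hδ hA
  have hQb : |Q| ≤ N / 4 := by
    calc |Q| ≤ ∑ d ∈ Finset.Icc 1 N, |(ArithmeticFunction.moebius d : ℝ) * (saw (x / d) ^ 2 - 1 / 4)| :=
          Finset.abs_sum_le_sum_abs _ _
      _ ≤ ∑ d ∈ Finset.Icc 1 N, (1 / 4 : ℝ) := by
          refine Finset.sum_le_sum fun d _ => ?_
          rw [abs_mul]
          have h1 := abs_moebius_le_one_real d
          have h2 : |saw (x / d) ^ 2 - 1 / 4| ≤ 1 / 4 := by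
            have := abs_le.mp (abs_saw_le (x / d))
            rw [abs_le]; constructor <;> nlinarith
          calc _ ≤ 1 * (1 / 4 : ℝ) := by gcongr
            _ = _ := one_mul _
      _ = _ := by simp; ring
  have hUb : |U| ≤ 3 * δ * (2 * x ^ 2) / N := by
    refine abs_sum_moebius_mul_le hN hNx hδ (fun n _ => by positivity) (fun n hn => ?_) (fun n hn => ?_)
      (by positivity) hA
    · simp only [hc]
      have : X / (n + 1) ≤ X / n := Nat.div_le_div_left (by omega) (by omega)
      gcongr
    · simp only [hc]
      have hn0 : (0:ℝ) < n := by exact_mod_cast (by omega : 0 < n)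
      have h1 : ((X / n : ℕ) : ℝ) ≤ x / n := by rw [hq]; exact Nat.floor_le (by positivity)
      have h2 : ((X / n : ℕ) : ℝ) ≤ ((X / n : ℕ) : ℝ) ^ 2 := by exact_mod_cast Nat.le_self_pow (by norm_num) _
      have h3 : ((X / n : ℕ) : ℝ) ^ 2 ≤ (x / n) ^ 2 := by gcongr
      have h4 : (x / n) ^ 2 = x ^ 2 * ((n : ℝ) ^ 2)⁻¹ := by field_simp
      linarith
  have hR : Rtilde x + sawSum (Finset.Icc 1 N) x =
      x / 2 * (P - 6 / π ^ 2) + Q / (2 * x) + U / (2 * x) := by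
    rw [Rtilde, if_neg hx, Rerr, ← hX, sum_totient_eq, hsplit, sawSum]
    have := Real.pi_pos
    field_simp
    ring
  rw [hR]
  have t1 : |x / 2 * (P - 6 / π ^ 2)| ≤ x / 2 * (3 * δ / N) := by
    rw [abs_mul, abs_of_pos (by positivity : 0 < x / 2)]; gcongr
  have t2 : |Q / (2 * x)| ≤ N / 4 / (2 * x) := by
    rw [abs_div, abs_of_pos (by positivity : 0 < 2 * x)]; gcongr
  have t3 : |U / (2 * x)| ≤ 3 * δ * (2 * x ^ 2) / N / (2 * x) := by
    rw [abs_div, abs_of_pos (by positivity : 0 < 2 * x)]; gcongr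
  have t4 : N / 4 / (2 * x) = N / (8 * x) := by field_simp; norm_num
  have t5 : 3 * δ * (2 * x ^ 2) / N / (2 * x) = 3 * (δ * x / N) := by field_simp
  have t6 : x / 2 * (3 * δ / N) = 3 / 2 * (δ * x / N) := by field_simp
  have t7 : 5 * δ * x / N = 5 * (δ * x / N) := by field_simp
  have t8 : 0 ≤ δ * x / N := by positivity
  rw [t4] at t2; rw [t5] at t3; rw [t6] at t1; rw [t7]
  have a1 := abs_add_le (x / 2 * (P - 6 / π ^ 2) + Q / (2 * x)) (U / (2 * x))
  have a2 := abs_add_le (x / 2 * (P - 6 / π ^ 2)) (Q / (2 * x))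
  linarith

lemma sum_Icc_inv_le (N : ℕ) : ∑ d ∈ Finset.Icc 1 N, (d : ℝ)⁻¹ ≤ 1 + Real.log N := by
  have := harmonic_le_one_add_log N
  rw [harmonic_eq_sum_Icc] at this
  push_cast at this
  exact this

lemma abs_sawSum_le_sum_inv (D : Finset ℕ) (u : ℝ) : |sawSum D u| ≤ 1 / 2 * ∑ d ∈ D, (d : ℝ)⁻¹ := by
  unfold sawSum
  rw [Finset.mul_sum]
  refine (Finset.abs_sum_le_sum_abs _ _).trans (Finset.sum_le_sum fun d _ => ?_)
  rw [abs_mul, abs_div, Nat.abs_cast, div_eq_mul_inv, mul_comm]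
  have h1 := abs_moebius_le_one_real d
  have h2 := abs_saw_le (u / d)
  have h3 : (0:ℝ) ≤ (d:ℝ)⁻¹ := by positivity
  calc |saw (u / d)| * (|(ArithmeticFunction.moebius d : ℝ)| * (d : ℝ)⁻¹) ≤ 1 / 2 * (1 * (d:ℝ)⁻¹) := by gcongr
    _ = _ := by ring

lemma abs_Rtilde_le {x y : ℝ} (hx : Int.fract x ≠ 0) (hx0 : 0 < x) (hxy : x ≤ y) (hy : 1 ≤ y) :
    |Rtilde x| ≤ 12 + Real.log y := by
  have hly : 0 ≤ Real.log y := Real.log_nonneg hy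
  rcases lt_or_ge x 1 with h1 | h1
  · have hfl : ⌊x⌋₊ = 0 := Nat.floor_eq_zero.mpr h1
    have : Rtilde x = - (3 / π ^ 2 * x) := by
      rw [Rtilde, if_neg hx, Rerr, hfl]
      simp; field_simp
    rw [this, abs_neg, abs_of_nonneg (by positivity)]
    have hpi : 3 / π ^ 2 ≤ 1 := by
      rw [div_le_one (by positivity)]; nlinarith [Real.pi_gt_three]
    nlinarith [show 0 < 3 / π ^ 2 by positivity]
  · have hN : 1 ≤ ⌊x⌋₊ := Nat.le_floor (by exact_mod_cast h1)
    have hN1 : (1:ℝ) ≤ ⌊x⌋₊ := by exact_mod_cast hN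
    have h2 : (⌊x⌋₊ : ℝ) ≤ x := Nat.floor_le hx0.le
    have h3 := Nat.lt_floor_add_one x
    have hmain := abs_Rtilde_add_sawSum_le hx hN le_rfl (δ := 1) zero_le_one (fun j _ => by
      have := abs_sum_moebius_le_card (Finset.Icc 1 j)
      rw [Nat.card_Icc, Nat.add_sub_cancel] at this
      linarith)
    have h4 := (abs_sawSum_le_sum_inv (Finset.Icc 1 ⌊x⌋₊) x).trans
      (mul_le_mul_of_nonneg_left (sum_Icc_inv_le _) (by norm_num))
    have h5 : Real.log ⌊x⌋₊ ≤ Real.log y := Real.log_le_log (by linarith) (by linarith)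
    have h6 : 5 * 1 * x / (⌊x⌋₊ : ℝ) ≤ 10 := by
      rw [div_le_iff₀ (by linarith)]; linarith
    have h7 : (⌊x⌋₊ : ℝ) / (8 * x) ≤ 1 := by
      rw [div_le_one (by linarith)]; linarith
    have h8 : |Rtilde x| ≤ |Rtilde x + sawSum (Finset.Icc 1 ⌊x⌋₊) x| + |sawSum (Finset.Icc 1 ⌊x⌋₊) x| := by
      have := abs_sub (Rtilde x + sawSum (Finset.Icc 1 ⌊x⌋₊) x) (sawSum (Finset.Icc 1 ⌊x⌋₊) x)
      rwa [add_sub_cancel_right] at this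
    linarith

lemma ae_fract_ne_zero : ∀ᵐ x : ℝ, Int.fract x ≠ 0 := by
  have : {x : ℝ | ¬ Int.fract x ≠ 0} ⊆ Set.range ((↑) : ℤ → ℝ) := by
    intro x hx
    simp only [ne_eq, not_not, Set.mem_ofPred_eq] at hx
    exact ⟨⌊x⌋, by have := Int.self_sub_floor x; rw [hx] at this; linarith⟩
  exact measure_mono_null this ((Set.countable_range _).measure_zero _)

lemma measurable_saw : Measurable saw := by
  unfold saw
  exact Measurable.ite (measurableSet_eq_fun measurable_fract measurable_const) measurable_const
    (measurable_fract.sub_const _)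

lemma measurable_sawSum (D : Finset ℕ) : Measurable (sawSum D) := by
  unfold sawSum
  exact Finset.measurable_sum _ fun d _ => (measurable_saw.comp (measurable_id.div_const _)).const_mul _

lemma measurable_Rtilde : Measurable Rtilde := by
  unfold Rtilde Rerr
  have h1 : Measurable fun x : ℝ => ∑ n ∈ Finset.range (⌊x⌋₊ + 1), (Nat.totient n : ℝ) :=
    (measurable_of_countable (fun X : ℕ => ∑ n ∈ Finset.range (X + 1), (Nat.totient n : ℝ))).comp
      Nat.measurable_floor
  have h2 : Measurable fun x : ℝ => (Nat.totient ⌊x⌋₊ : ℝ) :=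
    (measurable_of_countable (fun X : ℕ => (Nat.totient X : ℝ))).comp Nat.measurable_floor
  refine ((h1.sub (by fun_prop)).div measurable_id).sub (Measurable.div ?_ (by fun_prop))
  exact Measurable.ite (measurableSet_eq_fun measurable_fract measurable_const) h2 measurable_const

/-- Bounded measurable functions. -/
structure Tame (f : ℝ → ℝ) : Prop where
  meas : Measurable f
  bdd : ∃ C, 0 ≤ C ∧ ∀ x, |f x| ≤ C

namespace Tame

lemma intervalIntegrable {f : ℝ → ℝ} (hf : Tame f) (a b : ℝ) : IntervalIntegrable f volume a b := by
  obtain ⟨C, -, hC⟩ := hf.bdd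
  refine (intervalIntegrable_const (c := C)).mono_fun hf.meas.aestronglyMeasurable ?_
  refine Filter.Eventually.of_forall fun x => ?_
  exact (hC x).trans (le_abs_self C)

lemma const (c : ℝ) : Tame (fun _ => c) := ⟨measurable_const, |c|, abs_nonneg c, fun _ => le_rfl⟩

lemma mul {f g : ℝ → ℝ} (hf : Tame f) (hg : Tame g) : Tame (fun x => f x * g x) := by
  obtain ⟨C, hC0, hC⟩ := hf.bdd
  obtain ⟨D, hD0, hD⟩ := hg.bdd
  refine ⟨hf.meas.mul hg.meas, C * D, by positivity, fun x => ?_⟩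
  rw [abs_mul]; have := hC x; have := hD x; gcongr

lemma add {f g : ℝ → ℝ} (hf : Tame f) (hg : Tame g) : Tame (fun x => f x + g x) := by
  obtain ⟨C, hC0, hC⟩ := hf.bdd
  obtain ⟨D, hD0, hD⟩ := hg.bdd
  exact ⟨hf.meas.add hg.meas, C + D, by positivity, fun x =>
    (abs_add_le _ _).trans (add_le_add (hC x) (hD x))⟩

lemma sum {ι : Type*} {s : Finset ι} {f : ι → ℝ → ℝ} (hf : ∀ i ∈ s, Tame (f i)) :
    Tame (fun x => ∑ i ∈ s, f i x) := by
  induction s using Finset.induction_on with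
  | empty => simpa using const 0
  | insert a s ha ih =>
    simp only [Finset.sum_insert ha]
    exact (hf a (by simp)).add (ih fun i hi => hf i (by simp [hi]))

lemma prod {ι : Type*} {s : Finset ι} {f : ι → ℝ → ℝ} (hf : ∀ i ∈ s, Tame (f i)) :
    Tame (fun x => ∏ i ∈ s, f i x) := by
  induction s using Finset.induction_on with
  | empty => simpa using const 1
  | insert a s ha ih =>
    simp only [Finset.prod_insert ha]
    exact (hf a (by simp)).mul (ih fun i hi => hf i (by simp [hi]))

lemma pow {f : ℝ → ℝ} (hf : Tame f) (k : ℕ) : Tame (fun x => f x ^ k) := by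
  have := prod (s := Finset.range k) (f := fun _ => f) fun _ _ => hf
  simpa using this

end Tame

lemma tame_saw_div (d : ℝ) : Tame (fun x => saw (x / d)) :=
  ⟨measurable_saw.comp (measurable_id.div_const d), 1 / 2, by norm_num, fun _ => abs_saw_le _⟩

lemma tame_sawSum (D : Finset ℕ) : Tame (sawSum D) :=
  ⟨measurable_sawSum D, _, by positivity, fun x => abs_sawSum_le_sum_inv D x⟩

/-- The mean of a function over `[0, L]`. -/
noncomputable def perMean (f : ℝ → ℝ) (L : ℕ) : ℝ := (1 / (L : ℝ)) * ∫ x in (0 : ℝ)..L, f x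

lemma periodic_mul_nat {f : ℝ → ℝ} {L : ℕ} (hp : Function.Periodic f L) (k : ℕ) :
    Function.Periodic f ((L * k : ℕ) : ℝ) := by
  have := hp.nat_mul k
  push_cast; rwa [mul_comm]

lemma periodic_of_dvd {f : ℝ → ℝ} {L M : ℕ} (hp : Function.Periodic f L) (h : L ∣ M) :
    Function.Periodic f (M : ℝ) := by
  obtain ⟨k, rfl⟩ := h
  exact periodic_mul_nat hp k

lemma integral_zero_mul {f : ℝ → ℝ} (hf : Tame f) {L : ℝ} (hp : Function.Periodic f L) (k : ℕ) :
    ∫ x in (0 : ℝ)..k * L, f x = k * ∫ x in (0 : ℝ)..L, f x := by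
  have := hp.intervalIntegral_add_zsmul_eq k 0 hf.intervalIntegrable
  simpa using this

lemma perMean_mul {f : ℝ → ℝ} (hf : Tame f) {L : ℕ} (hp : Function.Periodic f L) {k : ℕ} (hk : k ≠ 0) :
    perMean f (L * k) = perMean f L := by
  have hk' : (k : ℝ) ≠ 0 := by exact_mod_cast hk
  unfold perMean
  push_cast
  rw [mul_comm (L : ℝ) k, integral_zero_mul hf hp]
  by_cases hL : (L : ℝ) = 0
  · simp [hL]
  · field_simp

lemma perMean_eq {f : ℝ → ℝ} (hf : Tame f) {L M : ℕ} (hL : L ≠ 0) (hM : M ≠ 0)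
    (hpL : Function.Periodic f L) (hpM : Function.Periodic f M) : perMean f L = perMean f M := by
  rw [← perMean_mul hf hpL hM, mul_comm, perMean_mul hf hpM hL]

lemma abs_perMean_le {f : ℝ → ℝ} {C : ℝ} (hC0 : 0 ≤ C) (hC : ∀ x, |f x| ≤ C) (L : ℕ) : |perMean f L| ≤ C := by
  unfold perMean
  by_cases hL : L = 0
  · simp [hL, hC0]
  have hL0 : (0 : ℝ) < L := by positivity
  have := intervalIntegral.norm_integral_le_of_norm_le_const (a := 0) (b := (L : ℝ)) (f := f) (C := C)
    (fun x _ => by simpa using hC x)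
  rw [Real.norm_eq_abs, sub_zero, abs_of_pos hL0] at this
  rw [abs_mul, abs_of_pos (by positivity)]
  rw [one_div_mul_eq_div, div_le_iff₀ hL0]; exact this

/-- The integral of a periodic function over `[0, X]`. -/
lemma abs_integral_sub_mul_perMean_le {f : ℝ → ℝ} (hf : Tame f) {C : ℝ} (hC0 : 0 ≤ C) (hC : ∀ x, |f x| ≤ C)
    {L : ℕ} (hL : L ≠ 0) (hp : Function.Periodic f L) {X : ℝ} (hX : 0 ≤ X) :
    |(∫ x in (0 : ℝ)..X, f x) - X * perMean f L| ≤ 2 * L * C := by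
  have hL0 : (0 : ℝ) < L := by positivity
  set m := ⌊X / L⌋₊ with hm
  have h1 : (m : ℝ) * L ≤ X := by
    have := Nat.floor_le (show 0 ≤ X / L by positivity)
    rwa [le_div_iff₀ hL0] at this
  have h2 : X < (m : ℝ) * L + L := by
    have := Nat.lt_floor_add_one (X / L)
    rw [div_lt_iff₀ hL0, add_mul, one_mul] at this
    exact this
  have h3 : (∫ x in (0 : ℝ)..X, f x) = m * (L * perMean f L) + ∫ x in (m * L : ℝ)..X, f x := by
    rw [← intervalIntegral.integral_add_adjacent_intervals (hf.intervalIntegrable 0 (m * L))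
      (hf.intervalIntegrable _ _), integral_zero_mul hf hp]
    unfold perMean; field_simp
  have h4 : |∫ x in (m * L : ℝ)..X, f x| ≤ C * L := by
    have := intervalIntegral.norm_integral_le_of_norm_le_const (a := (m * L : ℝ)) (b := X) (f := f) (C := C)
      (fun x _ => by simpa using hC x)
    rw [Real.norm_eq_abs, abs_of_nonneg (show 0 ≤ X - m * L by linarith)] at this
    refine this.trans ?_
    gcongr; linarith
  have h5 := abs_perMean_le hC0 hC L
  have h6 : |(X - m * L) * perMean f L| ≤ L * C := by
    rw [abs_mul, abs_of_nonneg (by linarith)]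
    gcongr; linarith
  rw [h3, abs_le]
  rw [abs_le] at h4 h6
  constructor <;> nlinarith

lemma saw_add_one (x : ℝ) : saw (x + 1) = saw x := by simp [saw]

lemma periodic_saw_div {d : ℕ} (hd : d ≠ 0) : Function.Periodic (fun x => saw (x / d)) (d : ℝ) := by
  intro x
  have : (d : ℝ) ≠ 0 := by exact_mod_cast hd
  simp only [add_div, div_self this, saw_add_one]

lemma periodic_saw : Function.Periodic saw 1 := saw_add_one

lemma saw_neg (x : ℝ) : saw (-x) = - saw x := by
  unfold saw
  by_cases h : Int.fract x = 0
  · have : Int.fract (-x) = 0 := by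
      rw [Int.fract_eq_zero_iff] at h ⊢; obtain ⟨z, hz⟩ := h; exact ⟨-z, by simp [hz]⟩
    simp [h, this]
  · have := Int.fract_neg h
    have h2 : Int.fract (-x) ≠ 0 := by
      rw [this]; linarith [Int.fract_lt_one x]
    rw [if_neg h, if_neg h2, this]; ring

/-- The distribution relation of the sawtooth function. -/
lemma sum_saw_add_div {p : ℕ} (hp : p ≠ 0) (v : ℝ) :
    ∑ h ∈ Finset.range p, saw (v + h / p) = saw (p * v) := by
  have hp0 : (0 : ℝ) < p := by positivity
  set S : ℝ → ℝ := fun v => ∑ h ∈ Finset.range p, saw (v + h / p) with hS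
  have hper : Function.Periodic S (1 / p) := by
    intro v
    simp only [hS]
    have h1 := Finset.sum_range_succ (fun h : ℕ => saw (v + h / p)) p
    have h2 := Finset.sum_range_succ' (fun h : ℕ => saw (v + h / p)) p
    rw [h2, div_self hp0.ne', saw_add_one] at h1
    simp only [Nat.cast_zero, zero_div, add_zero] at h1
    rw [← add_right_cancel h1]
    refine Finset.sum_congr rfl fun h _ => ?_
    congr 1; push_cast; field_simp; ring
  set k := ⌊p * v⌋ with hk
  set r := Int.fract (p * v) with hr
  have hv : v - k • (1 / (p : ℝ)) = r / p := by
    have := Int.self_sub_floor (p * v)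
    rw [← hk, ← hr] at this
    rw [← this]; simp; field_simp
  change S v = _
  rw [← hper.sub_zsmul_eq k, hv]
  have hr0 : 0 ≤ r := Int.fract_nonneg _
  have hr1 : r < 1 := Int.fract_lt_one _
  have hfr : ∀ h ∈ Finset.range p, Int.fract (r / p + h / p) = r / p + h / p := by
    intro h hh
    rw [Int.fract_eq_self]
    refine ⟨by positivity, ?_⟩
    rw [← add_div, div_lt_one hp0]
    have : (h : ℝ) + 1 ≤ p := by exact_mod_cast Finset.mem_range.mp hh
    linarith
  have hgauss : ∑ h ∈ Finset.range p, (h : ℝ) = p * (p - 1) / 2 := by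
    have := Finset.sum_range_id_mul_two p
    have h2 : ((∑ h ∈ Finset.range p, h : ℕ) : ℝ) * 2 = p * (p - 1) := by
      rw [← Nat.cast_pred (by omega)]; exact_mod_cast this
    push_cast at h2; linarith
  by_cases h0 : r = 0
  · have e1 : saw (p * v) = 0 := by unfold saw; rw [← hr, h0]; simp
    rw [e1]
    obtain ⟨q, rfl⟩ : ∃ q, p = q + 1 := ⟨p - 1, by omega⟩
    simp only [hS, Finset.sum_range_succ']
    have : ∀ h ∈ Finset.range q, saw (r / ((q + 1 : ℕ) : ℝ) + ((h + 1 : ℕ) : ℝ) / ((q + 1 : ℕ) : ℝ)) =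
        ((h + 1 : ℕ) : ℝ) / ((q + 1 : ℕ) : ℝ) - 1 / 2 := by
      intro h hh
      have := hfr (h + 1) (by simpa using hh)
      rw [saw_of_fract_ne_zero, this, h0]
      · simp
      · rw [this, h0, zero_div, zero_add]; positivity
    rw [Finset.sum_congr rfl this, h0]
    rw [Finset.sum_sub_distrib, ← Finset.sum_div]
    rw [Finset.sum_range_succ'] at hgauss
    simp only [Nat.cast_zero, add_zero] at hgauss
    rw [hgauss]
    simp [saw]; field_simp; ring
  · have e1 : saw (p * v) = r - 1 / 2 := by rw [saw_of_fract_ne_zero h0]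
    rw [e1]
    have : ∀ h ∈ Finset.range p, saw (r / p + h / p) = r / p + h / p - 1 / 2 := by
      intro h hh
      rw [saw_of_fract_ne_zero, hfr h hh]
      rw [hfr h hh]
      have : 0 < r := lt_of_le_of_ne hr0 (Ne.symm h0)
      positivity
    simp only [hS]
    rw [Finset.sum_congr rfl this]
    rw [Finset.sum_sub_distrib, Finset.sum_add_distrib, ← Finset.sum_div, ← Finset.sum_div, hgauss]
    simp; field_simp; ring

/-- Removal of a prime dividing the modulus of just one sawtooth factor. -/
lemma perMean_mul_saw_div {G : ℝ → ℝ} (hG : Tame G) {L d p : ℕ} (hL : L ≠ 0) (hGp : Function.Periodic G L)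
    (hd : d ∣ L) (hp : p.Prime) (hpL : ¬ p ∣ L / d) :
    perMean (fun u => G u * saw (u / ((p * d : ℕ) : ℝ))) (p * L) =
      (1 / (p : ℝ)) * perMean (fun u => G u * saw (u / d)) L := by
  obtain ⟨e, rfl⟩ := hd
  have hd0 : d ≠ 0 := by rintro rfl; simp at hL
  have he0 : e ≠ 0 := by rintro rfl; simp at hL
  rw [Nat.mul_div_cancel_left _ (Nat.pos_of_ne_zero hd0)] at hpL
  obtain ⟨b, -, hb⟩ := Nat.exists_mul_mod_eq_one_of_coprime
    ((Nat.Prime.coprime_iff_not_dvd hp).2 hpL).symm hp.one_lt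
  set f : ℝ → ℝ := fun u => G u * saw (u / ((p * d : ℕ) : ℝ)) with hf
  have hft : Tame f := hG.mul (tame_saw_div _)
  have hpd : p * d ≠ 0 := mul_ne_zero hp.ne_zero hd0
  have hfp : Function.Periodic f ((p * (d * e) : ℕ) : ℝ) :=
    (periodic_of_dvd hGp (Dvd.intro_left p rfl)).mul (periodic_of_dvd (periodic_saw_div hpd) ⟨e, by ring⟩)
  have hgt : Tame (fun u => G u * saw (u / d)) := hG.mul (tame_saw_div _)
  have hgp : Function.Periodic (fun u => G u * saw (u / d)) ((d * e : ℕ) : ℝ) :=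
    hGp.mul (periodic_of_dvd (periodic_saw_div hd0) ⟨e, rfl⟩)
  have hp0 : (p : ℝ) ≠ 0 := by exact_mod_cast hp.ne_zero
  have hd0' : (d : ℝ) ≠ 0 := by exact_mod_cast hd0
  have he0' : (e : ℝ) ≠ 0 := by exact_mod_cast he0
  set P : ℝ := ((p * (d * e) : ℕ) : ℝ) with hP
  have hshift : ∀ h : ℕ, ∫ u in (0:ℝ)..P, f u = ∫ u in (0:ℝ)..P, G u * saw (u / ((p * d : ℕ) : ℝ) + h / p) := by
    intro h
    have h1 := hfp.intervalIntegral_add_eq 0 (h * b * (d * e) : ℝ)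
    rw [zero_add] at h1
    rw [h1]
    have h2 := intervalIntegral.integral_comp_add_right (a := 0) (b := P) f (h * b * (d * e) : ℝ)
    rw [zero_add, add_comm P] at h2
    rw [← h2]
    refine intervalIntegral.integral_congr fun u _ => ?_
    simp only [hf]
    have e1 : G (u + h * b * (d * e)) = G u := by
      have := periodic_mul_nat hGp (h * b) u
      push_cast at this
      rw [← this]; congr 1; ring
    rw [e1]; congr 1
    have hk : (e : ℝ) * b = p * ((e * b / p : ℕ) : ℝ) + 1 := by
      have := Nat.div_add_mod (e * b) p
      rw [hb] at this
      exact_mod_cast this.symm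
    have e2 : (u + h * b * (d * e)) / ((p * d : ℕ) : ℝ) =
        u / ((p * d : ℕ) : ℝ) + h / p + ((h * (e * b / p) : ℕ) : ℝ) * 1 := by
      push_cast
      field_simp
      linear_combination h * d * hk
    rw [e2]
    exact periodic_saw.nat_mul _ _
  have hsum : (p : ℝ) * ∫ u in (0:ℝ)..P, f u = ∫ u in (0:ℝ)..P, G u * saw (u / d) := by
    have : ∀ u : ℝ, G u * saw (u / d) = ∑ h ∈ Finset.range p, G u * saw (u / ((p * d : ℕ) : ℝ) + h / p) := by
      intro u
      rw [← Finset.mul_sum, sum_saw_add_div hp.ne_zero]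
      congr 2; push_cast; field_simp
    simp only [this]
    rw [intervalIntegral.integral_finsetSum]
    · rw [← Finset.sum_congr rfl (fun h _ => hshift h)]; simp
    · intro h _
      refine (hG.mul (g := fun u => saw (u / ((p * d : ℕ) : ℝ) + h / p)) ⟨?_, 1/2, by norm_num, fun _ => abs_saw_le _⟩).intervalIntegrable _ _
      exact measurable_saw.comp ((measurable_id.div_const _).add_const _)
  have hPe : P = p * ((d * e : ℕ) : ℝ) := by simp [hP]
  rw [hPe, integral_zero_mul hgt hgp, ← hPe] at hsum
  have hsum2 := mul_left_cancel₀ hp0 hsum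
  unfold perMean
  rw [← hP, hsum2, hPe]
  push_cast; field_simp

lemma tame_prod_saw {l : ℕ} (n : Fin l → ℕ) : Tame (fun x => ∏ j, saw (x / n j)) :=
  Tame.prod fun _ _ => tame_saw_div _

lemma periodic_prod {ι : Type*} {s : Finset ι} {f : ι → ℝ → ℝ} {c : ℝ} (h : ∀ i ∈ s, Function.Periodic (f i) c) :
    Function.Periodic (fun x => ∏ i ∈ s, f i x) c := fun x =>
  Finset.prod_congr rfl fun i hi => h i hi x

lemma periodic_sum {ι : Type*} {s : Finset ι} {f : ι → ℝ → ℝ} {c : ℝ} (h : ∀ i ∈ s, Function.Periodic (f i) c) :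
    Function.Periodic (fun x => ∑ i ∈ s, f i x) c := fun x =>
  Finset.sum_congr rfl fun i hi => h i hi x

lemma periodic_prod_saw {l : ℕ} {n : Fin l → ℕ} (hn : ∀ j, n j ≠ 0) {L : ℕ} (hL : ∀ j, n j ∣ L) :
    Function.Periodic (fun x => ∏ j, saw (x / n j)) (L : ℝ) :=
  periodic_prod fun j _ => periodic_of_dvd (periodic_saw_div (hn j)) (hL j)

lemma abs_prod_saw_le {ι : Type*} (s : Finset ι) (x : ι → ℝ) : |∏ j ∈ s, saw (x j)| ≤ 1 := by
  rw [Finset.abs_prod]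
  exact Finset.prod_le_one (fun _ _ => abs_nonneg _) fun j _ => (abs_saw_le _).trans (by norm_num)

lemma Bcorr_eq_perMean {l : ℕ} (n : Fin l → ℕ) :
    Bcorr n = perMean (fun x => ∏ j, saw (x / n j)) (∏ j, n j) := by
  unfold Bcorr perMean; push_cast; rfl

lemma Bcorr_eq_perMean_of_dvd {l : ℕ} {n : Fin l → ℕ} (hn : ∀ j, n j ≠ 0) {L : ℕ} (hL0 : L ≠ 0)
    (hL : ∀ j, n j ∣ L) : Bcorr n = perMean (fun x => ∏ j, saw (x / n j)) L := by
  rw [Bcorr_eq_perMean]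
  exact perMean_eq (tame_prod_saw n) (Finset.prod_ne_zero_iff.2 fun j _ => hn j) hL0
    (periodic_prod_saw hn fun j => Finset.dvd_prod_of_mem _ (Finset.mem_univ j)) (periodic_prod_saw hn hL)

lemma abs_Bcorr_le_one {l : ℕ} (n : Fin l → ℕ) : |Bcorr n| ≤ 1 := by
  rw [Bcorr_eq_perMean]
  exact abs_perMean_le zero_le_one (fun x => abs_prod_saw_le _ _) _

lemma Bcorr_odd {l : ℕ} (hl : Odd l) {n : Fin l → ℕ} (hn : ∀ j, n j ≠ 0) : Bcorr n = 0 := by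
  have hp := periodic_prod_saw hn (L := ∏ j, n j) fun j => Finset.dvd_prod_of_mem _ (Finset.mem_univ j)
  rw [Bcorr_eq_perMean]
  unfold perMean
  set P : ℝ := ((∏ j, n j : ℕ) : ℝ)
  have h1 := intervalIntegral.integral_comp_neg (a := 0) (b := P) (fun x => ∏ j, saw (x / n j))
  have h2 : ∀ x : ℝ, ∏ j, saw (-x / n j) = - ∏ j, saw (x / n j) := by
    intro x
    simp only [neg_div, saw_neg, Finset.prod_neg, Finset.card_univ, Fintype.card_fin, hl.neg_one_pow]
    ring
  simp only [h2, intervalIntegral.integral_neg] at h1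
  have h3 := hp.intervalIntegral_add_eq (-P) 0
  simp only [neg_add_cancel, zero_add] at h3
  rw [neg_zero, h3] at h1
  have : ∫ (x : ℝ) in (0:ℝ)..P, ∏ j, saw (x / n j) = 0 := by linarith
  rw [this, mul_zero]

/-- The product of the primes dividing `N`. -/
def primeRad (N : ℕ) : ℕ := ∏ p ∈ N.primeFactors, p

lemma primeRad_pos (N : ℕ) : 0 < primeRad N :=
  Finset.prod_pos fun _ hp => (Nat.prime_of_mem_primeFactors hp).pos

lemma primeRad_prime_mul {p N : ℕ} (hp : p.Prime) (hN : N ≠ 0) (h : ¬ p ∣ N) :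
    primeRad (p * N) = p * primeRad N := by
  unfold primeRad
  rw [Nat.primeFactors_mul hp.ne_zero hN, hp.primeFactors, Finset.prod_union, Finset.prod_singleton]
  rw [Finset.disjoint_singleton_left]
  exact fun h' => h (Nat.dvd_of_mem_primeFactors h')

lemma squarefree_primeRad (N : ℕ) : Squarefree (primeRad N) := by
  unfold primeRad
  refine Finset.squarefree_prod_of_pairwise_isCoprime ?_ fun p hp => (Nat.prime_of_mem_primeFactors hp).squarefree
  intro p hp q hq hpq
  simp only [Function.onFun]
  rw [← Nat.coprime_iff_isRelPrime]
  exact (Nat.coprime_primes (Nat.prime_of_mem_primeFactors hp) (Nat.prime_of_mem_primeFactors hq)).2 hpq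

lemma dvd_primeRad {m N : ℕ} (hN : N ≠ 0) (hm : Squarefree m) (h : m ∣ N) : m ∣ primeRad N := by
  rw [← Nat.prod_primeFactors_of_squarefree hm]
  exact Finset.prod_dvd_prod_of_subset _ _ _ (Nat.primeFactors_mono h hN)

lemma primeRad_sq_dvd {N : ℕ} (h : ∀ p ∈ N.primeFactors, p ^ 2 ∣ N) : primeRad N ^ 2 ∣ N := by
  unfold primeRad
  rw [← Finset.prod_pow]
  refine Finset.prod_dvd_of_isRelPrime ?_ h
  intro p hp q hq hpq
  simp only [Function.onFun]
  rw [← Nat.coprime_iff_isRelPrime]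
  exact Nat.Coprime.pow _ _ ((Nat.coprime_primes (Nat.prime_of_mem_primeFactors hp) (Nat.prime_of_mem_primeFactors hq)).2 hpq)

lemma Bcorr_prime_step {l : ℕ} {n : Fin l → ℕ} (hn : ∀ j, n j ≠ 0) {i : Fin l} {p d : ℕ} (hp : p.Prime)
    (hi : n i = p * d) (hj : ∀ j, j ≠ i → ¬ p ∣ n j) :
    Bcorr n = (1 / (p : ℝ)) * Bcorr (Function.update n i d) := by
  set E := ∏ j ∈ Finset.univ.erase i, n j with hE
  have hE0 : E ≠ 0 := Finset.prod_ne_zero_iff.2 fun j _ => hn j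
  have hd0 : d ≠ 0 := by rintro rfl; exact hn i (by simpa using hi)
  have hpE : ¬ p ∣ E := by
    rw [hE, hp.prime.dvd_finsetProd_iff]
    rintro ⟨j, hj1, hj2⟩
    exact hj j (Finset.ne_of_mem_erase hj1) hj2
  have hdE : ∀ j, j ≠ i → n j ∣ E := fun j h => Finset.dvd_prod_of_mem _ (by simp [h])
  have h1 : Bcorr n = perMean (fun x => (∏ j ∈ Finset.univ.erase i, saw (x / n j)) * saw (x / ((p * d : ℕ) : ℝ))) (p * (d * E)) := by
    rw [Bcorr_eq_perMean_of_dvd hn (L := p * (d * E)) (mul_ne_zero hp.ne_zero (mul_ne_zero hd0 hE0))]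
    · congr 1; ext x
      rw [← Finset.prod_erase_mul _ _ (Finset.mem_univ i), hi]
    · intro j
      by_cases h : j = i
      · rw [h, hi]; exact ⟨E, by ring⟩
      · exact (hdE j h).trans ⟨p * d, by ring⟩
  have h2 : Bcorr (Function.update n i d) = perMean (fun x => (∏ j ∈ Finset.univ.erase i, saw (x / n j)) * saw (x / d)) (d * E) := by
    rw [Bcorr_eq_perMean_of_dvd (L := d * E) _ (mul_ne_zero hd0 hE0)]
    · congr 1; ext x
      rw [← Finset.prod_erase_mul _ _ (Finset.mem_univ i)]
      congr 1
      · refine Finset.prod_congr rfl fun j hj => ?_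
        rw [Function.update_of_ne (Finset.ne_of_mem_erase hj)]
      · simp
    · intro j
      by_cases h : j = i
      · subst h; simp
      · rw [Function.update_of_ne h]; exact (hdE j h).trans ⟨d, by ring⟩
    · intro j
      by_cases h : j = i
      · subst h; simpa using hd0
      · rw [Function.update_of_ne h]; exact hn j
  rw [h1, h2]
  refine perMean_mul_saw_div (Tame.prod fun _ _ => tame_saw_div _) (mul_ne_zero hd0 hE0) ?_ ⟨E, rfl⟩ hp ?_
  · exact periodic_prod fun j hj => periodic_of_dvd (periodic_saw_div (hn j))
      ((hdE j (Finset.ne_of_mem_erase hj)).trans ⟨d, by ring⟩)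
  · rwa [Nat.mul_div_cancel_left _ (Nat.pos_of_ne_zero hd0)]

lemma abs_Bcorr_le {l : ℕ} (N : ℕ) : ∀ n : Fin l → ℕ, (∀ j, Squarefree (n j)) → ∏ j, n j = N →
    |Bcorr n| ≤ N / (primeRad N : ℝ) ^ 2 := by
  induction N using Nat.strong_induction_on with
  | _ N ih =>
  intro n hn hN
  have hn0 : ∀ j, n j ≠ 0 := fun j => (hn j).ne_zero
  have hN0 : N ≠ 0 := by rw [← hN]; exact Finset.prod_ne_zero_iff.2 fun j _ => hn0 j
  have hr0 : ∀ m, (0:ℝ) < primeRad m := fun m => by exact_mod_cast primeRad_pos m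
  by_cases h : ∃ i p, p.Prime ∧ p ∣ n i ∧ ∀ j, j ≠ i → ¬ p ∣ n j
  · obtain ⟨i, p, hp, ⟨d, hd⟩, hj⟩ := h
    have hpd : ¬ p ∣ d := by
      rintro ⟨e, rfl⟩
      have := hn i p ⟨e, by rw [hd]; ring⟩
      exact hp.ne_one (Nat.isUnit_iff.1 this)
    have hd0 : d ≠ 0 := by rintro rfl; exact hpd (dvd_zero p)
    set E := ∏ j ∈ Finset.univ.erase i, n j with hE
    have hE0 : E ≠ 0 := Finset.prod_ne_zero_iff.2 fun j _ => hn0 j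
    have hpE : ¬ p ∣ E := by
      rw [hE, hp.prime.dvd_finsetProd_iff]
      rintro ⟨j, hj1, hj2⟩
      exact hj j (Finset.ne_of_mem_erase hj1) hj2
    have hNe : N = p * (E * d) := by
      rw [← hN, ← Finset.prod_erase_mul _ _ (Finset.mem_univ i), hd]; ring
    have hN' : ∏ j, Function.update n i d j = E * d := by
      rw [← Finset.prod_erase_mul _ _ (Finset.mem_univ i)]
      congr 1
      · exact Finset.prod_congr rfl fun j hj => Function.update_of_ne (Finset.ne_of_mem_erase hj) _ _
      · simp
    have hEd : ¬ p ∣ E * d := by rw [hp.dvd_mul]; tauto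
    have hb := ih (E * d) (by
      rw [hNe]; exact lt_mul_of_one_lt_left (Nat.pos_of_ne_zero (mul_ne_zero hE0 hd0)) hp.one_lt)
      (Function.update n i d) (by
        intro j
        by_cases hji : j = i
        · subst hji; simpa using (hn j).squarefree_of_dvd ⟨p, by rw [hd]; ring⟩
        · rw [Function.update_of_ne hji]; exact hn j) hN'
    rw [Bcorr_prime_step hn0 hp hd hj, hNe, primeRad_prime_mul hp (mul_ne_zero hE0 hd0) hEd, abs_mul]
    have hp0 : (0:ℝ) < p := by exact_mod_cast hp.pos
    rw [abs_of_pos (by positivity)]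
    have hr := hr0 (E * d)
    calc 1 / (p:ℝ) * |Bcorr (Function.update n i d)| ≤ 1 / (p:ℝ) * (((E * d : ℕ) : ℝ) / (primeRad (E * d) : ℝ) ^ 2) := by gcongr
      _ = _ := by push_cast; field_simp
  · push Not at h
    refine (abs_Bcorr_le_one n).trans ?_
    rw [le_div_iff₀ (pow_pos (hr0 N) 2), one_mul]
    have : primeRad N ^ 2 ∣ N := by
      refine primeRad_sq_dvd fun p hp => ?_
      have hpp := Nat.prime_of_mem_primeFactors hp
      have hpN := Nat.dvd_of_mem_primeFactors hp
      rw [← hN, hpp.prime.dvd_finsetProd_iff] at hpN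
      obtain ⟨i, -, hi⟩ := hpN
      obtain ⟨j, hji, hj⟩ := h i p hpp hi
      rw [← hN, ← Finset.mul_prod_erase _ _ (Finset.mem_univ i), sq]
      exact mul_dvd_mul hi (hj.trans (Finset.dvd_prod_of_mem _ (by simp [hji])))
    exact_mod_cast Nat.le_of_dvd (Nat.pos_of_ne_zero hN0) this

/-- The general term of the series defining `M_R(l)`. -/
noncomputable def MRterm {l : ℕ} (n : Fin l → ℕ) : ℝ :=
  (∏ j, (ArithmeticFunction.moebius (n j) : ℝ)) * Bcorr n / ∏ j, (n j : ℝ)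

lemma MRterm_eq_zero {l : ℕ} {n : Fin l → ℕ} {j : Fin l} (h : ¬ Squarefree (n j)) : MRterm n = 0 := by
  unfold MRterm
  rw [Finset.prod_eq_zero (Finset.mem_univ j)]
  · simp
  · simp [ArithmeticFunction.moebius_eq_zero_of_not_squarefree h]

lemma abs_MRterm_le {l : ℕ} {n : Fin l → ℕ} (hn : ∀ j, Squarefree (n j)) :
    |MRterm n| ≤ 1 / (primeRad (∏ j, n j) : ℝ) ^ 2 := by
  have hN : (0:ℝ) < ∏ j, (n j : ℝ) := Finset.prod_pos fun j _ => by
    exact_mod_cast Nat.pos_of_ne_zero (hn j).ne_zero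
  have h1 := abs_Bcorr_le _ n hn rfl
  have h2 : |∏ j, (ArithmeticFunction.moebius (n j) : ℝ)| ≤ 1 := by
    rw [Finset.abs_prod]
    exact Finset.prod_le_one (fun _ _ => abs_nonneg _) fun j _ => abs_moebius_le_one_real _
  unfold MRterm
  rw [abs_div, abs_mul, abs_of_pos hN, div_le_iff₀ hN]
  calc _ ≤ 1 * |Bcorr n| := by gcongr
    _ ≤ _ := by rw [one_mul]; refine h1.trans (le_of_eq ?_); push_cast; ring

lemma card_divisors_pow_le (l : ℕ) {d : ℕ} (hd : Squarefree d) :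
    (d.divisors.card : ℝ) ^ l ≤ (2 ^ l) ^ (4 ^ l) * Real.sqrt d := by
  have h1 : d.divisors.card = ∏ p ∈ d.primeFactors, 2 := by
    rw [Nat.card_divisors hd.ne_zero]
    refine Finset.prod_congr rfl fun p hp => ?_
    rw [Nat.factorization_eq_one_of_squarefree hd (Nat.prime_of_mem_primeFactors hp) (Nat.dvd_of_mem_primeFactors hp)]
  have h2 : Real.sqrt d = ∏ p ∈ d.primeFactors, Real.sqrt p := by
    conv_lhs => rw [← Nat.prod_primeFactors_of_squarefree hd]
    push_cast
    simp only [Real.sqrt_eq_rpow]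
    rw [Real.finsetProd_rpow _ (fun i : ℕ => (i : ℝ)) (fun i _ => by positivity)]
  rw [h1, h2]
  push_cast
  rw [← Finset.prod_pow]
  have h3 : ∀ p ∈ d.primeFactors, (2:ℝ) ^ l ≤ (if p < 4 ^ l then 2 ^ l else 1) * Real.sqrt p := by
    intro p hp
    split_ifs with h
    · have : 1 ≤ Real.sqrt p := by
        rw [Real.one_le_sqrt]; exact_mod_cast (Nat.prime_of_mem_primeFactors hp).one_le
      nlinarith [show (0:ℝ) < 2 ^ l by positivity]
    · rw [one_mul]
      apply Real.le_sqrt_of_sq_le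
      push Not at h
      rw [← pow_mul, mul_comm, pow_mul]; norm_num
      exact_mod_cast h
  refine (Finset.prod_le_prod (fun _ _ => by positivity) h3).trans ?_
  rw [Finset.prod_mul_distrib]
  gcongr
  rw [← Finset.prod_filter, Finset.prod_const]
  refine pow_le_pow_right₀ (one_le_pow₀ (by norm_num)) ?_
  calc _ ≤ (Finset.range (4 ^ l)).card := Finset.card_le_card fun p hp => by
        simpa using (Finset.mem_filter.1 hp).2
    _ = _ := Finset.card_range _

lemma summable_MRterm (l : ℕ) : Summable (fun n : Fin l → ℕ => MRterm n) := by
  set K : ℝ := (2 ^ l) ^ (4 ^ l)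
  have hs : Summable (fun d : ℕ => K * ((d : ℝ) ^ (3 / 2 : ℝ))⁻¹) :=
    (Real.summable_nat_rpow_inv.2 (by norm_num)).mul_left K
  refine Summable.of_abs ?_
  refine summable_of_sum_le (c := ∑' d : ℕ, K * ((d : ℝ) ^ (3 / 2 : ℝ))⁻¹) (fun _ => abs_nonneg _) fun s => ?_
  set s' := s.filter fun n => ∀ j, Squarefree (n j) with hs'
  have h1 : ∑ n ∈ s, |MRterm n| = ∑ n ∈ s', |MRterm n| := by
    symm
    refine Finset.sum_subset (Finset.filter_subset _ _) fun n hn hn' => ?_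
    simp only [hs', Finset.mem_filter, hn, true_and, not_forall] at hn'
    obtain ⟨j, hj⟩ := hn'
    rw [MRterm_eq_zero hj, abs_zero]
  set r : (Fin l → ℕ) → ℕ := fun n => primeRad (∏ j, n j) with hr
  rw [h1, ← Finset.sum_fiberwise_of_maps_to (t := s'.image r) (g := r) fun n hn => Finset.mem_image_of_mem _ hn]
  refine le_trans (Finset.sum_le_sum fun d hd => ?_)
    (hs.sum_le_tsum (s'.image r) fun d _ => by positivity)
  have hdsq : Squarefree d := by
    obtain ⟨n, -, rfl⟩ := Finset.mem_image.1 hd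
    exact squarefree_primeRad _
  have hd0 : (0:ℝ) < d := by exact_mod_cast Nat.pos_of_ne_zero hdsq.ne_zero
  calc ∑ n ∈ s' with r n = d, |MRterm n| ≤ ∑ n ∈ s' with r n = d, 1 / (d:ℝ) ^ 2 := by
        refine Finset.sum_le_sum fun n hn => ?_
        rw [Finset.mem_filter] at hn
        rw [← hn.2]
        exact abs_MRterm_le (Finset.mem_filter.1 hn.1).2
    _ = ((s'.filter fun n => r n = d).card : ℝ) * (1 / (d:ℝ) ^ 2) := by rw [Finset.sum_const, nsmul_eq_mul]
    _ ≤ ((d.divisors.card : ℝ) ^ l) * (1 / (d:ℝ) ^ 2) := by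
        gcongr
        have : (s'.filter fun n => r n = d) ⊆ Fintype.piFinset fun _ : Fin l => d.divisors := by
          intro n hn
          rw [Finset.mem_filter] at hn
          have hsq := (Finset.mem_filter.1 hn.1).2
          rw [Fintype.mem_piFinset]
          intro j
          rw [Nat.mem_divisors]
          refine ⟨?_, hdsq.ne_zero⟩
          rw [← hn.2]
          exact dvd_primeRad (Finset.prod_ne_zero_iff.2 fun j _ => (hsq j).ne_zero) (hsq j)
            (Finset.dvd_prod_of_mem _ (Finset.mem_univ j))
        have := Finset.card_le_card this
        rw [Fintype.card_piFinset_const] at this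
        exact_mod_cast this
    _ ≤ (K * Real.sqrt d) * (1 / (d:ℝ) ^ 2) := by
        gcongr; exact card_divisors_pow_le l hdsq
    _ = K * ((d : ℝ) ^ (3 / 2 : ℝ))⁻¹ := by
        rw [mul_assoc]; congr 1
        rw [Real.sqrt_eq_rpow, one_div, one_div, ← Real.rpow_natCast, ← Real.rpow_neg hd0.le, ← Real.rpow_neg hd0.le, ← Real.rpow_add hd0]
        norm_num

lemma MR_eq_tsum (l : ℕ) : MR l = ∑' n : Fin l → ℕ, MRterm n := by
  have hinj : Function.Injective (fun (n : Fin l → ℕ+) (j : Fin l) => (n j : ℕ)) := by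
    intro a b h; funext j; exact PNat.coe_injective (congrFun h j)
  have := hinj.tsum_eq (f := fun n : Fin l → ℕ => MRterm n) ?_
  · rw [← this]; rfl
  · intro n hn
    refine ⟨fun j => ⟨n j, ?_⟩, rfl⟩
    by_contra h0
    refine hn (MRterm_eq_zero (j := j) ?_)
    have : n j = 0 := by omega
    rw [this]; exact not_squarefree_zero

lemma hasSum_MR (l : ℕ) : HasSum (fun n : Fin l → ℕ => MRterm n) (MR l) := by
  rw [MR_eq_tsum]; exact (summable_MRterm l).hasSum

lemma MR_odd {l : ℕ} (hl : Odd l) : MR l = 0 := by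
  unfold MR
  simp [Bcorr_odd hl]

/-- The truncated mean value of the `l`-th power of `sawSum D`. -/
noncomputable def MRfin (l : ℕ) (D : Finset ℕ) : ℝ := ∑ n ∈ Fintype.piFinset (fun _ : Fin l => D), MRterm n

lemma MRfin_odd {l : ℕ} (hl : Odd l) {D : Finset ℕ} (hD : ∀ d ∈ D, d ≠ 0) : MRfin l D = 0 := by
  refine Finset.sum_eq_zero fun n hn => ?_
  rw [Fintype.mem_piFinset] at hn
  simp [MRterm, Bcorr_odd hl fun j => hD _ (hn j)]

lemma tendsto_MRfin (l : ℕ) {D : ℕ → Finset ℕ} (hmono : Monotone D) (hD : ∀ n : ℕ, Squarefree n → ∃ k, n ∈ D k) :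
    Filter.Tendsto (fun k => MRfin l (D k)) Filter.atTop (nhds (MR l)) := by
  set E : ℕ → Finset ℕ := fun k => D k ∪ (Finset.range k).filter fun n => ¬ Squarefree n with hE
  have hEmono : Monotone E := fun a b hab => Finset.union_subset_union (hmono hab)
    (Finset.filter_subset_filter _ (Finset.range_mono hab))
  have h1 : ∀ k, MRfin l (D k) = ∑ n ∈ Fintype.piFinset (fun _ : Fin l => E k), MRterm n := by
    intro k
    refine Finset.sum_subset (Fintype.piFinset_subset _ _ fun _ => Finset.subset_union_left) fun n hn hn' => ?_
    rw [Fintype.mem_piFinset] at hn hn'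
    push Not at hn'
    obtain ⟨j, hj⟩ := hn'
    refine MRterm_eq_zero (j := j) ?_
    have := hn j
    rw [hE, Finset.mem_union, Finset.mem_filter] at this
    tauto
  simp only [h1]
  refine (hasSum_MR l).comp (Filter.tendsto_atTop_finset_of_monotone ?_ ?_)
  · intro a b hab
    exact Fintype.piFinset_subset _ _ fun _ => hEmono hab
  · intro n
    have : ∀ j, ∃ k, n j ∈ E k := by
      intro j
      by_cases h : Squarefree (n j)
      · obtain ⟨k, hk⟩ := hD _ h
        exact ⟨k, Finset.mem_union_left _ hk⟩
      · exact ⟨n j + 1, Finset.mem_union_right _ (by simp [h])⟩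
    choose k hk using this
    refine ⟨Finset.univ.sup k, ?_⟩
    rw [Fintype.mem_piFinset]
    intro j
    exact hEmono (Finset.le_sup (Finset.mem_univ j)) (hk j)

lemma sawSum_pow (D : Finset ℕ) (l : ℕ) (u : ℝ) :
    sawSum D u ^ l = ∑ n ∈ Fintype.piFinset (fun _ : Fin l => D),
      (∏ j, (ArithmeticFunction.moebius (n j) : ℝ)) / (∏ j, (n j : ℝ)) * ∏ j, saw (u / n j) := by
  have h := Finset.prod_univ_sum (fun _ : Fin l => D)
    (fun (_ : Fin l) d => (ArithmeticFunction.moebius d : ℝ) / d * saw (u / d))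
  rw [Finset.prod_const, Finset.card_univ, Fintype.card_fin] at h
  unfold sawSum
  rw [h]
  refine Finset.sum_congr rfl fun n _ => ?_
  rw [Finset.prod_mul_distrib, Finset.prod_div_distrib]

lemma periodic_sawSum {D : Finset ℕ} (hD : ∀ d ∈ D, d ≠ 0) {L : ℕ} (hL : ∀ d ∈ D, d ∣ L) :
    Function.Periodic (sawSum D) L := by
  unfold sawSum
  refine periodic_sum fun d hd x => ?_
  have := periodic_of_dvd (periodic_saw_div (hD d hd)) (hL d hd) x
  exact congrArg _ this

lemma perMean_sawSum_pow {D : Finset ℕ} (hD : ∀ d ∈ D, d ≠ 0) (l : ℕ) {L : ℕ} (hL0 : L ≠ 0) (hL : ∀ d ∈ D, d ∣ L) :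
    perMean (fun u => sawSum D u ^ l) L = MRfin l D := by
  unfold perMean MRfin
  simp only [sawSum_pow]
  rw [intervalIntegral.integral_finsetSum fun n _ => ((Tame.const _).mul (tame_prod_saw n)).intervalIntegrable _ _,
    Finset.mul_sum]
  refine Finset.sum_congr rfl fun n hn => ?_
  rw [Fintype.mem_piFinset] at hn
  rw [intervalIntegral.integral_const_mul]
  unfold MRterm
  rw [Bcorr_eq_perMean_of_dvd (fun j => hD _ (hn j)) hL0 (fun j => hL _ (hn j))]
  unfold perMean; ring

/-- Finite-length averages of powers of `sawSum D`. -/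
lemma abs_integral_sawSum_pow_sub_le {D : Finset ℕ} (hD : ∀ d ∈ D, d ≠ 0) (l : ℕ) {X : ℝ} (hX : 0 ≤ X) :
    |(∫ u in (0:ℝ)..X, sawSum D u ^ l) - X * MRfin l D| ≤ 2 * (D.card : ℝ) ^ l := by
  unfold MRfin
  simp only [sawSum_pow]
  rw [intervalIntegral.integral_finsetSum fun n _ => ((Tame.const _).mul (tame_prod_saw n)).intervalIntegrable _ _,
    Finset.mul_sum, ← Finset.sum_sub_distrib]
  refine (Finset.abs_sum_le_sum_abs _ _).trans ?_
  have : ∀ n ∈ Fintype.piFinset (fun _ : Fin l => D),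
      |(∫ u in (0:ℝ)..X, (∏ j, (ArithmeticFunction.moebius (n j) : ℝ)) / (∏ j, (n j : ℝ)) * ∏ j, saw (u / n j)) -
        X * MRterm n| ≤ 2 := by
    intro n hn
    rw [Fintype.mem_piFinset] at hn
    have hn0 : ∀ j, n j ≠ 0 := fun j => hD _ (hn j)
    have hP : ∏ j, n j ≠ 0 := Finset.prod_ne_zero_iff.2 fun j _ => hn0 j
    have hP0 : (0:ℝ) < ∏ j, (n j : ℝ) := Finset.prod_pos fun j _ => by
      exact_mod_cast Nat.pos_of_ne_zero (hn0 j)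
    have h := abs_integral_sub_mul_perMean_le (tame_prod_saw n) zero_le_one (fun x => abs_prod_saw_le _ _) hP
      (periodic_prod_saw hn0 fun j => Finset.dvd_prod_of_mem _ (Finset.mem_univ j)) hX
    rw [← Bcorr_eq_perMean] at h
    have h2 : |∏ j, (ArithmeticFunction.moebius (n j) : ℝ)| ≤ 1 := by
      rw [Finset.abs_prod]
      exact Finset.prod_le_one (fun _ _ => abs_nonneg _) fun j _ => abs_moebius_le_one_real _
    rw [intervalIntegral.integral_const_mul]
    have e : (∏ j, (ArithmeticFunction.moebius (n j) : ℝ)) / (∏ j, (n j : ℝ)) * (∫ u in (0:ℝ)..X, ∏ j, saw (u / n j)) -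
        X * MRterm n = (∏ j, (ArithmeticFunction.moebius (n j) : ℝ)) / (∏ j, (n j : ℝ)) *
        ((∫ u in (0:ℝ)..X, ∏ j, saw (u / n j)) - X * Bcorr n) := by
      unfold MRterm; ring
    rw [e, abs_mul, abs_div, abs_of_pos hP0, div_mul_eq_mul_div, div_le_iff₀ hP0]
    push_cast at h
    calc _ ≤ 1 * (2 * (∏ j, (n j : ℝ)) * 1) := by gcongr
      _ = _ := by ring
  refine (Finset.sum_le_sum this).trans ?_
  rw [Finset.sum_const, Fintype.card_piFinset_const, nsmul_eq_mul]
  push_cast; rw [mul_comm]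

lemma divisors_prime_mul {p Q : ℕ} (hp : p.Prime) (hQ : Q ≠ 0) :
    (p * Q).divisors = Q.divisors ∪ Q.divisors.image (p * ·) := by
  ext d
  simp only [Nat.mem_divisors, Finset.mem_union, Finset.mem_image]
  constructor
  · rintro ⟨hd, -⟩
    by_cases hpd : p ∣ d
    · obtain ⟨e, rfl⟩ := hpd
      exact Or.inr ⟨e, ⟨Nat.dvd_of_mul_dvd_mul_left hp.pos hd, hQ⟩, rfl⟩
    · exact Or.inl ⟨(((Nat.Prime.coprime_iff_not_dvd hp).2 hpd).symm).dvd_of_dvd_mul_left hd, hQ⟩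
  · rintro (⟨hd, -⟩ | ⟨e, ⟨he, -⟩, rfl⟩)
    · exact ⟨hd.trans ⟨p, by ring⟩, mul_ne_zero hp.ne_zero hQ⟩
    · exact ⟨mul_dvd_mul_left p he, mul_ne_zero hp.ne_zero hQ⟩

lemma sum_divisors_prime_mul {p Q : ℕ} (hp : p.Prime) (hQ : Q ≠ 0) (h : ¬ p ∣ Q) (f : ℕ → ℝ) :
    ∑ d ∈ (p * Q).divisors, f d = ∑ d ∈ Q.divisors, f d + ∑ d ∈ Q.divisors, f (p * d) := by
  rw [divisors_prime_mul hp hQ, Finset.sum_union, Finset.sum_image]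
  · intro a _ b _ hab; exact Nat.eq_of_mul_eq_mul_left hp.pos hab
  · rw [Finset.disjoint_left]
    intro d hd hd'
    obtain ⟨e, -, rfl⟩ := Finset.mem_image.1 hd'
    exact h ((Dvd.intro e rfl).trans (Nat.dvd_of_mem_divisors hd))

lemma sawSum_divisors_prime_mul {p Q : ℕ} (hp : p.Prime) (hQ : Q ≠ 0) (h : ¬ p ∣ Q) (u : ℝ) :
    sawSum (p * Q).divisors u = sawSum Q.divisors u - (1 / p) * sawSum Q.divisors (u / p) := by
  unfold sawSum
  rw [sum_divisors_prime_mul hp hQ h, sub_eq_add_neg, Finset.mul_sum, ← Finset.sum_neg_distrib]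
  congr 1
  refine Finset.sum_congr rfl fun d hd => ?_
  have hpd : ¬ p ∣ d := fun h' => h (h'.trans (Nat.dvd_of_mem_divisors hd))
  rw [ArithmeticFunction.isMultiplicative_moebius.map_mul_of_coprime ((Nat.Prime.coprime_iff_not_dvd hp).2 hpd),
    ArithmeticFunction.moebius_apply_prime hp]
  rw [div_div u]
  push_cast
  have hp0 : (p : ℝ) ≠ 0 := by exact_mod_cast hp.ne_zero
  have hd0 : (d : ℝ) ≠ 0 := by exact_mod_cast (Nat.pos_of_mem_divisors hd).ne'
  field_simp

lemma perMean_add {f g : ℝ → ℝ} (hf : Tame f) (hg : Tame g) (L : ℕ) :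
    perMean (fun x => f x + g x) L = perMean f L + perMean g L := by
  unfold perMean
  rw [intervalIntegral.integral_add (hf.intervalIntegrable _ _) (hg.intervalIntegrable _ _), mul_add]

lemma perMean_const_mul (f : ℝ → ℝ) (c : ℝ) (L : ℕ) :
    perMean (fun x => c * f x) L = c * perMean f L := by
  unfold perMean
  rw [intervalIntegral.integral_const_mul]; ring

lemma perMean_sum {ι : Type*} {s : Finset ι} {f : ι → ℝ → ℝ} (hf : ∀ i ∈ s, Tame (f i)) (L : ℕ) :
    perMean (fun x => ∑ i ∈ s, f i x) L = ∑ i ∈ s, perMean (f i) L := by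
  unfold perMean
  rw [intervalIntegral.integral_finsetSum fun i hi => (hf i hi).intervalIntegrable _ _, Finset.mul_sum]

lemma perMean_mono {f g : ℝ → ℝ} (hf : Tame f) (hg : Tame g) (h : ∀ x, f x ≤ g x) (L : ℕ) :
    perMean f L ≤ perMean g L := by
  unfold perMean
  gcongr
  exact intervalIntegral.integral_mono_on (by positivity) (hf.intervalIntegrable _ _) (hg.intervalIntegrable _ _)
    fun x _ => h x

lemma perMean_comp_div (f : ℝ → ℝ) {p : ℕ} (hp : p ≠ 0) (L : ℕ) :
    perMean (fun x => f (x / p)) (p * L) = perMean f L := by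
  have hp0 : (p : ℝ) ≠ 0 := by exact_mod_cast hp
  unfold perMean
  rw [intervalIntegral.integral_comp_div _ hp0]
  push_cast
  rw [zero_div, mul_div_cancel_left₀ _ hp0, smul_eq_mul]
  by_cases hL : (L : ℝ) = 0
  · simp [hL]
  · field_simp

lemma Tame.comp_div {f : ℝ → ℝ} (hf : Tame f) (c : ℝ) : Tame (fun x => f (x / c)) := by
  obtain ⟨C, h0, hC⟩ := hf.bdd
  exact ⟨hf.meas.comp (measurable_id.div_const c), C, h0, fun x => hC _⟩

lemma divisors_ne_zero {Q : ℕ} : ∀ d ∈ Q.divisors, d ≠ 0 := fun _ hd => (Nat.pos_of_mem_divisors hd).ne'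

lemma periodic_sawSum_divisors {Q : ℕ} : Function.Periodic (sawSum Q.divisors) Q :=
  periodic_sawSum divisors_ne_zero fun _ hd => Nat.dvd_of_mem_divisors hd

lemma perMean_pow_mul_sawSum_div {p Q : ℕ} (hp : p.Prime) (hQ : Q ≠ 0) (h : ¬ p ∣ Q) (k : ℕ) :
    perMean (fun u => sawSum Q.divisors u ^ k * sawSum Q.divisors (u / p)) (p * Q) =
      (1 / p) * perMean (fun u => sawSum Q.divisors u ^ (k + 1)) Q := by
  have hG : Tame (fun u => sawSum Q.divisors u ^ k) := (tame_sawSum _).pow k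
  have hGp : Function.Periodic (fun u => sawSum Q.divisors u ^ k) Q := fun x => by
    simp only [periodic_sawSum_divisors x]
  have e1 : ∀ u, sawSum Q.divisors u ^ k * sawSum Q.divisors (u / p) =
      ∑ d ∈ Q.divisors, (ArithmeticFunction.moebius d : ℝ) / d *
        (sawSum Q.divisors u ^ k * saw (u / ((p * d : ℕ) : ℝ))) := by
    intro u
    conv_lhs => rw [show sawSum Q.divisors (u / p) = ∑ d ∈ Q.divisors, (ArithmeticFunction.moebius d : ℝ) / d * saw (u / p / d) from rfl]
    rw [Finset.mul_sum]
    refine Finset.sum_congr rfl fun d _ => ?_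
    rw [div_div u]; push_cast; ring
  have e2 : ∀ u, sawSum Q.divisors u ^ (k + 1) =
      ∑ d ∈ Q.divisors, (ArithmeticFunction.moebius d : ℝ) / d * (sawSum Q.divisors u ^ k * saw (u / d)) := by
    intro u
    rw [pow_succ]
    conv_lhs => rw [show sawSum Q.divisors u = ∑ d ∈ Q.divisors, (ArithmeticFunction.moebius d : ℝ) / d * saw (u / d) from rfl]
    rw [Finset.mul_sum]
    exact Finset.sum_congr rfl fun d _ => by simp only [sawSum]; ring
  simp only [e1, e2]
  rw [perMean_sum fun d _ => (Tame.const _).mul (hG.mul (tame_saw_div _)),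
    perMean_sum fun d _ => (Tame.const _).mul (hG.mul (tame_saw_div _)), Finset.mul_sum]
  refine Finset.sum_congr rfl fun d hd => ?_
  have hdQ := Nat.dvd_of_mem_divisors hd
  rw [perMean_const_mul, perMean_const_mul, perMean_mul_saw_div hG hQ hGp hdQ hp
    (fun h' => h (h'.trans (Nat.div_dvd_of_dvd hdQ)))]
  ring

lemma MRfin_divisors {Q : ℕ} (hQ : Q ≠ 0) (l : ℕ) :
    MRfin l Q.divisors = perMean (fun u => sawSum Q.divisors u ^ l) Q :=
  (perMean_sawSum_pow divisors_ne_zero l hQ fun _ hd => Nat.dvd_of_mem_divisors hd).symm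

lemma MRfin_two_prime_mul {p Q : ℕ} (hp : p.Prime) (hQ : Q ≠ 0) (h : ¬ p ∣ Q) :
    MRfin 2 (p * Q).divisors = (1 - 1 / (p : ℝ) ^ 2) * MRfin 2 Q.divisors := by
  have hF := tame_sawSum Q.divisors
  rw [MRfin_divisors (mul_ne_zero hp.ne_zero hQ), MRfin_divisors hQ]
  have e : ∀ u, sawSum (p * Q).divisors u ^ 2 = sawSum Q.divisors u ^ 2 +
      ((-(2 / p)) * (sawSum Q.divisors u ^ 1 * sawSum Q.divisors (u / p)) +
      (1 / (p : ℝ) ^ 2) * sawSum Q.divisors (u / p) ^ 2) := by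
    intro u; rw [sawSum_divisors_prime_mul hp hQ h]; ring
  simp only [e]
  have hFd := hF.comp_div (p : ℝ)
  rw [perMean_add (hF.pow 2) (((Tame.const _).mul ((hF.pow 1).mul hFd)).add ((Tame.const _).mul (hFd.pow 2))),
    perMean_add ((Tame.const _).mul ((hF.pow 1).mul hFd)) ((Tame.const _).mul (hFd.pow 2)),
    perMean_const_mul, perMean_const_mul, perMean_pow_mul_sawSum_div hp hQ h,
    perMean_comp_div (fun u => sawSum Q.divisors u ^ 2) hp.ne_zero, mul_comm p Q,
    perMean_mul (hF.pow 2) (fun x => by simp only [periodic_sawSum_divisors x]) hp.ne_zero]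
  have hp0 : (p : ℝ) ≠ 0 := by exact_mod_cast hp.ne_zero
  field_simp; ring

lemma abs_pow_mul_abs_pow_le {l k : ℕ} (hl : Even l) (hk : k ≤ l) (a b : ℝ) : |a| ^ (l - k) * |b| ^ k ≤ a ^ l + b ^ l := by
  rw [← hl.pow_abs a, ← hl.pow_abs b]
  have ha := abs_nonneg a
  have hb := abs_nonneg b
  rcases le_total |a| |b| with h | h
  · calc |a| ^ (l - k) * |b| ^ k ≤ |b| ^ (l - k) * |b| ^ k := by gcongr
      _ = |b| ^ l := by rw [← pow_add, Nat.sub_add_cancel hk]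
      _ ≤ _ := by linarith [pow_nonneg ha l]
  · calc |a| ^ (l - k) * |b| ^ k ≤ |a| ^ (l - k) * |a| ^ k := by gcongr
      _ = |a| ^ l := by rw [← pow_add, Nat.sub_add_cancel hk]
      _ ≤ _ := by linarith [pow_nonneg hb l]

lemma sub_mul_pow_le {l : ℕ} (hl : Even l) (hl2 : 2 ≤ l) {s : ℝ} (hs : 0 ≤ s) (hls : l * s ≤ 1) (a b : ℝ) :
    (a - s * b) ^ l ≤ a ^ l + -(l * s) * (a ^ (l - 1) * b) + (l * s) ^ 2 * (a ^ l + b ^ l) := by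
  obtain ⟨m, rfl⟩ : ∃ m, l = m + 2 := ⟨l - 2, by omega⟩
  set l := m + 2 with hl'
  have hN : 0 ≤ a ^ l + b ^ l := add_nonneg (hl.pow_nonneg a) (hl.pow_nonneg b)
  have e1 : ∀ x y : ℝ, (x + y) ^ l = ∑ k ∈ Finset.range (l + 1), x ^ (l - k) * y ^ k * (l.choose k : ℝ) := by
    intro x y
    rw [add_comm, add_pow]
    exact Finset.sum_congr rfl fun k _ => by ring
  have h1 := e1 a (-(s * b))
  have h2 := e1 1 s
  rw [hl', Finset.sum_range_succ', Finset.sum_range_succ', ← hl'] at h1 h2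
  simp only [one_pow, one_mul, pow_zero, mul_one, Nat.choose_zero_right, Nat.cast_one, Nat.sub_zero, zero_add,
    pow_one, Nat.choose_one_right] at h1 h2
  have h3 : ∑ k ∈ Finset.range (m + 1), a ^ (l - (k + 1 + 1)) * (-(s * b)) ^ (k + 1 + 1) * (l.choose (k + 1 + 1) : ℝ) ≤
      (∑ k ∈ Finset.range (m + 1), s ^ (k + 1 + 1) * (l.choose (k + 1 + 1) : ℝ)) * (a ^ l + b ^ l) := by
    rw [Finset.sum_mul]
    refine Finset.sum_le_sum fun k hk => ?_
    have hk' : k + 1 + 1 ≤ l := by have := Finset.mem_range.1 hk; omega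
    calc _ ≤ |a ^ (l - (k + 1 + 1)) * (-(s * b)) ^ (k + 1 + 1) * (l.choose (k + 1 + 1) : ℝ)| := le_abs_self _
      _ = s ^ (k + 1 + 1) * (l.choose (k + 1 + 1) : ℝ) * (|a| ^ (l - (k + 1 + 1)) * |b| ^ (k + 1 + 1)) := by
        rw [abs_mul, abs_mul, abs_pow, abs_pow, abs_neg, abs_mul, abs_of_nonneg hs, Nat.abs_cast, mul_pow]; ring
      _ ≤ _ := by
        gcongr; exact abs_pow_mul_abs_pow_le hl hk' a b
  have h4 : ∑ k ∈ Finset.range (m + 1), s ^ (k + 1 + 1) * (l.choose (k + 1 + 1) : ℝ) ≤ (l * s) ^ 2 := by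
    have h5 : (1 + s) ^ l ≤ Real.exp (l * s) := by
      rw [Real.exp_nat_mul]
      gcongr
      rw [add_comm]; exact Real.add_one_le_exp s
    have h6 := Real.abs_exp_sub_one_sub_id_le (x := l * s) (by rw [abs_of_nonneg (by positivity)]; exact hls)
    have h7 := le_abs_self (Real.exp (l * s) - 1 - l * s)
    linarith
  have h5 := mul_le_mul_of_nonneg_right h4 hN
  have h6 : l - 1 = m + 1 := by omega
  rw [show a - s * b = a + -(s * b) by ring, h1]
  nlinarith

lemma MRfin_nonneg {l : ℕ} (hl : Even l) {Q : ℕ} (hQ : Q ≠ 0) : 0 ≤ MRfin l Q.divisors := by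
  rw [MRfin_divisors hQ]
  unfold perMean
  exact mul_nonneg (by positivity) (intervalIntegral.integral_nonneg (by positivity) fun u _ => hl.pow_nonneg _)

lemma MRfin_prime_mul_le {l : ℕ} (hl : Even l) (hl2 : 2 ≤ l) {p Q : ℕ} (hp : p.Prime) (hQ : Q ≠ 0) (h : ¬ p ∣ Q)
    (hlp : l ≤ p) :
    MRfin l (p * Q).divisors ≤ (1 + 2 * (l : ℝ) ^ 2 / (p : ℝ) ^ 2) * MRfin l Q.divisors := by
  have hF := tame_sawSum Q.divisors
  have hp0 : (0 : ℝ) < p := by exact_mod_cast hp.pos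
  have hM := MRfin_nonneg hl hQ
  rw [MRfin_divisors (mul_ne_zero hp.ne_zero hQ)]
  rw [MRfin_divisors hQ] at hM ⊢
  have hFd := hF.comp_div (p : ℝ)
  have t1 := (Tame.const (-(l * (1 / (p : ℝ))))).mul ((hF.pow (l - 1)).mul hFd)
  have t2 := (Tame.const ((l * (1 / (p : ℝ))) ^ 2)).mul ((hF.pow l).add (hFd.pow l))
  have hle := perMean_mono ((tame_sawSum (p * Q).divisors).pow l) (((hF.pow l).add t1).add t2) (fun u => by
    rw [sawSum_divisors_prime_mul hp hQ h]
    refine sub_mul_pow_le hl hl2 (by positivity) ?_ _ _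
    rw [mul_one_div, div_le_one hp0]; exact_mod_cast hlp) (p * Q)
  refine hle.trans ?_
  rw [perMean_add ((hF.pow l).add t1) t2, perMean_add (hF.pow l) t1, perMean_const_mul, perMean_const_mul,
    perMean_add (hF.pow l) (hFd.pow l), perMean_pow_mul_sawSum_div hp hQ h,
    perMean_comp_div (fun u => sawSum Q.divisors u ^ l) hp.ne_zero, mul_comm p Q,
    perMean_mul (hF.pow l) (fun x => by simp only [periodic_sawSum_divisors x]) hp.ne_zero, Nat.sub_add_cancel (by omega)]
  have : (1 + 2 * (l : ℝ) ^ 2 / (p : ℝ) ^ 2) * perMean (fun u => sawSum Q.divisors u ^ l) Q -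
    (perMean (fun u => sawSum Q.divisors u ^ l) Q +
        -(l * (1 / (p:ℝ))) * (1 / p * perMean (fun u => sawSum Q.divisors u ^ l) Q) +
      (l * (1 / (p:ℝ))) ^ 2 * (perMean (fun u => sawSum Q.divisors u ^ l) Q + perMean (fun u => sawSum Q.divisors u ^ l) Q)) =
      l / (p:ℝ) ^ 2 * perMean (fun u => sawSum Q.divisors u ^ l) Q := by field_simp; ring
  have h2 : 0 ≤ l / (p:ℝ) ^ 2 * perMean (fun u => sawSum Q.divisors u ^ l) Q := by positivity
  linarith

/-- The product of the primes below `k`. -/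
def primeProd (k : ℕ) : ℕ := ∏ p ∈ Nat.primesBelow k, p

lemma primeProd_ne_zero (k : ℕ) : primeProd k ≠ 0 :=
  Finset.prod_ne_zero_iff.2 fun _ hp => (Nat.prime_of_mem_primesBelow hp).ne_zero

lemma primeProd_succ_of_prime {k : ℕ} (hk : k.Prime) : primeProd (k + 1) = k * primeProd k := by
  unfold primeProd
  rw [Nat.primesBelow_succ, if_pos hk, Finset.prod_insert (fun h => absurd (Nat.lt_of_mem_primesBelow h) (lt_irrefl _))]

lemma primeProd_succ_of_not_prime {k : ℕ} (hk : ¬ k.Prime) : primeProd (k + 1) = primeProd k := by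
  unfold primeProd
  rw [Nat.primesBelow_succ, if_neg hk]

lemma not_dvd_primeProd {k : ℕ} (hk : k.Prime) : ¬ k ∣ primeProd k := by
  unfold primeProd
  rw [hk.prime.dvd_finsetProd_iff]
  rintro ⟨p, hp, hkp⟩
  have := Nat.lt_of_mem_primesBelow hp
  exact absurd (Nat.le_of_dvd (Nat.prime_of_mem_primesBelow hp).pos hkp) (by omega)

lemma primeProd_dvd {a b : ℕ} (h : a ≤ b) : primeProd a ∣ primeProd b := by
  refine Finset.prod_dvd_prod_of_subset _ _ _ fun p hp => ?_
  rw [Nat.mem_primesBelow] at hp ⊢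
  exact ⟨by omega, hp.2⟩

lemma tendsto_MRfin_primeProd (l : ℕ) :
    Filter.Tendsto (fun k => MRfin l (primeProd k).divisors) Filter.atTop (nhds (MR l)) := by
  refine tendsto_MRfin l (fun a b hab => Nat.divisors_subset_of_dvd (primeProd_ne_zero b) (primeProd_dvd hab)) ?_
  intro n hn
  refine ⟨n + 1, Nat.mem_divisors.2 ⟨?_, primeProd_ne_zero _⟩⟩
  refine (Nat.prod_primeFactors_of_squarefree hn).symm.dvd.trans ?_
  refine Finset.prod_dvd_prod_of_subset _ _ _ fun p hp => ?_
  rw [Nat.mem_primesBelow]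
  exact ⟨Nat.lt_succ_of_le (Nat.le_of_mem_primeFactors hp), Nat.prime_of_mem_primeFactors hp⟩

lemma prod_primesBelow_succ (f : ℕ → ℝ) (k : ℕ) :
    ∏ p ∈ Nat.primesBelow (k + 1), f p = (if k.Prime then f k else 1) * ∏ p ∈ Nat.primesBelow k, f p := by
  rw [Nat.primesBelow_succ]
  split_ifs with h
  · rw [Finset.prod_insert (fun h => absurd (Nat.lt_of_mem_primesBelow h) (lt_irrefl _))]
  · rw [one_mul]

lemma primeProd_zero : primeProd 0 = 1 := by simp [primeProd, Nat.primesBelow]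

lemma perMean_saw_sq : perMean (fun u => saw u ^ 2) 1 = 1 / 12 := by
  unfold perMean
  have : ∫ x in (0:ℝ)..((1:ℕ):ℝ), saw x ^ 2 = ∫ x in (0:ℝ)..1, (x - 1 / 2) ^ 2 := by
    push_cast
    refine intervalIntegral.integral_congr_ae ?_
    have : ∀ᵐ x : ℝ, x ≠ 1 := by simp [ae_iff, measure_singleton]
    filter_upwards [this] with x hx1 hx
    rw [Set.uIoc_of_le zero_le_one] at hx
    have hf : Int.fract x = x := Int.fract_eq_self.2 ⟨hx.1.le, lt_of_le_of_ne hx.2 hx1⟩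
    rw [saw_of_fract_ne_zero (by rw [hf]; exact hx.1.ne'), hf]
  rw [this]
  rw [intervalIntegral.integral_comp_sub_right (fun x => x ^ 2)]
  rw [integral_pow]; norm_num

lemma MRfin_one_divisors (l : ℕ) : MRfin l (1:ℕ).divisors = perMean (fun u => saw u ^ l) 1 := by
  rw [MRfin_divisors one_ne_zero]
  congr 1; ext u
  simp [sawSum]

lemma MRfin_two_primeProd (k : ℕ) :
    MRfin 2 (primeProd k).divisors = 1 / 12 * ∏ p ∈ Nat.primesBelow k, (1 - 1 / (p : ℝ) ^ 2) := by
  induction k with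
  | zero => rw [primeProd_zero, MRfin_one_divisors, perMean_saw_sq]; simp [Nat.primesBelow]
  | succ k ih =>
    rw [prod_primesBelow_succ (fun p => 1 - 1 / (p : ℝ) ^ 2)]
    by_cases hk : k.Prime
    · rw [primeProd_succ_of_prime hk, MRfin_two_prime_mul hk (primeProd_ne_zero k) (not_dvd_primeProd hk), ih, if_pos hk]
      ring
    · rw [primeProd_succ_of_not_prime hk, ih, if_neg hk, one_mul]

lemma tendsto_prod_one_sub_inv_sq :
    Filter.Tendsto (fun k => ∏ p ∈ Nat.primesBelow k, (1 - 1 / (p : ℝ) ^ 2)) Filter.atTop (nhds (6 / π ^ 2)) := by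
  have h := riemannZeta_eulerProduct (s := 2) (by norm_num)
  rw [riemannZeta_two] at h
  have h0 : (π : ℂ) ^ 2 / 6 ≠ 0 := by simp [Real.pi_ne_zero]
  have h1 := (Complex.continuous_re.tendsto _).comp (h.inv₀ h0)
  have e : ((π : ℂ) ^ 2 / 6)⁻¹.re = 6 / π ^ 2 := by
    rw [show ((π : ℂ) ^ 2 / 6)⁻¹ = ((6 / π ^ 2 : ℝ) : ℂ) by push_cast; rw [inv_div]]
    exact Complex.ofReal_re _
  rw [e] at h1
  refine h1.congr fun k => ?_
  simp only [Function.comp]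
  rw [← Complex.ofReal_re (∏ p ∈ Nat.primesBelow k, (1 - 1 / (p : ℝ) ^ 2))]
  congr 1
  rw [Finset.prod_inv_distrib, inv_inv]
  push_cast
  refine Finset.prod_congr rfl fun p _ => ?_
  rw [Complex.cpow_neg]
  norm_cast
  simp

lemma MR_two : MR 2 = 1 / (2 * π ^ 2) := by
  have h := tendsto_MRfin_primeProd 2
  simp only [MRfin_two_primeProd] at h
  have h2 := tendsto_prod_one_sub_inv_sq.const_mul (1 / 12)
  rw [tendsto_nhds_unique h h2]
  field_simp; norm_num

lemma sum_divisors_primeProd_inv (k : ℕ) :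
    ∑ d ∈ (primeProd k).divisors, (d : ℝ)⁻¹ = ∏ p ∈ Nat.primesBelow k, (1 + 1 / (p : ℝ)) := by
  induction k with
  | zero => rw [primeProd_zero]; simp [Nat.primesBelow]
  | succ k ih =>
    rw [prod_primesBelow_succ (fun p => 1 + 1 / (p : ℝ))]
    by_cases hk : k.Prime
    · rw [primeProd_succ_of_prime hk, sum_divisors_prime_mul hk (primeProd_ne_zero k) (not_dvd_primeProd hk), ih, if_pos hk, ← ih,
        add_mul, one_mul, Finset.mul_sum]
      congr 1
      refine Finset.sum_congr rfl fun d _ => ?_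
      push_cast; rw [mul_inv, one_div]
    · rw [primeProd_succ_of_not_prime hk, ih, if_neg hk, one_mul]

lemma MRfin_primeProd_le {l : ℕ} (hl : Even l) (hl2 : 2 ≤ l) {k : ℕ} (hk : l ≤ k) :
    MRfin l (primeProd (k + 1)).divisors ≤ MRfin l (primeProd (l + 1)).divisors *
      Real.exp (2 * (l : ℝ) ^ 2 * ∑ p ∈ (Nat.primesBelow (k + 1)).filter (l < ·), 1 / (p : ℝ) ^ 2) := by
  induction k, hk using Nat.le_induction with
  | base =>
    rw [Finset.filter_false_of_mem]
    · simp
    · intro p hp; have := Nat.lt_of_mem_primesBelow hp; omega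
  | succ k hk ih =>
    by_cases hp : (k + 1).Prime
    · rw [primeProd_succ_of_prime hp, Nat.primesBelow_succ (k + 1), if_pos hp, Finset.filter_insert, if_pos (by omega), Finset.sum_insert]
      · refine (MRfin_prime_mul_le hl hl2 hp (primeProd_ne_zero _) (not_dvd_primeProd hp) (by omega)).trans ?_
        rw [mul_add, Real.exp_add]
        calc _ ≤ Real.exp (2 * (l : ℝ) ^ 2 * (1 / ((k + 1 : ℕ) : ℝ) ^ 2)) * (MRfin l (primeProd (l + 1)).divisors *
              Real.exp (2 * (l : ℝ) ^ 2 * ∑ p ∈ (Nat.primesBelow (k + 1)).filter (l < ·), 1 / (p : ℝ) ^ 2)) := by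
              refine mul_le_mul ?_ ih (MRfin_nonneg hl (primeProd_ne_zero _)) (Real.exp_pos _).le
              rw [add_comm, mul_one_div]; exact Real.add_one_le_exp _
          _ = _ := by ring
      · intro h
        exact absurd (Nat.lt_of_mem_primesBelow (Finset.mem_filter.1 h).1) (lt_irrefl _)
    · rw [primeProd_succ_of_not_prime hp, Nat.primesBelow_succ (k + 1), if_neg hp]
      exact ih

lemma MR_even_le {l : ℕ} (hl : Even l) (hl2 : 2 ≤ l) {B : ℝ}
    (hB : ∀ k, ∑ p ∈ (Nat.primesBelow k).filter (l < ·), 1 / (p : ℝ) ^ 2 ≤ B) :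
    MR l ≤ (1 / 2 * ∏ p ∈ Nat.primesBelow (l + 1), (1 + 1 / (p : ℝ))) ^ l * Real.exp (2 * (l : ℝ) ^ 2 * B) := by
  refine le_of_tendsto ((tendsto_MRfin_primeProd l).comp (Filter.tendsto_add_atTop_nat 1)) ?_
  filter_upwards [Filter.eventually_ge_atTop l] with k hk
  refine (MRfin_primeProd_le hl hl2 hk).trans ?_
  have h1 : MRfin l (primeProd (l + 1)).divisors ≤ (1 / 2 * ∏ p ∈ Nat.primesBelow (l + 1), (1 + 1 / (p : ℝ))) ^ l := by
    rw [MRfin_divisors (primeProd_ne_zero _)]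
    refine (le_abs_self _).trans (abs_perMean_le ?_ ?_ _)
    · positivity
    · intro x
      rw [abs_pow, ← sum_divisors_primeProd_inv]
      gcongr
      exact abs_sawSum_le_sum_inv _ _
  have h2 := hB (k + 1)
  gcongr

/-- The Fourier side of the periodised Gaussian. -/
noncomputable def gaussFourier (a t : ℝ) : ℂ :=
  ∑' n : ℤ, Complex.exp (-(π : ℂ) * (a : ℂ) * (n : ℂ) ^ 2 + 2 * (π : ℂ) * (-(Complex.I * (t : ℂ))) * (n : ℂ))

lemma norm_gaussFourier_term (a t : ℝ) (n : ℤ) :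
    ‖Complex.exp (-(π : ℂ) * (a : ℂ) * (n : ℂ) ^ 2 + 2 * (π : ℂ) * (-(Complex.I * (t : ℂ))) * (n : ℂ))‖ =
      Real.exp (-π * a * n ^ 2) := by
  rw [Complex.norm_exp]
  congr 1
  have : -(π : ℂ) * (a : ℂ) * (n : ℂ) ^ 2 + 2 * (π : ℂ) * (-(Complex.I * (t : ℂ))) * (n : ℂ) =
      ((-π * a * n ^ 2 : ℝ) : ℂ) + ((-2 * π * t * n : ℝ) : ℂ) * Complex.I := by push_cast; ring
  rw [this, Complex.add_re, Complex.ofReal_re, Complex.re_ofReal_mul, Complex.I_re]; simp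

lemma hasSum_gauss_majorant {q : ℝ} (hq : 0 ≤ q) (hq1 : q < 1) :
    HasSum (fun n : ℤ => if n = 0 then 0 else q ^ n.natAbs) (2 * (q * (1 - q)⁻¹)) := by
  have h : HasSum (fun n : ℕ => q ^ (n + 1)) (q * (1 - q)⁻¹) := by
    simpa only [pow_succ'] using (hasSum_geometric_of_lt_one hq hq1).mul_left q
  have := HasSum.of_add_one_of_neg_add_one (f := fun n : ℤ => if n = 0 then 0 else q ^ n.natAbs)
    (m := q * (1 - q)⁻¹) (m' := q * (1 - q)⁻¹) ?_ ?_
  · convert this using 1; simp; ring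
  · refine h.congr_fun ?_ |> fun h => h
    intro n
    have h1 : ((n : ℤ) + 1) ≠ 0 := by omega
    have h2 : ((n : ℤ) + 1).natAbs = n + 1 := by omega
    simp only [h1, if_false, h2]
  · refine h.congr_fun ?_ |> fun h => h
    intro n
    have h1 : -((n : ℤ) + 1) ≠ 0 := by omega
    have h2 : (-((n : ℤ) + 1)).natAbs = n + 1 := by omega
    simp only [h1, if_false, h2]

lemma exp_neg_pi_le_half {a : ℝ} (ha : 1 ≤ a) : Real.exp (-π * a) ≤ 1 / 2 := by
  have h1 : -π * a ≤ -1 := by nlinarith [Real.pi_gt_three]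
  have h2 := Real.exp_le_exp.2 h1
  have h3 : Real.exp (-1) ≤ 1 / 2 := by
    rw [Real.exp_neg, inv_le_comm₀ (Real.exp_pos _) (by norm_num)]
    have := Real.add_one_le_exp (1:ℝ); norm_num; linarith
  linarith

lemma exp_gauss_term_le {a : ℝ} (ha : 1 ≤ a) (n : ℤ) :
    Real.exp (-π * a * n ^ 2) ≤ Real.exp (-π * a) ^ n.natAbs := by
  rw [← Real.exp_nat_mul]
  apply Real.exp_le_exp.2
  have h1 : ((n.natAbs : ℕ) : ℝ) ≤ (n : ℝ) ^ 2 := by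
    rw [Nat.cast_natAbs]
    have : |n| ≤ n ^ 2 := by
      rcases abs_cases n with ⟨h, _⟩ | ⟨h, _⟩ <;> rw [h] <;> nlinarith
    exact_mod_cast this
  nlinarith [Real.pi_pos, mul_le_mul_of_nonneg_left h1 (show 0 ≤ π * a by positivity)]

lemma norm_gaussFourier_sub_one_le {a : ℝ} (ha : 1 ≤ a) (t : ℝ) :
    ‖gaussFourier a t - 1‖ ≤ 4 * Real.exp (-π * a) := by
  set q := Real.exp (-π * a) with hq
  have hq2 : q ≤ 1 / 2 := exp_neg_pi_le_half ha
  have hq0 : 0 ≤ q := (Real.exp_pos _).le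
  have hM := hasSum_gauss_majorant hq0 (by linarith)
  set c : ℤ → ℂ := fun n => Complex.exp (-(π : ℂ) * (a : ℂ) * (n : ℂ) ^ 2 + 2 * (π : ℂ) * (-(Complex.I * (t : ℂ))) * (n : ℂ)) with hc
  have hb : ∀ n : ℤ, ‖c n - (if n = 0 then 1 else 0)‖ ≤ if n = 0 then 0 else q ^ n.natAbs := by
    intro n
    by_cases hn : n = 0
    · simp [hn, hc]
    · simp only [hn, if_false, sub_zero]
      rw [norm_gaussFourier_term]; exact exp_gauss_term_le ha n
  have hs1 : Summable (fun n : ℤ => c n - (if n = 0 then 1 else 0)) := Summable.of_norm_bounded hM.summable hb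
  have hs2 : HasSum (fun n : ℤ => if n = 0 then (1:ℂ) else 0) 1 := hasSum_ite_eq 0 1
  have hs3 := hs1.hasSum.add hs2
  simp only [sub_add_cancel] at hs3
  have e : gaussFourier a t - 1 = ∑' n : ℤ, (c n - (if n = 0 then 1 else 0)) := by
    unfold gaussFourier; rw [hs3.tsum_eq]; ring
  rw [e]
  refine (tsum_of_norm_bounded hM hb).trans ?_
  have : (1 - q)⁻¹ ≤ 2 := by
    rw [inv_le_comm₀ (by linarith) (by norm_num)]; linarith
  nlinarith

lemma continuous_gaussFourier {a : ℝ} (ha : 1 ≤ a) : Continuous (gaussFourier a) := by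
  unfold gaussFourier
  have hq2 := exp_neg_pi_le_half ha
  have hM := hasSum_gauss_majorant (Real.exp_pos (-π * a)).le (by linarith)
  refine continuous_tsum (u := fun n : ℤ => (if n = 0 then 0 else Real.exp (-π * a) ^ n.natAbs) + if n = 0 then 1 else 0) ?_
    (hM.summable.add (hasSum_ite_eq 0 1).summable) ?_
  · intro n; fun_prop
  · intro n t
    rw [norm_gaussFourier_term]
    by_cases hn : n = 0
    · simp [hn]
    · simp only [hn, if_false, add_zero]; exact exp_gauss_term_le ha n

lemma tsum_gauss_eq {a : ℝ} (ha : 0 < a) (t : ℝ) :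
    ((∑' n : ℤ, Real.exp (-(π / a) * (t + n) ^ 2) : ℝ) : ℂ) = (Real.sqrt a : ℂ) * gaussFourier a t := by
  have h := Complex.tsum_exp_neg_quadratic (a := (a : ℂ)) (by simpa using ha) (-(Complex.I * (t : ℂ)))
  unfold gaussFourier
  rw [h]
  have h1 : ((a : ℂ)) ^ (1 / 2 : ℂ) = (Real.sqrt a : ℂ) := by
    rw [Real.sqrt_eq_rpow, Complex.ofReal_cpow ha.le]; norm_num
  rw [h1, ← mul_assoc, mul_one_div, div_self, one_mul, Complex.ofReal_tsum]
  · refine tsum_congr fun n => ?_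
    push_cast
    congr 1
    have : (n : ℂ) + Complex.I * -(Complex.I * (t : ℂ)) = (t : ℂ) + n := by
      linear_combination -(t : ℂ) * Complex.I_mul_I
    rw [this]; ring
  · exact_mod_cast (Real.sqrt_pos.2 ha).ne'

lemma tsum_gauss_eq_re {a : ℝ} (ha : 0 < a) (t : ℝ) :
    ∑' n : ℤ, Real.exp (-(π / a) * (t + n) ^ 2) = Real.sqrt a * (gaussFourier a t).re := by
  rw [← Complex.ofReal_re (∑' n : ℤ, Real.exp (-(π / a) * (t + n) ^ 2)), tsum_gauss_eq ha, Complex.re_ofReal_mul]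

lemma abs_integral_gauss_sub_le {h : ℝ → ℝ} (hh : Measurable h) (hb : ∀ t, |h t| ≤ 1) (hp : Function.Periodic h 1)
    {a : ℝ} (ha : 1 ≤ a) :
    |(∫ t : ℝ, h t * Real.exp (-(π / a) * t ^ 2)) - Real.sqrt a * ∫ t in (0:ℝ)..1, h t| ≤
      4 * Real.sqrt a * Real.exp (-π * a) := by
  have ha0 : 0 < a := by linarith
  have hg : Integrable (fun t : ℝ => Real.exp (-(π / a) * t ^ 2)) :=
    integrable_exp_neg_mul_sq (by positivity)
  have hhg : Integrable (fun t : ℝ => h t * Real.exp (-(π / a) * t ^ 2)) :=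
    hg.bdd_mul hh.aestronglyMeasurable (Filter.Eventually.of_forall fun t => by simpa using hb t)
  have hshift : ∀ (f : ℝ → ℝ) (n : ℤ), ∫ t in (0 + (n:ℝ))..(0 + n + 1), f t = ∫ t in Set.Ioc (0:ℝ) 1, f (t + n) := by
    intro f n
    rw [← intervalIntegral.integral_of_le zero_le_one, intervalIntegral.integral_comp_add_right]
    congr 1; ring
  have h1 := hhg.hasSum_intervalIntegral 0
  have h2 := (hg.hasSum_intervalIntegral 0).summable
  simp only [hshift] at h1 h2
  have hpn : ∀ (t : ℝ) (n : ℤ), h (t + n) = h t := fun t n => by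
    have := hp.int_mul n t
    simpa using this
  simp only [hpn] at h1
  have hI : ∀ n : ℤ, Integrable (fun t : ℝ => h t * Real.exp (-(π / a) * (t + n) ^ 2)) (volume.restrict (Set.Ioc 0 1)) := by
    intro n
    refine Integrable.restrict ?_
    have := hhg.comp_add_right (n : ℝ)
    simpa only [hpn] using this
  have h3 := hasSum_integral_of_summable_integral_norm hI (by
    refine Summable.of_nonneg_of_le (fun n => integral_nonneg fun t => norm_nonneg _) (fun n => ?_) h2
    refine integral_mono (hI n).norm ((hg.comp_add_right (n : ℝ)).restrict) fun t => ?_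
    simp only [norm_mul, Real.norm_eq_abs, Real.abs_exp]
    exact mul_le_of_le_one_left (Real.exp_pos _).le (hb t))
  rw [h1.unique h3]
  simp only [tsum_mul_left, tsum_gauss_eq_re ha0]
  rw [← intervalIntegral.integral_of_le zero_le_one, ← intervalIntegral.integral_const_mul]
  have hht : Tame h := ⟨hh, 1, zero_le_one, hb⟩
  have hc := continuous_gaussFourier ha
  have hbig : ∀ t, |(gaussFourier a t).re - 1| ≤ 4 * Real.exp (-π * a) := fun t => by
    have h1 := norm_gaussFourier_sub_one_le ha t
    have h2 := Complex.abs_re_le_norm (gaussFourier a t - 1)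
    rw [Complex.sub_re, Complex.one_re] at h2
    linarith
  have hmul : IntervalIntegrable (fun t => h t * (Real.sqrt a * (gaussFourier a t).re)) volume 0 1 :=
    (hht.intervalIntegrable 0 1).mul_continuousOn (by fun_prop)
  rw [← intervalIntegral.integral_sub hmul ((hht.intervalIntegrable 0 1).const_mul _)]
  have := intervalIntegral.norm_integral_le_of_norm_le_const (a := 0) (b := 1)
    (f := fun t => h t * (Real.sqrt a * (gaussFourier a t).re) - Real.sqrt a * h t) (C := 4 * Real.sqrt a * Real.exp (-π * a)) (by
    intro t _
    rw [show h t * (Real.sqrt a * (gaussFourier a t).re) - Real.sqrt a * h t = h t * (Real.sqrt a * ((gaussFourier a t).re - 1)) by ring,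
      Real.norm_eq_abs, abs_mul, abs_mul, abs_of_nonneg (Real.sqrt_nonneg a)]
    have e1 := hb t
    have e2 := hbig t
    calc _ ≤ 1 * (Real.sqrt a * (4 * Real.exp (-π * a))) := by gcongr
      _ = _ := by ring)
  simpa using this

/-- Gaussian averages of a periodic function. -/
lemma abs_integral_mul_gauss_sub_le {f : ℝ → ℝ} (hf : Measurable f) (hb : ∀ t, |f t| ≤ 1) {L : ℕ} (hL : L ≠ 0)
    (hp : Function.Periodic f L) {X : ℝ} (hX : (L : ℝ) ≤ X) :
    |(∫ u : ℝ, f u * Real.exp (-π * (u / X) ^ 2)) - X * perMean f L| ≤ 4 * X * Real.exp (-π * (X / L) ^ 2) := by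
  have hL0 : (0 : ℝ) < L := by positivity
  have hX0 : 0 < X := by linarith
  have h := abs_integral_gauss_sub_le (h := fun t => f (L * t)) (hf.comp (measurable_const_mul _)) (fun t => hb _)
    (fun t => by simp only [mul_add, mul_one]; exact hp _) (a := (X / L) ^ 2) (by
      rw [one_le_sq_iff₀ (by positivity), one_le_div hL0]; exact hX)
  rw [Real.sqrt_sq (by positivity)] at h
  have e1 := Measure.integral_comp_mul_left (fun u => f u * Real.exp (-π * (u / X) ^ 2)) (L : ℝ)
  have e2 : ∀ t : ℝ, -(π / (X / L) ^ 2) * t ^ 2 = -π * (L * t / X) ^ 2 := fun t => by field_simp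
  simp only [e2] at h
  rw [e1, abs_of_pos (show (0:ℝ) < (L:ℝ)⁻¹ by positivity), smul_eq_mul, intervalIntegral.integral_comp_mul_left _ hL0.ne', smul_eq_mul] at h
  unfold perMean
  simp only [mul_zero, mul_one] at h
  set A := ∫ u : ℝ, f u * Real.exp (-π * (u / X) ^ 2)
  set B := ∫ x in (0:ℝ)..(L:ℝ), f x
  have e3 : A - X * (1 / (L:ℝ) * B) = L * ((L:ℝ)⁻¹ * A - X / L * ((L:ℝ)⁻¹ * B)) := by field_simp
  rw [e3, abs_mul, abs_of_pos hL0]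
  calc _ ≤ L * (4 * (X / L) * Real.exp (-π * (X / L) ^ 2)) := by gcongr
    _ = _ := by field_simp

lemma sum_piFinset_fin_two (D : Finset ℕ) (g : ℕ → ℕ → ℝ) :
    ∑ n ∈ Fintype.piFinset (fun _ : Fin 2 => D), g (n 0) (n 1) = ∑ m ∈ D, ∑ n ∈ D, g m n := by
  rw [← Finset.sum_product']
  refine Finset.sum_nbij' (fun n => (n 0, n 1)) (fun p => ![p.1, p.2]) ?_ ?_ ?_ ?_ ?_
  · intro n hn
    rw [Fintype.mem_piFinset] at hn
    exact Finset.mem_product.2 ⟨hn 0, hn 1⟩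
  · intro p hp
    rw [Finset.mem_product] at hp
    rw [Fintype.mem_piFinset]
    intro i
    fin_cases i
    · exact hp.1
    · exact hp.2
  · intro n _
    ext i; fin_cases i <;> rfl
  · intro p _; rfl
  · intro n _; rfl

lemma abs_MRterm_two_le (n : Fin 2 → ℕ) (h0 : n 0 ≠ 0) (h1 : n 1 ≠ 0) :
    |MRterm n| ≤ (Nat.gcd (n 0) (n 1) : ℝ) ^ 2 / ((n 0 : ℝ) * n 1) ^ 2 := by
  by_cases h : ∀ j, Squarefree (n j)
  · refine (abs_MRterm_le h).trans ?_
    have hN : ∏ j, n j = n 0 * n 1 := by simp [Fin.prod_univ_two]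
    rw [hN]
    have hl : Nat.lcm (n 0) (n 1) ∣ primeRad (n 0 * n 1) :=
      Nat.lcm_dvd (dvd_primeRad (mul_ne_zero h0 h1) (h 0) ⟨_, rfl⟩)
        (dvd_primeRad (mul_ne_zero h0 h1) (h 1) ⟨n 0, by ring⟩)
    have hle : ((Nat.lcm (n 0) (n 1) : ℕ) : ℝ) ≤ primeRad (n 0 * n 1) := by
      exact_mod_cast Nat.le_of_dvd (primeRad_pos _) hl
    have hlpos : (0:ℝ) < (Nat.lcm (n 0) (n 1) : ℕ) := by exact_mod_cast Nat.lcm_pos (Nat.pos_of_ne_zero h0) (Nat.pos_of_ne_zero h1)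
    have hg : (Nat.gcd (n 0) (n 1) : ℝ) * (Nat.lcm (n 0) (n 1) : ℕ) = (n 0 : ℝ) * n 1 := by
      exact_mod_cast Nat.gcd_mul_lcm (n 0) (n 1)
    have hgpos : (0:ℝ) < (Nat.gcd (n 0) (n 1) : ℕ) := by exact_mod_cast Nat.gcd_pos_of_pos_left _ (Nat.pos_of_ne_zero h0)
    rw [← hg, mul_pow, ← div_div, div_self (by positivity)]
    gcongr
  · push Not at h
    obtain ⟨j, hj⟩ := h
    rw [MRterm_eq_zero hj, abs_zero]; positivity

lemma sum_gcd_sq_le {V : ℕ} : ∑ m ∈ Finset.Ioc V (2 * V), ∑ n ∈ Finset.Ioc V (2 * V), (Nat.gcd m n : ℝ) ^ 2 ≤ 8 * (V:ℝ) ^ 3 := by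
  set D := Finset.Ioc V (2 * V) with hD
  have h1 : ∀ m ∈ D, ∀ n ∈ D, (Nat.gcd m n : ℝ) ^ 2 ≤
      ∑ g ∈ Finset.Icc 1 (2 * V), (g : ℝ) ^ 2 * ((if g ∣ m then 1 else 0) * (if g ∣ n then 1 else 0)) := by
    intro m hm n hn
    rw [hD, Finset.mem_Ioc] at hm hn
    have hmem : Nat.gcd m n ∈ Finset.Icc 1 (2 * V) := by
      rw [Finset.mem_Icc]
      exact ⟨Nat.gcd_pos_of_pos_left _ (by omega), (Nat.le_of_dvd (by omega) (Nat.gcd_dvd_left m n)).trans hm.2⟩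
    refine le_trans (le_of_eq ?_) (Finset.single_le_sum (fun g _ => by positivity) hmem)
    simp [Nat.gcd_dvd_left, Nat.gcd_dvd_right]
  refine (Finset.sum_le_sum fun m hm => Finset.sum_le_sum fun n hn => h1 m hm n hn).trans ?_
  have h2 : ∑ m ∈ D, ∑ n ∈ D, ∑ g ∈ Finset.Icc 1 (2 * V), (g : ℝ) ^ 2 * ((if g ∣ m then (1:ℝ) else 0) * (if g ∣ n then 1 else 0)) =
      ∑ g ∈ Finset.Icc 1 (2 * V), ((g : ℝ) * ∑ m ∈ D, (if g ∣ m then (1:ℝ) else 0)) ^ 2 := by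
    have : ∀ m ∈ D, ∑ n ∈ D, ∑ g ∈ Finset.Icc 1 (2 * V), (g : ℝ) ^ 2 * ((if g ∣ m then (1:ℝ) else 0) * (if g ∣ n then 1 else 0)) =
        ∑ g ∈ Finset.Icc 1 (2 * V), ∑ n ∈ D, (g : ℝ) ^ 2 * ((if g ∣ m then (1:ℝ) else 0) * (if g ∣ n then 1 else 0)) :=
      fun m _ => Finset.sum_comm
    rw [Finset.sum_congr rfl this, Finset.sum_comm]
    refine Finset.sum_congr rfl fun g _ => ?_
    rw [mul_pow, sq (∑ m ∈ D, _), Finset.sum_mul_sum, Finset.mul_sum]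
    exact Finset.sum_congr rfl fun m _ => by rw [Finset.mul_sum]
  rw [h2]
  have h3 : ∀ g ∈ Finset.Icc 1 (2 * V), ((g : ℝ) * ∑ m ∈ D, (if g ∣ m then (1:ℝ) else 0)) ^ 2 ≤ (2 * V : ℝ) ^ 2 := by
    intro g hg
    have hg0 : (0:ℝ) < g := by exact_mod_cast (Finset.mem_Icc.1 hg).1
    refine pow_le_pow_left₀ (by positivity) ?_ 2
    rw [← Finset.sum_filter, Finset.sum_const, nsmul_eq_mul, mul_one]
    have : (D.filter (g ∣ ·)).card ≤ (2 * V) / g := by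
      rw [← Nat.Ioc_filter_dvd_card_eq_div]
      exact Finset.card_le_card (Finset.filter_subset_filter _ (Finset.Ioc_subset_Ioc_left (Nat.zero_le V)))
    have h4 : g * (D.filter (g ∣ ·)).card ≤ 2 * V := (Nat.mul_le_mul_left g this).trans (Nat.mul_div_le _ _)
    exact_mod_cast h4
  refine (Finset.sum_le_sum h3).trans ?_
  rw [Finset.sum_const, Nat.card_Icc, nsmul_eq_mul, Nat.add_sub_cancel]
  push_cast
  apply le_of_eq; ring

lemma sum_abs_MRterm_two_le {V : ℕ} (hV : 1 ≤ V) :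
    ∑ n ∈ Fintype.piFinset (fun _ : Fin 2 => Finset.Ioc V (2 * V)), |MRterm n| ≤ 8 / V := by
  have hV0 : (0:ℝ) < V := by exact_mod_cast hV
  calc _ ≤ ∑ n ∈ Fintype.piFinset (fun _ : Fin 2 => Finset.Ioc V (2 * V)), (Nat.gcd (n 0) (n 1) : ℝ) ^ 2 / (V:ℝ) ^ 4 := by
        refine Finset.sum_le_sum fun n hn => ?_
        rw [Fintype.mem_piFinset] at hn
        have h0 := Finset.mem_Ioc.1 (hn 0)
        have h1 := Finset.mem_Ioc.1 (hn 1)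
        refine (abs_MRterm_two_le n (by omega) (by omega)).trans ?_
        have h0' : (V:ℝ) ≤ n 0 := by exact_mod_cast h0.1.le
        have h1' : (V:ℝ) ≤ n 1 := by exact_mod_cast h1.1.le
        gcongr
        calc (V:ℝ) ^ 4 = (V * V) ^ 2 := by ring
          _ ≤ _ := by gcongr
    _ = (∑ m ∈ Finset.Ioc V (2 * V), ∑ n ∈ Finset.Ioc V (2 * V), (Nat.gcd m n : ℝ) ^ 2) / (V:ℝ) ^ 4 := by
        rw [← Finset.sum_div, sum_piFinset_fin_two _ fun m n => (Nat.gcd m n : ℝ) ^ 2]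
    _ ≤ 8 * (V:ℝ) ^ 3 / (V:ℝ) ^ 4 := by gcongr; exact sum_gcd_sq_le
    _ = _ := by field_simp

lemma MRfin_two_Ioc_le {V : ℕ} (hV : 1 ≤ V) : MRfin 2 (Finset.Ioc V (2 * V)) ≤ 8 / V :=
  (le_abs_self _).trans ((Finset.abs_sum_le_sum_abs _ _).trans (sum_abs_MRterm_two_le hV))

lemma sum_Ioc_inv_le_one {V : ℕ} : ∑ d ∈ Finset.Ioc V (2 * V), (d : ℝ)⁻¹ ≤ 1 := by
  by_cases hV : V = 0
  · simp [hV]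
  have hV0 : (0:ℝ) < V := by positivity
  calc _ ≤ ∑ d ∈ Finset.Ioc V (2 * V), (V : ℝ)⁻¹ := by
        refine Finset.sum_le_sum fun d hd => ?_
        have : (V:ℝ) ≤ d := by exact_mod_cast (Finset.mem_Ioc.1 hd).1.le
        gcongr
    _ = 1 := by
        rw [Finset.sum_const, Nat.card_Ioc, nsmul_eq_mul, show 2 * V - V = V by omega, mul_inv_cancel₀ hV0.ne']

lemma integrable_gauss {X : ℝ} (hX : 0 < X) : Integrable (fun u : ℝ => Real.exp (-π * (u / X) ^ 2)) := by
  have h := integrable_exp_neg_mul_sq (b := π / X ^ 2) (by positivity)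
  refine h.congr (Filter.Eventually.of_forall fun u => ?_)
  simp only; congr 1; field_simp

lemma Tame.integrable_mul_gauss {f : ℝ → ℝ} (hf : Tame f) {X : ℝ} (hX : 0 < X) :
    Integrable (fun u : ℝ => f u * Real.exp (-π * (u / X) ^ 2)) := by
  obtain ⟨C, -, hC⟩ := hf.bdd
  exact (integrable_gauss hX).bdd_mul hf.meas.aestronglyMeasurable (Filter.Eventually.of_forall fun t => by simpa using hC t)

/-- The mean square of a dyadic block, for every length of the interval. -/
lemma integral_sq_block_le {V : ℕ} (hV : 1 ≤ V) {Y : ℝ} (hY : 0 ≤ Y) :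
    ∫ u in (0:ℝ)..Y, sawSum (Finset.Ioc V (2 * V)) u ^ 2 ≤
      12 * Real.exp π * (Y + 4 * (V:ℝ) ^ 2 * (1 + Real.log (2 * V))) / V := by
  have hV0 : (1:ℝ) ≤ V := by exact_mod_cast hV
  have hlog : 0 ≤ Real.log (2 * V) := Real.log_nonneg (by linarith)
  set D := Finset.Ioc V (2 * V) with hD
  set X : ℝ := Y + 4 * (V:ℝ) ^ 2 * (1 + Real.log (2 * V)) with hX
  have hX4 : 4 * (V:ℝ) ^ 2 * (1 + Real.log (2 * V)) ≤ X := by linarith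
  have hX0 : 0 < X := lt_of_lt_of_le (by positivity) hX4
  have hYX : Y ≤ X := by
    have : 0 ≤ 4 * (V:ℝ) ^ 2 * (1 + Real.log (2 * V)) := by positivity
    linarith
  have hT := (tame_sawSum D).pow 2
  have hint := hT.integrable_mul_gauss hX0
  have h1 : ∫ u in (0:ℝ)..Y, sawSum D u ^ 2 ≤ Real.exp π * ∫ u : ℝ, sawSum D u ^ 2 * Real.exp (-π * (u / X) ^ 2) := by
    rw [← integral_const_mul]
    have hnn : ∀ u : ℝ, 0 ≤ Real.exp π * (sawSum D u ^ 2 * Real.exp (-π * (u / X) ^ 2)) := fun u => by positivity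
    refine le_trans ?_ (setIntegral_le_integral (s := Set.Ioc 0 Y) (hint.const_mul _) (Filter.Eventually.of_forall hnn))
    rw [← intervalIntegral.integral_of_le hY]
    refine intervalIntegral.integral_mono_on hY (hT.intervalIntegrable _ _) (hint.const_mul _).intervalIntegrable fun u hu => ?_
    have hu1 : (u / X) ^ 2 ≤ 1 := by
      rw [sq_le_one_iff₀ (div_nonneg hu.1 hX0.le), div_le_one hX0]; exact hu.2.trans hYX
    have : 1 ≤ Real.exp π * Real.exp (-π * (u / X) ^ 2) := by
      rw [← Real.exp_add]; apply Real.one_le_exp; nlinarith [Real.pi_pos]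
    nlinarith [sq_nonneg (sawSum D u)]
  have h2 : ∫ u : ℝ, sawSum D u ^ 2 * Real.exp (-π * (u / X) ^ 2) ≤ 12 * X / V := by
    have e : ∀ u : ℝ, sawSum D u ^ 2 * Real.exp (-π * (u / X) ^ 2) =
        ∑ n ∈ Fintype.piFinset (fun _ : Fin 2 => D), (∏ j, (ArithmeticFunction.moebius (n j) : ℝ)) / (∏ j, (n j : ℝ)) *
          ((∏ j, saw (u / n j)) * Real.exp (-π * (u / X) ^ 2)) := fun u => by
      rw [sawSum_pow, Finset.sum_mul]
      exact Finset.sum_congr rfl fun n _ => by ring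
    simp only [e]
    rw [integral_finsetSum _ fun n _ => ((tame_prod_saw n).integrable_mul_gauss hX0).const_mul _]
    simp only [integral_const_mul]
    have hterm : ∀ n ∈ Fintype.piFinset (fun _ : Fin 2 => D),
        (∏ j, (ArithmeticFunction.moebius (n j) : ℝ)) / (∏ j, (n j : ℝ)) *
          (∫ u : ℝ, (∏ j, saw (u / n j)) * Real.exp (-π * (u / X) ^ 2)) ≤
        X * |MRterm n| + 4 * X / V * ((n 0 : ℝ)⁻¹ * (n 1 : ℝ)⁻¹) := by
      intro n hn
      rw [Fintype.mem_piFinset] at hn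
      have hm0 := Finset.mem_Ioc.1 (hn 0)
      have hm1 := Finset.mem_Ioc.1 (hn 1)
      have hn0 : ∀ j, n j ≠ 0 := fun j => by have := Finset.mem_Ioc.1 (hn j); omega
      have hP : ∏ j, n j ≠ 0 := Finset.prod_ne_zero_iff.2 fun j _ => hn0 j
      have hP0 : (0:ℝ) < ∏ j, (n j : ℝ) := Finset.prod_pos fun j _ => by
        exact_mod_cast Nat.pos_of_ne_zero (hn0 j)
      have hPle : ((∏ j, n j : ℕ) : ℝ) ≤ 4 * (V:ℝ) ^ 2 := by
        have : ∏ j, n j ≤ 4 * V ^ 2 := by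
          rw [Fin.prod_univ_two]
          calc n 0 * n 1 ≤ (2 * V) * (2 * V) := Nat.mul_le_mul hm0.2 hm1.2
            _ = _ := by ring
        exact_mod_cast this
      have hPpos : (0:ℝ) < ((∏ j, n j : ℕ) : ℝ) := by exact_mod_cast Nat.pos_of_ne_zero hP
      have hratio : 1 + Real.log (2 * V) ≤ X / ((∏ j, n j : ℕ) : ℝ) := by
        rw [le_div_iff₀ hPpos]
        calc _ ≤ (1 + Real.log (2 * V)) * (4 * (V:ℝ) ^ 2) := by gcongr
          _ ≤ X := by linarith
      have hLX : ((∏ j, n j : ℕ) : ℝ) ≤ X := by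
        rw [← one_le_div hPpos]; linarith
      have h := abs_integral_mul_gauss_sub_le (tame_prod_saw n).meas (fun x => abs_prod_saw_le _ _) hP
        (periodic_prod_saw hn0 fun j => Finset.dvd_prod_of_mem _ (Finset.mem_univ j)) hLX
      rw [← Bcorr_eq_perMean] at h
      have hexp : Real.exp (-π * (X / ((∏ j, n j : ℕ) : ℝ)) ^ 2) ≤ 1 / V := by
        have h5 : -π * (X / ((∏ j, n j : ℕ) : ℝ)) ^ 2 ≤ -Real.log V := by
          have h6 : Real.log V ≤ Real.log (2 * V) := Real.log_le_log (by linarith) (by linarith)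
          set r := X / ((∏ j, n j : ℕ) : ℝ)
          have : 1 ≤ r := by linarith
          have h7 : r ≤ r ^ 2 := by nlinarith
          nlinarith [Real.pi_gt_three]
        refine (Real.exp_le_exp.2 h5).trans ?_
        rw [Real.exp_neg, Real.exp_log (by linarith), one_div]
      have h2 : |∏ j, (ArithmeticFunction.moebius (n j) : ℝ)| ≤ 1 := by
        rw [Finset.abs_prod]
        exact Finset.prod_le_one (fun _ _ => abs_nonneg _) fun j _ => abs_moebius_le_one_real _
      set I := ∫ u : ℝ, (∏ j, saw (u / n j)) * Real.exp (-π * (u / X) ^ 2) with hI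
      have e1 : (∏ j, (ArithmeticFunction.moebius (n j) : ℝ)) / (∏ j, (n j : ℝ)) * I = X * MRterm n +
          (∏ j, (ArithmeticFunction.moebius (n j) : ℝ)) / (∏ j, (n j : ℝ)) * (I - X * Bcorr n) := by
        unfold MRterm; ring
      rw [e1]
      refine add_le_add (mul_le_mul_of_nonneg_left (le_abs_self _) hX0.le) ((le_abs_self _).trans ?_)
      rw [abs_mul, abs_div, abs_of_pos hP0]
      have e2 : (n 0 : ℝ)⁻¹ * (n 1 : ℝ)⁻¹ = 1 / ∏ j, (n j : ℝ) := by
        rw [Fin.prod_univ_two, one_div, mul_inv]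
      rw [e2]
      calc _ ≤ 1 / (∏ j, (n j : ℝ)) * (4 * X * (1 / V)) := by
            gcongr
            exact h.trans (by gcongr)
        _ = _ := by ring
    refine (Finset.sum_le_sum hterm).trans ?_
    rw [Finset.sum_add_distrib, ← Finset.mul_sum, ← Finset.mul_sum, sum_piFinset_fin_two D fun m n => (m:ℝ)⁻¹ * (n:ℝ)⁻¹,
      ← Finset.sum_mul_sum]
    have h5 := sum_abs_MRterm_two_le hV
    have h6 : ∑ d ∈ D, (d : ℝ)⁻¹ ≤ 1 := sum_Ioc_inv_le_one
    have h7 : 0 ≤ ∑ d ∈ D, (d : ℝ)⁻¹ := Finset.sum_nonneg fun _ _ => by positivity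
    calc _ ≤ X * (8 / V) + 4 * X / V * (1 * 1) := by gcongr
      _ = _ := by ring
  refine h1.trans ((mul_le_mul_of_nonneg_left h2 (Real.exp_pos _).le).trans (le_of_eq ?_))
  ring

lemma sawSum_Icc_add_Ioc {a b : ℕ} (h : a ≤ b) (u : ℝ) :
    sawSum (Finset.Icc 1 b) u = sawSum (Finset.Icc 1 a) u + sawSum (Finset.Ioc a b) u := by
  unfold sawSum
  rw [← Finset.sum_union]
  · congr 1; ext n; simp only [Finset.mem_Icc, Finset.mem_union, Finset.mem_Ioc]; omega
  · rw [Finset.disjoint_left]; intro n; simp only [Finset.mem_Icc, Finset.mem_Ioc]; omega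

lemma sawSum_dyadic (z k : ℕ) (u : ℝ) :
    sawSum (Finset.Icc 1 (z * 2 ^ k)) u - sawSum (Finset.Icc 1 z) u =
      ∑ i ∈ Finset.range k, sawSum (Finset.Ioc (z * 2 ^ i) (2 * (z * 2 ^ i))) u := by
  induction k with
  | zero => simp
  | succ k ih =>
    rw [Finset.sum_range_succ, ← ih, show z * 2 ^ (k + 1) = 2 * (z * 2 ^ k) by ring,
      sawSum_Icc_add_Ioc (show z * 2 ^ k ≤ 2 * (z * 2 ^ k) by omega)]
    ring

/-- The mean square of the tail of the sawtooth expansion. -/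
lemma integral_sq_sawSum_sub_le {z : ℕ} (hz : 1 ≤ z) (k : ℕ) {Y : ℝ} (hY : 0 ≤ Y) :
    ∫ u in (0:ℝ)..Y, (sawSum (Finset.Icc 1 (z * 2 ^ k)) u - sawSum (Finset.Icc 1 z) u) ^ 2 ≤
      12 * Real.exp π * k * (2 * Y / z + 4 * (z * 2 ^ k : ℕ) * (1 + Real.log (z * 2 ^ k : ℕ))) := by
  have hz0 : (0:ℝ) < z := by exact_mod_cast hz
  set N : ℝ := ((z * 2 ^ k : ℕ) : ℝ) with hN
  have hNe : N = z * 2 ^ k := by simp [hN]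
  have hN1 : 1 ≤ N := by
    rw [hN]; exact_mod_cast Nat.mul_pos hz (by positivity : 0 < 2 ^ k)
  have hT : ∀ i, Tame (fun u => sawSum (Finset.Ioc (z * 2 ^ i) (2 * (z * 2 ^ i))) u ^ 2) := fun i => (tame_sawSum _).pow 2
  have h1 : ∫ u in (0:ℝ)..Y, (sawSum (Finset.Icc 1 (z * 2 ^ k)) u - sawSum (Finset.Icc 1 z) u) ^ 2 ≤
      ∫ u in (0:ℝ)..Y, (k:ℝ) * ∑ i ∈ Finset.range k, sawSum (Finset.Ioc (z * 2 ^ i) (2 * (z * 2 ^ i))) u ^ 2 := by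
    simp only [sawSum_dyadic]
    refine intervalIntegral.integral_mono_on hY (((Tame.sum fun i _ => tame_sawSum _).pow 2).intervalIntegrable _ _)
      (((Tame.const _).mul (Tame.sum fun i _ => hT i)).intervalIntegrable _ _) fun u _ => ?_
    have := sq_sum_le_card_mul_sum_sq (s := Finset.range k) (f := fun i => sawSum (Finset.Ioc (z * 2 ^ i) (2 * (z * 2 ^ i))) u)
    simpa using this
  refine h1.trans ?_
  rw [intervalIntegral.integral_const_mul, intervalIntegral.integral_finsetSum fun i _ => (hT i).intervalIntegrable _ _]
  have h2 : ∀ i ∈ Finset.range k, ∫ u in (0:ℝ)..Y, sawSum (Finset.Ioc (z * 2 ^ i) (2 * (z * 2 ^ i))) u ^ 2 ≤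
      12 * Real.exp π * (Y / z * (1 / 2) ^ i + 4 * z * (1 + Real.log N) * 2 ^ i) := by
    intro i hi
    have hV : 1 ≤ z * 2 ^ i := Nat.mul_pos hz (by positivity)
    refine (integral_sq_block_le hV hY).trans ?_
    have hV0 : (0:ℝ) < ((z * 2 ^ i : ℕ) : ℝ) := by exact_mod_cast hV
    have hle : 2 * ((z * 2 ^ i : ℕ) : ℝ) ≤ N := by
      rw [hN]
      have : 2 * (z * 2 ^ i) ≤ z * 2 ^ k := by
        rw [show 2 * (z * 2 ^ i) = z * 2 ^ (i + 1) by ring]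
        exact Nat.mul_le_mul_left z (Nat.pow_le_pow_right (by norm_num) (Finset.mem_range.1 hi))
      exact_mod_cast this
    have hlog := Real.log_le_log (by positivity) hle
    rw [mul_div_assoc]
    gcongr
    rw [add_div]
    have e1 : Y / ((z * 2 ^ i : ℕ) : ℝ) = Y / z * (1 / 2) ^ i := by
      push_cast; rw [one_div, inv_pow]; field_simp
    have e2 : 4 * ((z * 2 ^ i : ℕ) : ℝ) ^ 2 * (1 + Real.log (2 * ((z * 2 ^ i : ℕ) : ℝ))) / ((z * 2 ^ i : ℕ) : ℝ) =
        4 * ((z * 2 ^ i : ℕ) : ℝ) * (1 + Real.log (2 * ((z * 2 ^ i : ℕ) : ℝ))) := by field_simp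
    rw [e1, e2]
    have e3 : 4 * (z:ℝ) * (1 + Real.log N) * 2 ^ i = 4 * ((z * 2 ^ i : ℕ) : ℝ) * (1 + Real.log N) := by push_cast; ring
    rw [e3]
    gcongr
  have h3 : ∑ i ∈ Finset.range k, ∫ u in (0:ℝ)..Y, sawSum (Finset.Ioc (z * 2 ^ i) (2 * (z * 2 ^ i))) u ^ 2 ≤
      12 * Real.exp π * (2 * Y / z + 4 * N * (1 + Real.log N)) := by
    refine (Finset.sum_le_sum h2).trans ?_
    rw [← Finset.mul_sum, Finset.sum_add_distrib, ← Finset.mul_sum, ← Finset.mul_sum]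
    have g1 : ∑ i ∈ Finset.range k, ((1:ℝ) / 2) ^ i ≤ 2 := by
      rw [geom_sum_eq (by norm_num)]
      have : (0:ℝ) < (1 / 2) ^ k := by positivity
      rw [div_le_iff_of_neg (by norm_num)]; linarith
    have g2 : ∑ i ∈ Finset.range k, (2:ℝ) ^ i ≤ 2 ^ k := by
      rw [geom_sum_eq (by norm_num)]; norm_num
    have hlogN : 0 ≤ Real.log N := Real.log_nonneg hN1
    refine mul_le_mul_of_nonneg_left (add_le_add ?_ ?_) (by positivity)
    · calc _ ≤ Y / z * 2 := by gcongr
        _ = _ := by ring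
    · have h4 := mul_le_mul_of_nonneg_left g2 (show 0 ≤ 4 * (z:ℝ) * (1 + Real.log N) by positivity)
      have h5 : 4 * (N:ℝ) * (1 + Real.log N) = 4 * (z * 2 ^ k) * (1 + Real.log N) := by rw [← hNe]
      rw [h5]
      refine h4.trans (le_of_eq ?_)
      ring
  calc _ ≤ (k:ℝ) * (12 * Real.exp π * (2 * Y / z + 4 * N * (1 + Real.log N))) := by gcongr
    _ = _ := by ring

lemma log_factorial_eq_sum (n : ℕ) :
    Real.log (n.factorial : ℝ) = ∑ p ∈ Nat.primesBelow (n + 1), (n.factorial.factorization p : ℝ) * Real.log p := by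
  rw [Real.log_nat_eq_sum_factorization, Finsupp.sum]
  refine Finset.sum_subset (fun p hp => ?_) fun p _ hp => ?_
  · have hp' := Nat.prime_of_mem_primeFactors (Nat.support_factorization _ ▸ hp)
    have hd := Nat.dvd_of_mem_primeFactors (Nat.support_factorization _ ▸ hp)
    exact Nat.mem_primesBelow.2 ⟨Nat.lt_succ_of_le (hp'.dvd_factorial.1 hd), hp'⟩
  · rw [Finsupp.notMem_support_iff.1 hp]; simp

lemma exists_sum_log_div_mul_pred_le :
    ∃ K : ℝ, 0 ≤ K ∧ ∀ k, ∑ p ∈ Nat.primesBelow k, Real.log p / (p * (p - 1 : ℝ)) ≤ K := by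
  have hs : Summable fun n : ℕ => 4 * ((n:ℝ) ^ (3/2 : ℝ))⁻¹ :=
    (Real.summable_nat_rpow_inv.2 (by norm_num)).mul_left 4
  refine ⟨_, tsum_nonneg fun n => by positivity, fun k => le_trans (Finset.sum_le_sum fun p hp => ?_)
    (hs.sum_le_tsum (Nat.primesBelow k) fun n _ => by positivity)⟩
  have hp2 : (2:ℝ) ≤ p := by exact_mod_cast (Nat.prime_of_mem_primesBelow hp).two_le
  have h1 : Real.log p ≤ 2 * (p:ℝ) ^ (1/2 : ℝ) := by
    refine (Real.log_le_rpow_div (by positivity) (show (0:ℝ) < 1/2 by norm_num)).trans (le_of_eq ?_)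
    ring
  have h2 : (p:ℝ) ^ (1/2 : ℝ) * (p:ℝ) ^ (3/2 : ℝ) = (p:ℝ) ^ 2 := by
    rw [← Real.rpow_add (by positivity), ← Real.rpow_natCast]; norm_num
  have h3 : (0:ℝ) < p * (p - 1) := mul_pos (by linarith) (by linarith)
  have h4 : (0:ℝ) < (p:ℝ) ^ (3/2 : ℝ) := by positivity
  rw [div_le_iff₀ h3, mul_comm (4:ℝ), mul_assoc, ← div_eq_inv_mul, le_div_iff₀ h4]
  calc Real.log p * (p:ℝ) ^ (3/2 : ℝ) ≤ 2 * (p:ℝ) ^ (1/2 : ℝ) * (p:ℝ) ^ (3/2 : ℝ) := by gcongr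
    _ = 2 * (p:ℝ) ^ 2 := by rw [mul_assoc, h2]
    _ ≤ _ := by nlinarith

lemma sum_log_primesBelow_le (n : ℕ) : ∑ p ∈ Nat.primesBelow (n + 1), Real.log p ≤ Real.log 4 * n := by
  have h := Chebyshev.theta_le_log4_mul_x (x := (n:ℝ)) (by positivity)
  rwa [Chebyshev.theta_eq_sum_primesLE_log] at h

lemma div_le_factorization_factorial {n p : ℕ} (hp : p.Prime) : n / p ≤ n.factorial.factorization p := by
  rw [Nat.factorization_factorial hp (b := Nat.log p n + 2) (by omega)]
  refine le_trans (by simp) (Finset.single_le_sum (f := fun i => n / p ^ i) (fun _ _ => Nat.zero_le _) (Finset.mem_Ico.2 ⟨le_rfl, (by omega : 1 < _)⟩))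

/-- Mertens' first theorem. -/
lemma exists_abs_sum_log_div_sub_log_le :
    ∃ K : ℝ, 0 ≤ K ∧ ∀ n : ℕ, 1 ≤ n → |∑ p ∈ Nat.primesBelow (n + 1), Real.log p / p - Real.log n| ≤ K := by
  obtain ⟨K, hK0, hK⟩ := exists_sum_log_div_mul_pred_le
  have h40 : 0 ≤ Real.log 4 := Real.log_nonneg (by norm_num)
  refine ⟨1 + K + Real.log 4, by positivity, fun n hn => ?_⟩
  have hn0 : (0:ℝ) < n := by exact_mod_cast hn
  have hp : ∀ p ∈ Nat.primesBelow (n + 1), (2:ℝ) ≤ p := fun p hp => by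
    exact_mod_cast (Nat.prime_of_mem_primesBelow hp).two_le
  rw [abs_le]
  constructor
  · have h1 : (n:ℝ) * Real.log n - n ≤ Real.log n.factorial := by
      have h := Stirling.le_log_factorial_stirling (n := n) (by omega)
      have : 0 ≤ Real.log n := Real.log_nonneg (by exact_mod_cast hn)
      have h3 : 0 ≤ Real.log (2 * π) := Real.log_nonneg (by linarith [Real.two_le_pi])
      linarith
    have h2 : Real.log n.factorial ≤ n * (∑ p ∈ Nat.primesBelow (n + 1), Real.log p / p + ∑ p ∈ Nat.primesBelow (n + 1), Real.log p / (p * (p - 1 : ℝ))) := by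
      rw [log_factorial_eq_sum, ← Finset.sum_add_distrib, Finset.mul_sum]
      refine Finset.sum_le_sum fun p hp' => ?_
      have hp1 := hp p hp'
      have h3 : ((p:ℝ) - 1) * (n.factorial.factorization p : ℝ) ≤ n := by
        have h4 := Nat.sub_one_mul_factorization_factorial (n := n) (Nat.prime_of_mem_primesBelow hp')
        have h5 : (p - 1) * n.factorial.factorization p ≤ n := by omega
        have h6 : (((p - 1) * n.factorial.factorization p : ℕ) : ℝ) ≤ n := by exact_mod_cast h5
        rwa [Nat.cast_mul, Nat.cast_sub (Nat.prime_of_mem_primesBelow hp').one_le, Nat.cast_one] at h6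
      have hlog : 0 ≤ Real.log p := Real.log_nonneg (by linarith)
      have hpp : (0:ℝ) < p - 1 := by linarith
      have e : (n:ℝ) * (Real.log p / p + Real.log p / (p * (p - 1 : ℝ))) = n / (p - 1) * Real.log p := by
        field_simp; ring
      rw [e]
      refine mul_le_mul_of_nonneg_right ?_ hlog
      rw [le_div_iff₀ hpp]; linarith
    have h3 := hK (n + 1)
    have h4 : (n:ℝ) * (Real.log n - 1) ≤ n * (∑ p ∈ Nat.primesBelow (n + 1), Real.log p / p + K) := by
      refine le_trans (by linarith) (h2.trans (mul_le_mul_of_nonneg_left (by linarith) hn0.le))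
    have := le_of_mul_le_mul_left h4 hn0
    linarith
  · have h1 : Real.log n.factorial ≤ n * Real.log n := by
      rw [← Real.log_pow]
      exact Real.log_le_log (by positivity) (by exact_mod_cast Nat.factorial_le_pow n)
    have h2 : n * ∑ p ∈ Nat.primesBelow (n + 1), Real.log p / p - Real.log 4 * n ≤ Real.log n.factorial := by
      refine le_trans (sub_le_sub_left (sum_log_primesBelow_le n) _) ?_
      rw [log_factorial_eq_sum, Finset.mul_sum, ← Finset.sum_sub_distrib]
      refine Finset.sum_le_sum fun p hp' => ?_
      have hp1 := hp p hp'
      have hlog : 0 ≤ Real.log p := Real.log_nonneg (by linarith)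
      have h3 : (n:ℝ) / p - 1 ≤ n.factorial.factorization p := by
        have h4 : ((n / p : ℕ) : ℝ) ≤ n.factorial.factorization p := by
          exact_mod_cast div_le_factorization_factorial (Nat.prime_of_mem_primesBelow hp')
        have h5 := Nat.lt_floor_add_one ((n:ℝ) / p)
        rw [Nat.floor_div_eq_div] at h5
        linarith
      calc _ = ((n:ℝ) / p - 1) * Real.log p := by ring
        _ ≤ _ := by gcongr
    have h4 : (n:ℝ) * ∑ p ∈ Nat.primesBelow (n + 1), Real.log p / p ≤ n * (Real.log n + Real.log 4) := by linarith
    have := le_of_mul_le_mul_left h4 hn0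
    linarith

lemma sum_primesBelow_succ (f : ℕ → ℝ) (k : ℕ) :
    ∑ p ∈ Nat.primesBelow (k + 1), f p = (if k.Prime then f k else 0) + ∑ p ∈ Nat.primesBelow k, f p := by
  rw [Nat.primesBelow_succ]
  split_ifs with h
  · rw [Finset.sum_insert (fun h => absurd (Nat.lt_of_mem_primesBelow h) (lt_irrefl _))]
  · rw [zero_add]

lemma sum_primesBelow_filter_succ (f : ℕ → ℝ) {k l : ℕ} (h : l < k) :
    ∑ p ∈ (Nat.primesBelow (k + 1)).filter (l < ·), f p =
      (if k.Prime then f k else 0) + ∑ p ∈ (Nat.primesBelow k).filter (l < ·), f p := by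
  rw [Nat.primesBelow_succ]
  split_ifs with h1
  · rw [Finset.filter_insert, if_pos h, Finset.sum_insert]
    exact fun h => absurd (Nat.lt_of_mem_primesBelow (Finset.mem_filter.1 h).1) (lt_irrefl _)
  · rw [zero_add]

lemma sum_primesBelow_filter_eq_zero (f : ℕ → ℝ) (l : ℕ) :
    ∑ p ∈ (Nat.primesBelow (l + 1)).filter (l < ·), f p = 0 := by
  rw [Finset.sum_eq_zero]
  intro p hp
  rw [Finset.mem_filter, Nat.mem_primesBelow] at hp
  omega

lemma sum_log_div_sq_aux {l : ℕ} (hl : 1 ≤ l) {n : ℕ} (hn : l ≤ n) :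
    ∑ p ∈ (Nat.primesBelow (n + 1)).filter (l < ·), Real.log p / (p:ℝ) ^ 2 +
      2 * Real.log 4 / n ≤ (∑ p ∈ Nat.primesBelow (n + 1), Real.log p) / (n:ℝ) ^ 2 + 2 * Real.log 4 / l := by
  induction n, hn using Nat.le_induction with
  | base =>
    rw [sum_primesBelow_filter_eq_zero]
    have : 0 ≤ ∑ p ∈ Nat.primesBelow (l + 1), Real.log p := Finset.sum_nonneg fun p _ => Real.log_natCast_nonneg p
    have : 0 ≤ (∑ p ∈ Nat.primesBelow (l + 1), Real.log p) / (l:ℝ) ^ 2 := by positivity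
    linarith
  | succ n hn ih =>
    rw [sum_primesBelow_filter_succ _ (by omega), sum_primesBelow_succ _ (n + 1)]
    have hn0 : (0:ℝ) < n := by exact_mod_cast (by omega : 0 < n)
    have h1 := sum_log_primesBelow_le n
    set θ := ∑ p ∈ Nat.primesBelow (n + 1), Real.log p
    have h2 : θ / (n:ℝ) ^ 2 - θ / ((n + 1 : ℕ):ℝ) ^ 2 ≤ 2 * Real.log 4 / n - 2 * Real.log 4 / (n + 1 : ℕ) := by
      push_cast
      have e1 : θ / (n:ℝ) ^ 2 - θ / ((n:ℝ) + 1) ^ 2 = θ * ((2 * n + 1) / (n ^ 2 * (n + 1) ^ 2)) := by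
        field_simp; ring
      have e2 : 2 * Real.log 4 / (n:ℝ) - 2 * Real.log 4 / (n + 1) = Real.log 4 * n * ((2 * n + 2) / (n ^ 2 * (n + 1) ^ 2)) := by
        field_simp; ring
      rw [e1, e2]
      have h40 : 0 ≤ Real.log 4 := Real.log_nonneg (by norm_num)
      gcongr
      norm_num
    have e3 : ((if (n + 1).Prime then Real.log (n + 1 : ℕ) else 0) + θ) / ((n + 1 : ℕ) : ℝ) ^ 2 =
        (if (n + 1).Prime then Real.log (n + 1 : ℕ) / ((n + 1 : ℕ) : ℝ) ^ 2 else 0) + θ / ((n + 1 : ℕ) : ℝ) ^ 2 := by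
      split_ifs <;> ring
    rw [e3]
    linarith

lemma sum_log_div_sq_le {l : ℕ} (hl : 1 ≤ l) (k : ℕ) :
    ∑ p ∈ (Nat.primesBelow k).filter (l < ·), Real.log p / (p:ℝ) ^ 2 ≤ 3 * Real.log 4 / l := by
  have h40 : 0 ≤ Real.log 4 := Real.log_nonneg (by norm_num)
  have hl0 : (0:ℝ) < l := by exact_mod_cast hl
  have h1 : (Nat.primesBelow k).filter (l < ·) ⊆ (Nat.primesBelow (l + k + 1)).filter (l < ·) := by
    refine Finset.filter_subset_filter _ fun p hp => ?_
    rw [Nat.mem_primesBelow] at hp ⊢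
    exact ⟨by omega, hp.2⟩
  refine (Finset.sum_le_sum_of_subset_of_nonneg h1 fun p _ _ => div_nonneg (Real.log_natCast_nonneg p) (by positivity)).trans ?_
  have h2 := sum_log_div_sq_aux hl (Nat.le_add_right l k)
  have hn0 : (0:ℝ) < (l + k : ℕ) := by exact_mod_cast (by omega : 0 < l + k)
  have h3 : (∑ p ∈ Nat.primesBelow (l + k + 1), Real.log p) / ((l + k : ℕ):ℝ) ^ 2 ≤ Real.log 4 / (l + k : ℕ) := by
    rw [div_le_div_iff₀ (by positivity) hn0]
    have := mul_le_mul_of_nonneg_right (sum_log_primesBelow_le (l + k)) hn0.le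
    refine this.trans (le_of_eq ?_); ring
  have h4 : Real.log 4 / (l + k : ℕ) ≤ Real.log 4 / l := by gcongr; omega
  have h5 : 0 ≤ 2 * Real.log 4 / (l + k : ℕ) := by positivity
  have e : 3 * Real.log 4 / (l:ℝ) = 2 * Real.log 4 / l + Real.log 4 / l := by ring
  rw [e]; linarith

lemma sum_inv_sq_primes_gt_le {l : ℕ} (hl : 2 ≤ l) (k : ℕ) :
    ∑ p ∈ (Nat.primesBelow k).filter (l < ·), 1 / (p:ℝ) ^ 2 ≤ 3 * Real.log 4 / (l * Real.log l) := by
  have hl0 : 0 < Real.log l := Real.log_pos (by exact_mod_cast (by omega : 1 < l))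
  rw [← div_div, le_div_iff₀ hl0]
  refine le_trans ?_ (sum_log_div_sq_le (by omega) k)
  rw [Finset.sum_mul]
  refine Finset.sum_le_sum fun p hp => ?_
  rw [one_div_mul_eq_div]
  have : (l:ℝ) ≤ p := by exact_mod_cast (Finset.mem_filter.1 hp).2.le
  gcongr

/-- `∑_{p ≤ n} log (1 + 1/p)`. -/
noncomputable def logPrimeSum (n : ℕ) : ℝ := ∑ p ∈ Nat.primesBelow (n + 1), Real.log (1 + 1 / (p:ℝ))

lemma logPrimeSum_aux {K : ℝ} (hK : ∀ n : ℕ, 1 ≤ n → |∑ p ∈ Nat.primesBelow (n + 1), Real.log p / p - Real.log n| ≤ K)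
    {x y : ℕ} (hx : 2 ≤ x) (hxy : x ≤ y) :
    logPrimeSum x - Real.log (Real.log x) - (∑ p ∈ Nat.primesBelow (x + 1), Real.log p / p - Real.log x) / Real.log x
        - (1 + K) / Real.log x - 1 / x ≤
      logPrimeSum y - Real.log (Real.log y) - (∑ p ∈ Nat.primesBelow (y + 1), Real.log p / p - Real.log y) / Real.log y
        - (1 + K) / Real.log y - 1 / y := by
  induction y, hxy using Nat.le_induction with
  | base => exact le_rfl
  | succ n hn ih =>
    refine ih.trans ?_
    have hE := hK n (by omega)
    have hn2 : (2:ℝ) ≤ n := by exact_mod_cast hx.trans hn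
    have hv : 0 < Real.log n := Real.log_pos (by linarith)
    have huv : Real.log n ≤ Real.log (n + 1 : ℕ) := Real.log_le_log (by linarith) (by push_cast; linarith)
    have huv1 : Real.log (n + 1 : ℕ) - Real.log n ≤ 1 := by
      rw [← Real.log_div (by positivity) (by positivity)]
      refine (Real.log_le_sub_one_of_pos (by positivity)).trans ?_
      rw [sub_le_iff_le_add, div_le_iff₀ (by linarith)]; push_cast; linarith
    have hF : (if (n + 1).Prime then Real.log (n + 1 : ℕ) / (n + 1 : ℕ) else 0) / Real.log (n + 1 : ℕ) - (1 / (n:ℝ) - 1 / (n + 1 : ℕ)) + logPrimeSum n ≤ logPrimeSum (n + 1) := by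
      unfold logPrimeSum
      rw [sum_primesBelow_succ _ (n + 1)]
      gcongr
      have h0 : 1 / ((n + 1 : ℕ) : ℝ) ≤ 1 / n := by gcongr; simp
      split_ifs
      · have e : Real.log (n + 1 : ℕ) / (n + 1 : ℕ) / Real.log (n + 1 : ℕ) = 1 / (n + 1 : ℕ) := by
          rw [div_right_comm, div_self (by linarith)]
        rw [e]
        have h1 := Real.one_sub_inv_le_log_of_pos (show (0:ℝ) < 1 + 1 / ((n + 1 : ℕ):ℝ) by positivity)
        refine le_trans ?_ h1
        push_cast
        have hn0 : (0:ℝ) < n := by linarith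
        have : (1 - (1 + 1 / ((n:ℝ) + 1))⁻¹) - (1 / ((n:ℝ) + 1) - (1 / n - 1 / (n + 1))) = 2 / (n * (n + 1) * (n + 2)) := by
          have h3 : (1 + 1 / ((n:ℝ) + 1)) = (n + 2) / (n + 1) := by field_simp; ring
          rw [h3]
          field_simp; ring
        have h4 : (0:ℝ) < 2 / (n * (n + 1) * (n + 2)) := by positivity
        linarith
      · rw [zero_div]; linarith
    rw [sum_primesBelow_succ _ (n + 1)]
    set u := Real.log (n + 1 : ℕ)
    set v := Real.log n
    set T := ∑ p ∈ Nat.primesBelow (n + 1), Real.log p / (p:ℝ)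
    set t := if (n + 1).Prime then u / (n + 1 : ℕ) else 0
    have hu : 0 < u := hv.trans_le huv
    have h1 : Real.log u - Real.log v ≤ u / v - 1 := by
      rw [← Real.log_div hu.ne' hv.ne']
      exact Real.log_le_sub_one_of_pos (by positivity)
    have hinv : 0 ≤ 1 / v - 1 / u := by
      rw [sub_nonneg]; gcongr
    have h2 : -K * (1 / v - 1 / u) ≤ (T - v) * (1 / v - 1 / u) := mul_le_mul_of_nonneg_right (abs_le.1 hE).1 hinv
    have h3 : u / v - 1 - (1 - v / u) ≤ 1 / v - 1 / u := by
      have : u / v - 1 - (1 - v / u) = (u - v) * ((u - v) * (1 / (u * v))) := by field_simp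
      rw [this]
      have e : 1 / v - 1 / u = 1 * ((u - v) * (1 / (u * v))) := by field_simp
      rw [e]
      exact mul_le_mul_of_nonneg_right huv1 (mul_nonneg (by linarith) (by positivity))
    have e4 : (t + T - u) / u = t / u + (T - v) / u - (1 - v / u) := by field_simp; ring
    rw [e4]
    have e5 : (T - v) * (1 / v - 1 / u) = (T - v) / v - (T - v) / u := by ring
    have e6 : (1 + K) / v - (1 + K) / u = 1 / v - 1 / u + K * (1 / v - 1 / u) := by ring
    linarith

/-- Mertens' second theorem for `∑ log (1 + 1/p)`, as a lower bound on increments. -/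
lemma exists_logPrimeSum_le :
    ∃ C : ℝ, 0 ≤ C ∧ ∀ x y : ℕ, 2 ≤ x → x ≤ y →
      logPrimeSum x - Real.log (Real.log x) ≤ logPrimeSum y - Real.log (Real.log y) + C / Real.log x := by
  obtain ⟨K, hK0, hK⟩ := exists_abs_sum_log_div_sub_log_le
  refine ⟨3 * K + 3, by positivity, fun x y hx hxy => ?_⟩
  have h := logPrimeSum_aux hK hx hxy
  have hx2 : (2:ℝ) ≤ x := by exact_mod_cast hx
  have hxy' : (x:ℝ) ≤ y := by exact_mod_cast hxy
  have hv : 0 < Real.log x := Real.log_pos (by linarith)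
  have hvu : Real.log x ≤ Real.log y := Real.log_le_log (by linarith) hxy'
  have hu := hv.trans_le hvu
  have h1 : (∑ p ∈ Nat.primesBelow (x + 1), Real.log p / p - Real.log x) / Real.log x ≤ K / Real.log x := by
    gcongr; exact (abs_le.1 (hK x (by omega))).2
  have h2 : -(K / Real.log x) ≤ (∑ p ∈ Nat.primesBelow (y + 1), Real.log p / p - Real.log y) / Real.log y := by
    have h3 : K / Real.log y ≤ K / Real.log x := by gcongr
    have h4 : -K / Real.log y ≤ (∑ p ∈ Nat.primesBelow (y + 1), Real.log p / p - Real.log y) / Real.log y := by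
      gcongr; exact (abs_le.1 (hK y (by omega))).1
    rw [neg_div] at h4; linarith
  have h3 : 1 / (x:ℝ) ≤ 1 / Real.log x := by
    gcongr; linarith [Real.log_le_sub_one_of_pos (show (0:ℝ) < x by linarith)]
  have h4 : 0 ≤ (1 + K) / Real.log y := by positivity
  have h5 : 0 ≤ 1 / (y:ℝ) := by positivity
  have e : (3 * K + 3) / Real.log x = 3 * (K / Real.log x) + 3 * (1 / Real.log x) := by ring
  have e2 : (1 + K) / Real.log x = 1 / Real.log x + K / Real.log x := by ring
  have h6 : 0 ≤ 1 / Real.log x := by positivity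
  have h7 : 0 ≤ K / Real.log x := by positivity
  rw [e]; rw [e2] at h; linarith

lemma rpow_neg_prime_lt_one {p : ℕ} (hp : p.Prime) {s : ℝ} (hs : 0 < s) : (p:ℝ) ^ (-s) < 1 :=
  Real.rpow_lt_one_of_one_lt_of_neg (by exact_mod_cast hp.one_lt) (by linarith)

lemma tendsto_prod_primesBelow_zeta {s : ℝ} (hs : 1 < s) :
    Filter.Tendsto (fun k => ∏ p ∈ Nat.primesBelow k, (1 - (p:ℝ) ^ (-s))⁻¹) Filter.atTop (nhds (riemannZeta s).re) := by
  have h := riemannZeta_eulerProduct (s := (s:ℂ)) (by simpa using hs)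
  refine ((Complex.continuous_re.tendsto _).comp h).congr fun k => ?_
  simp only [Function.comp]
  rw [← Complex.ofReal_re (∏ p ∈ Nat.primesBelow k, (1 - (p:ℝ) ^ (-s))⁻¹)]
  congr 1
  push_cast
  refine Finset.prod_congr rfl fun p _ => ?_
  rw [Complex.ofReal_cpow (by positivity)]
  push_cast; rfl

lemma one_le_re_zeta {s : ℝ} (hs : 1 < s) : 1 ≤ (riemannZeta s).re := by
  refine ge_of_tendsto (tendsto_prod_primesBelow_zeta hs) (Filter.Eventually.of_forall fun k => ?_)
  refine Finset.one_le_prod fun p hp => ?_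
  have h1 := rpow_neg_prime_lt_one (Nat.prime_of_mem_primesBelow hp) (show 0 < s by linarith)
  exact (one_le_inv₀ (by linarith)).2 (by linarith [Real.rpow_nonneg (Nat.cast_nonneg (α := ℝ) p) (-s)])

lemma tendsto_sum_neg_log_zeta {s : ℝ} (hs : 1 < s) :
    Filter.Tendsto (fun k => ∑ p ∈ Nat.primesBelow k, -Real.log (1 - (p:ℝ) ^ (-s))) Filter.atTop (nhds (Real.log (riemannZeta s).re)) := by
  refine ((tendsto_prod_primesBelow_zeta hs).log (by linarith [one_le_re_zeta hs])).congr fun k => ?_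
  rw [Real.log_prod]
  · exact Finset.sum_congr rfl fun p _ => Real.log_inv _
  · intro p hp
    have h1 := rpow_neg_prime_lt_one (Nat.prime_of_mem_primesBelow hp) (show 0 < s by linarith)
    exact inv_ne_zero (by linarith)

lemma sum_log_one_add_rpow_le {s : ℝ} (hs : 1 < s) (k : ℕ) :
    ∑ p ∈ Nat.primesBelow k, Real.log (1 + (p:ℝ) ^ (-s)) ≤ Real.log (riemannZeta s).re - Real.log (riemannZeta (2 * s : ℝ)).re := by
  have h := (tendsto_sum_neg_log_zeta hs).sub (tendsto_sum_neg_log_zeta (show 1 < 2 * s by linarith))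
  have e : ∀ k, ∑ p ∈ Nat.primesBelow k, -Real.log (1 - (p:ℝ) ^ (-s)) - ∑ p ∈ Nat.primesBelow k, -Real.log (1 - (p:ℝ) ^ (-(2 * s))) =
      ∑ p ∈ Nat.primesBelow k, Real.log (1 + (p:ℝ) ^ (-s)) := by
    intro k
    rw [← Finset.sum_sub_distrib]
    refine Finset.sum_congr rfl fun p hp => ?_
    have h1 := rpow_neg_prime_lt_one (Nat.prime_of_mem_primesBelow hp) (show 0 < s by linarith)
    have h0 := Real.rpow_nonneg (Nat.cast_nonneg (α := ℝ) p) (-s)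
    have e2 : (p:ℝ) ^ (-(2 * s)) = (p:ℝ) ^ (-s) * (p:ℝ) ^ (-s) := by
      rw [← Real.rpow_add (by exact_mod_cast (Nat.prime_of_mem_primesBelow hp).pos)]; congr 1; ring
    rw [e2, show 1 - (p:ℝ) ^ (-s) * (p:ℝ) ^ (-s) = (1 - (p:ℝ) ^ (-s)) * (1 + (p:ℝ) ^ (-s)) by ring, Real.log_mul (by linarith) (by linarith)]
    ring
  simp only [e] at h
  refine Monotone.ge_of_tendsto (fun a b hab => ?_) h k
  refine Finset.sum_le_sum_of_subset_of_nonneg (fun p hp => ?_) fun p _ _ => Real.log_nonneg ?_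
  · rw [Nat.mem_primesBelow] at hp ⊢
    exact ⟨by omega, hp.2⟩
  · linarith [Real.rpow_nonneg (Nat.cast_nonneg (α := ℝ) p) (-s)]

lemma mul_log_one_add_le {c x : ℝ} (hc0 : 0 ≤ c) (hc1 : c ≤ 1) (hx : 0 ≤ x) : c * Real.log (1 + x) ≤ Real.log (1 + c * x) := by
  rw [← Real.log_rpow (by linarith)]
  exact Real.log_le_log (by positivity) (rpow_one_add_le_one_add_mul_self (by linarith) hc0 hc1)

lemma logPrimeSum_one : logPrimeSum 1 = 0 := by
  unfold logPrimeSum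
  refine Finset.sum_eq_zero fun p hp => ?_
  rw [Nat.mem_primesBelow] at hp
  have := hp.2.two_le
  omega

lemma sum_rpow_mul_logPrimeSum_le {δ : ℝ} (hδ : 0 < δ) (J : ℕ) :
    ∑ N ∈ Finset.range J, ((2:ℝ) ^ (-δ)) ^ (N + 1) * (logPrimeSum (2 ^ (N + 1)) - logPrimeSum (2 ^ N)) ≤
      ∑ p ∈ Nat.primesBelow (2 ^ J + 1), Real.log (1 + (p:ℝ) ^ (-(1 + δ))) := by
  induction J with
  | zero =>
    rw [Finset.sum_range_zero]
    exact Finset.sum_nonneg fun p _ => Real.log_nonneg (by linarith [Real.rpow_nonneg (Nat.cast_nonneg (α := ℝ) p) (-(1 + δ))])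
  | succ J ih =>
    rw [Finset.sum_range_succ]
    have hsub : Nat.primesBelow (2 ^ J + 1) ⊆ Nat.primesBelow (2 ^ (J + 1) + 1) := fun p hp => by
      rw [Nat.mem_primesBelow] at hp ⊢
      have : 2 ^ J ≤ 2 ^ (J + 1) := Nat.pow_le_pow_right (by norm_num) (by omega)
      exact ⟨by omega, hp.2⟩
    rw [← Finset.sum_sdiff hsub, add_comm]
    refine add_le_add ?_ ih
    unfold logPrimeSum
    rw [← Finset.sum_sdiff hsub, add_sub_cancel_right, Finset.mul_sum]
    refine Finset.sum_le_sum fun p hp => ?_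
    have hp' := Nat.mem_primesBelow.1 (Finset.mem_sdiff.1 hp).1
    have hp0 : (0:ℝ) < p := by exact_mod_cast hp'.2.pos
    have hp1 : (1:ℝ) ≤ p := by exact_mod_cast hp'.2.one_le
    have e : (p:ℝ) ^ (-(1 + δ)) = (p:ℝ) ^ (-δ) * (1 / p) := by
      rw [neg_add, Real.rpow_add hp0, Real.rpow_neg_one]; ring
    rw [e]
    refine le_trans ?_ (mul_log_one_add_le (by positivity) (Real.rpow_le_one_of_one_le_of_nonpos hp1 (by linarith)) (by positivity))
    refine mul_le_mul_of_nonneg_right ?_ (Real.log_nonneg (by linarith [show 0 < 1 / (p:ℝ) by positivity]))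
    rw [← Real.rpow_natCast, ← Real.rpow_mul (by norm_num), mul_comm, Real.rpow_mul (by norm_num)]
    refine Real.rpow_le_rpow_of_nonpos hp0 ?_ (by linarith)
    rw [Real.rpow_natCast]
    exact_mod_cast (by omega : p ≤ 2 ^ (J + 1))

lemma sum_pow_mul_sub (g : ℕ → ℝ) (q : ℝ) (J : ℕ) :
    ∑ N ∈ Finset.range J, q ^ (N + 1) * (g (N + 1) - g N) = q ^ J * g J - g 0 + (1 - q) * ∑ N ∈ Finset.range J, q ^ N * g N := by
  induction J with
  | zero => simp
  | succ J ih => rw [Finset.sum_range_succ, Finset.sum_range_succ, ih]; ring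

lemma sum_pow_mul_sub_ge {g : ℕ → ℝ} {q G : ℝ} (hq0 : 0 ≤ q) (hq1 : q ≤ 1) {N₀ : ℕ} (hg0 : g 0 = 0) (hG : ∀ N, N₀ ≤ N → G ≤ g N)
    {J : ℕ} (hJ : N₀ ≤ J) :
    q ^ N₀ * G - (1 - q) * ∑ N ∈ Finset.range N₀, |g N| ≤ ∑ N ∈ Finset.range J, q ^ (N + 1) * (g (N + 1) - g N) := by
  rw [sum_pow_mul_sub, hg0, sub_zero]
  have h1 : q ^ N₀ * G - (1 - q) * ∑ N ∈ Finset.range N₀, |g N| ≤ q ^ J * G + (1 - q) * ∑ N ∈ Finset.range J, q ^ N * g N := by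
    induction J, hJ using Nat.le_induction with
    | base =>
      have : ∑ N ∈ Finset.range N₀, -|g N| ≤ ∑ N ∈ Finset.range N₀, q ^ N * g N := by
        refine Finset.sum_le_sum fun N _ => ?_
        have h2 : |q ^ N * g N| ≤ |g N| := by
          rw [abs_mul, abs_of_nonneg (pow_nonneg hq0 N)]
          exact mul_le_of_le_one_left (abs_nonneg _) (pow_le_one₀ hq0 hq1)
        linarith [neg_abs_le (q ^ N * g N)]
      rw [Finset.sum_neg_distrib] at this
      have := mul_le_mul_of_nonneg_left this (show 0 ≤ 1 - q by linarith)
      linarith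
    | succ J hJ ih =>
      rw [Finset.sum_range_succ]
      have h3 : 0 ≤ (1 - q) * (q ^ J * (g J - G)) :=
        mul_nonneg (by linarith) (mul_nonneg (by positivity) (by linarith [hG J hJ]))
      have e : q ^ (J + 1) * G + (1 - q) * (∑ N ∈ Finset.range J, q ^ N * g N + q ^ J * g J) =
        q ^ J * G + (1 - q) * ∑ N ∈ Finset.range J, q ^ N * g N + (1 - q) * (q ^ J * (g J - G)) := by ring
      rw [e]; linarith
  have h2 : q ^ J * G ≤ q ^ J * g J := mul_le_mul_of_nonneg_left (hG J hJ) (by positivity)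
  linarith

lemma tendsto_log_zeta_aux :
    Filter.Tendsto (fun δ : ℝ => Real.log (riemannZeta (1 + δ : ℝ)).re - Real.log (riemannZeta (2 * (1 + δ) : ℝ)).re + Real.log (1 - (2:ℝ) ^ (-δ)))
      (nhdsWithin 0 (Set.Ioi 0)) (nhds (Real.log (6 / π ^ 2) + Real.log (Real.log 2))) := by
  have hl2 : 0 < Real.log 2 := Real.log_pos (by norm_num)
  have h1 : Filter.Tendsto (fun δ : ℝ => Real.log (riemannZeta (1 + δ : ℝ)).re + Real.log δ) (nhdsWithin 0 (Set.Ioi 0)) (nhds 0) := by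
    have h := (Asymptotics.isLittleO_one_iff ℝ).1 log_riemannZeta_add_log_sub_isLittleO_ofReal
    have ht : Filter.Tendsto (fun δ : ℝ => 1 + δ) (nhdsWithin 0 (Set.Ioi 0)) (nhdsWithin 1 (Set.Ioi 1)) := by
      refine tendsto_nhdsWithin_iff.2 ⟨?_, ?_⟩
      · have : Filter.Tendsto (fun δ : ℝ => 1 + δ) (nhds 0) (nhds (1 + 0)) := tendsto_const_nhds.add Filter.tendsto_id
        rw [add_zero] at this
        exact this.mono_left nhdsWithin_le_nhds
      · filter_upwards [self_mem_nhdsWithin] with δ hδ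
        have : (0:ℝ) < δ := hδ
        show (1:ℝ) < 1 + δ
        linarith
    refine (h.comp ht).congr fun δ => ?_
    simp only [Function.comp, add_sub_cancel_left]
  have h2 : Filter.Tendsto (fun δ : ℝ => Real.log (riemannZeta (2 * (1 + δ) : ℝ)).re) (nhdsWithin 0 (Set.Ioi 0)) (nhds (Real.log (π ^ 2 / 6))) := by
    have hc : ContinuousAt (fun δ : ℝ => (riemannZeta ((2 * (1 + δ) : ℝ) : ℂ)).re) 0 := by
      have h3 : ContinuousAt riemannZeta (((2 * (1 + (0:ℝ)) : ℝ)) : ℂ) := by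
        refine (differentiableAt_riemannZeta ?_).continuousAt
        norm_num
      refine Complex.continuous_re.continuousAt.comp (ContinuousAt.comp (f := fun δ : ℝ => ((2 * (1 + δ) : ℝ) : ℂ)) h3 ?_)
      fun_prop
    have e : (riemannZeta ((2 * (1 + 0) : ℝ) : ℂ)).re = π ^ 2 / 6 := by
      rw [show ((2 * (1 + 0) : ℝ) : ℂ) = 2 by norm_num, riemannZeta_two]
      rw [show ((π : ℂ) ^ 2 / 6) = ((π ^ 2 / 6 : ℝ) : ℂ) by push_cast; rfl]
      exact Complex.ofReal_re _
    have h4 := hc.tendsto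
    rw [e] at h4
    exact (h4.log (by positivity)).mono_left nhdsWithin_le_nhds
  have h3 : Filter.Tendsto (fun δ : ℝ => Real.log ((1 - (2:ℝ) ^ (-δ)) / δ)) (nhdsWithin 0 (Set.Ioi 0)) (nhds (Real.log (Real.log 2))) := by
    have hd : HasDerivAt (fun δ : ℝ => 1 - (2:ℝ) ^ (-δ)) (Real.log 2) 0 := by
      have := ((hasDerivAt_neg (0:ℝ)).const_rpow (show (0:ℝ) < 2 by norm_num)).const_sub 1
      have e : -(Real.log 2 * -1 * (2:ℝ) ^ (-(0:ℝ))) = Real.log 2 := by simp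
      rwa [e] at this
    have h4 := hd.tendsto_slope_zero_right
    refine (h4.congr fun δ => ?_).log hl2.ne'
    simp [div_eq_inv_mul]
  refine ((h1.sub h2).add h3).congr' ?_ |>.trans ?_
  · filter_upwards [self_mem_nhdsWithin] with δ hδ
    have hδ : (0:ℝ) < δ := hδ
    have : (2:ℝ) ^ (-δ) < 1 := Real.rpow_lt_one_of_one_lt_of_neg (by norm_num) (by linarith)
    rw [Real.log_div (by linarith) hδ.ne']
    ring
  · rw [zero_sub, ← Real.log_inv, inv_div]

lemma logPrimeSum_two_pow_limit {G : ℝ} {N₀ : ℕ} (hG : ∀ N, N₀ ≤ N → G ≤ logPrimeSum (2 ^ N) - (harmonic N : ℝ)) :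
    G ≤ Real.log (6 / π ^ 2) + Real.log (Real.log 2) := by
  set g : ℕ → ℝ := fun N => logPrimeSum (2 ^ N) - (harmonic N : ℝ) with hg
  have hg0 : g 0 = 0 := by simp [hg, logPrimeSum_one]
  set B := ∑ N ∈ Finset.range N₀, |g N|
  have key : ∀ δ : ℝ, 0 < δ → ((2:ℝ) ^ (-δ)) ^ N₀ * G - (1 - (2:ℝ) ^ (-δ)) * B ≤
      Real.log (riemannZeta (1 + δ : ℝ)).re - Real.log (riemannZeta (2 * (1 + δ) : ℝ)).re + Real.log (1 - (2:ℝ) ^ (-δ)) := by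
    intro δ hδ
    have hq1 : (2:ℝ) ^ (-δ) < 1 := Real.rpow_lt_one_of_one_lt_of_neg (by norm_num) (by linarith)
    have hq0 : 0 < (2:ℝ) ^ (-δ) := by positivity
    have hz : ∀ J, ∑ N ∈ Finset.range J, ((2:ℝ) ^ (-δ)) ^ (N + 1) * (g (N + 1) - g N) + ∑ N ∈ Finset.range J, ((2:ℝ) ^ (-δ)) ^ (N + 1) / (N + 1) ≤
        Real.log (riemannZeta (1 + δ : ℝ)).re - Real.log (riemannZeta (2 * (1 + δ) : ℝ)).re := by
      intro J
      refine le_trans (le_of_eq ?_) ((sum_rpow_mul_logPrimeSum_le hδ J).trans (sum_log_one_add_rpow_le (by linarith) _))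
      rw [← Finset.sum_add_distrib]
      refine Finset.sum_congr rfl fun N _ => ?_
      simp only [hg]
      rw [harmonic_succ]
      push_cast
      have : ((N:ℝ) + 1) ≠ 0 := by positivity
      field_simp; ring
    set q := (2:ℝ) ^ (-δ)
    have hlim := Real.hasSum_pow_div_log_of_abs_lt_one (x := q) (by rwa [abs_of_pos hq0])
    have h := le_of_tendsto hlim.tendsto_sum_nat (b := Real.log (riemannZeta (1 + δ : ℝ)).re - Real.log (riemannZeta (2 * (1 + δ) : ℝ)).re - (q ^ N₀ * G - (1 - q) * B)) ?_
    · linarith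
    · filter_upwards [Filter.eventually_ge_atTop N₀] with J hJ
      have := sum_pow_mul_sub_ge hq0.le hq1.le hg0 hG hJ
      have := hz J
      linarith
  have hq : Filter.Tendsto (fun δ : ℝ => (2:ℝ) ^ (-δ)) (nhdsWithin 0 (Set.Ioi 0)) (nhds 1) := by
    have : ContinuousAt (fun δ : ℝ => (2:ℝ) ^ (-δ)) 0 := by
      refine ContinuousAt.rpow continuousAt_const (by fun_prop) (Or.inl (by norm_num))
    have h := this.tendsto
    rw [neg_zero, Real.rpow_zero] at h
    exact h.mono_left nhdsWithin_le_nhds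
  have hL : Filter.Tendsto (fun δ : ℝ => ((2:ℝ) ^ (-δ)) ^ N₀ * G - (1 - (2:ℝ) ^ (-δ)) * B) (nhdsWithin 0 (Set.Ioi 0)) (nhds (1 ^ N₀ * G - (1 - 1) * B)) :=
    ((hq.pow N₀).mul_const G).sub ((hq.const_sub 1).mul_const B)
  have := le_of_tendsto_of_tendsto hL tendsto_log_zeta_aux (by
    filter_upwards [self_mem_nhdsWithin] with δ hδ using key δ hδ)
  simpa using this

lemma exists_logPrimeSum_upper :
    ∃ C : ℝ, 0 ≤ C ∧ ∀ x : ℕ, 2 ≤ x →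
      logPrimeSum x ≤ Real.log (Real.log x) + Real.eulerMascheroniConstant + Real.log (6 / π ^ 2) + C / Real.log x := by
  obtain ⟨C, hC0, hC⟩ := exists_logPrimeSum_le
  refine ⟨C, hC0, fun x hx => le_of_forall_pos_le_add fun ε hε => ?_⟩
  have h1 := (tendsto_order.1 Real.tendsto_harmonic_sub_log).2 (Real.eulerMascheroniConstant + ε) (by linarith)
  obtain ⟨N₁, hN₁⟩ := Filter.eventually_atTop.1 h1
  have h2 := logPrimeSum_two_pow_limit (N₀ := max N₁ x)
    (G := logPrimeSum x - Real.log (Real.log x) - C / Real.log x + Real.log (Real.log 2) - Real.eulerMascheroniConstant - ε) (by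
    intro N hN
    have hN1 := hN₁ N ((le_max_left _ _).trans hN)
    have hNx : x ≤ N := (le_max_right _ _).trans hN
    have h3 := hC x (2 ^ N) hx (hNx.trans (Nat.lt_two_pow_self).le)
    have hN0 : (0:ℝ) < N := by exact_mod_cast (by omega : 0 < N)
    have h4 : Real.log (Real.log ((2 ^ N : ℕ) : ℝ)) = Real.log N + Real.log (Real.log 2) := by
      push_cast
      rw [Real.log_pow, Real.log_mul hN0.ne' (Real.log_pos (by norm_num)).ne']
    rw [h4] at h3
    linarith)
  linarith

lemma exists_prod_one_add_inv_le :
    ∃ C : ℝ, 0 ≤ C ∧ ∀ x : ℕ, 2 ≤ x →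
      ∏ p ∈ Nat.primesBelow (x + 1), (1 + 1 / (p : ℝ)) ≤
        6 * Real.exp Real.eulerMascheroniConstant / π ^ 2 * Real.log x * Real.exp (C / Real.log x) := by
  obtain ⟨C, hC0, hC⟩ := exists_logPrimeSum_upper
  refine ⟨C, hC0, fun x hx => ?_⟩
  have hx0 : 0 < Real.log x := Real.log_pos (by exact_mod_cast (by omega : 1 < x))
  have h1 : ∏ p ∈ Nat.primesBelow (x + 1), (1 + 1 / (p : ℝ)) = Real.exp (logPrimeSum x) := by
    unfold logPrimeSum
    rw [Real.exp_sum]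
    exact Finset.prod_congr rfl fun p _ => (Real.exp_log (by positivity)).symm
  rw [h1]
  refine (Real.exp_le_exp.2 (hC x hx)).trans (le_of_eq ?_)
  rw [Real.exp_add, Real.exp_add, Real.exp_add, Real.exp_log hx0, Real.exp_log (by positivity)]
  ring

theorem exists_MR_even_le :
    ∃ A' : ℝ, ∀ l : ℕ, Even l → 4 ≤ l →
      MR l ≤ (3 * Real.exp Real.eulerMascheroniConstant / Real.pi ^ 2 * Real.log l + A') ^ l := by
  obtain ⟨C, hC0, hC⟩ := exists_prod_one_add_inv_le
  have h40 : 0 ≤ Real.log 4 := Real.log_nonneg (by norm_num)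
  set D := C + 6 * Real.log 4 with hD
  have hD0 : 0 ≤ D := by positivity
  set E := 3 * Real.exp Real.eulerMascheroniConstant / Real.pi ^ 2 with hE
  have hE0 : 0 ≤ E := by positivity
  refine ⟨E * (D * Real.exp D), fun l hl hl4 => ?_⟩
  have hl0 : (0:ℝ) < l := by exact_mod_cast (by omega : 0 < l)
  have hL1 : 1 ≤ Real.log l := by
    rw [Real.le_log_iff_exp_le hl0]
    have : (4:ℝ) ≤ l := by exact_mod_cast hl4
    linarith [Real.exp_one_lt_d9]
  have h1 := MR_even_le hl (by omega) (sum_inv_sq_primes_gt_le (show 2 ≤ l by omega))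
  have e1 : Real.exp (2 * (l:ℝ) ^ 2 * (3 * Real.log 4 / (l * Real.log l))) = Real.exp (6 * Real.log 4 / Real.log l) ^ l := by
    rw [← Real.exp_nat_mul]
    congr 1
    field_simp
    ring
  rw [e1, ← mul_pow] at h1
  refine h1.trans (pow_le_pow_left₀ (by positivity) ?_ l)
  set L := Real.log (l:ℝ)
  have h2 : Real.exp (D / L) ≤ 1 + D * Real.exp D / L := by
    have h3 : Real.exp (D / L) - 1 ≤ D / L * Real.exp (D / L) := by
      have := Real.add_one_le_exp (-(D / L))
      have h4 : Real.exp (-(D / L)) * Real.exp (D / L) = 1 := by rw [← Real.exp_add]; simp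
      nlinarith [Real.exp_pos (D / L)]
    have h5 : Real.exp (D / L) ≤ Real.exp D := Real.exp_le_exp.2 (div_le_self hD0 hL1)
    have h6 : D / L * Real.exp (D / L) ≤ D / L * Real.exp D := by gcongr
    have e : D * Real.exp D / L = D / L * Real.exp D := by ring
    rw [e]; linarith
  calc (1 / 2 * ∏ p ∈ Nat.primesBelow (l + 1), (1 + 1 / (p:ℝ))) * Real.exp (6 * Real.log 4 / L)
      ≤ 1 / 2 * (6 * Real.exp Real.eulerMascheroniConstant / π ^ 2 * L * Real.exp (C / L)) * Real.exp (6 * Real.log 4 / L) := by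
        gcongr; exact hC l (by omega)
    _ = E * L * Real.exp (D / L) := by
        rw [hD, add_div, Real.exp_add, hE]; ring
    _ ≤ E * L * (1 + D * Real.exp D / L) := by gcongr
    _ = E * L + E * (D * Real.exp D) := by field_simp

lemma abs_pow_sub_pow_le_of_abs_le {a b K : ℝ} (hK : 1 ≤ K) (ha : |a| ≤ K) (hb : |b| ≤ K) (l : ℕ) :
    |a ^ l - b ^ l| ≤ l * K ^ l * |a - b| := by
  refine (abs_pow_sub_pow_le a b l).trans ?_
  have h1 : max |a| |b| ^ (l - 1) ≤ K ^ l :=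
    (pow_le_pow_left₀ (le_max_of_le_left (abs_nonneg a)) (max_le ha hb) _).trans (pow_le_pow_right₀ hK (Nat.sub_le l 1))
  calc |a - b| * l * max |a| |b| ^ (l - 1) ≤ |a - b| * l * K ^ l := by gcongr
    _ = _ := by ring

lemma abs_le_half_add_sq_div {t : ℝ} (ht : 0 < t) (x : ℝ) : |x| ≤ t / 2 + x ^ 2 * (1 / (2 * t)) := by
  have : t / 2 + x ^ 2 * (1 / (2 * t)) = (t ^ 2 + x ^ 2) / (2 * t) := by field_simp
  rw [this, le_div_iff₀ (by positivity), ← sq_abs x]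
  nlinarith [sq_nonneg (t - |x|)]

lemma perMean_const (c : ℝ) {L : ℕ} (hL : L ≠ 0) : perMean (fun _ => c) L = c := by
  have : (L:ℝ) ≠ 0 := by exact_mod_cast hL
  simp only [perMean, intervalIntegral.integral_const, smul_eq_mul, sub_zero]
  field_simp

lemma abs_perMean_pow_sub_le {f g T : ℝ → ℝ} (hf : Tame f) (hg : Tame g) (hT : Tame T) (hfg : ∀ x, f x = g x + T x)
    {K t : ℝ} (hK : 1 ≤ K) (hfK : ∀ x, |f x| ≤ K) (hgK : ∀ x, |g x| ≤ K) (ht : 0 < t) {L : ℕ} (hL : L ≠ 0)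
    (hTt : perMean (fun x => T x ^ 2) L ≤ t ^ 2) (l : ℕ) :
    |perMean (fun x => f x ^ l) L - perMean (fun x => g x ^ l) L| ≤ l * K ^ l * t := by
  set A : ℝ := l * K ^ l with hA
  have hA0 : 0 ≤ A := by positivity
  have hpt : ∀ x, |f x ^ l - g x ^ l| ≤ A * (t / 2) + A * (1 / (2 * t)) * T x ^ 2 := by
    intro x
    refine (abs_pow_sub_pow_le_of_abs_le hK (hfK x) (hgK x) l).trans ?_
    have := mul_le_mul_of_nonneg_left (abs_le_half_add_sq_div ht (f x - g x)) hA0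
    refine this.trans (le_of_eq ?_)
    rw [hfg x]; ring
  have hR : Tame (fun x => A * (t / 2) + A * (1 / (2 * t)) * T x ^ 2) :=
    (Tame.const _).add ((Tame.const _).mul (hT.pow 2))
  have hRm : perMean (fun x => A * (t / 2) + A * (1 / (2 * t)) * T x ^ 2) L ≤ A * t := by
    rw [perMean_add (Tame.const _) ((Tame.const _).mul (hT.pow 2)), perMean_const _ hL, perMean_const_mul]
    calc _ ≤ A * (t / 2) + A * (1 / (2 * t)) * t ^ 2 := by gcongr
      _ = _ := by field_simp; ring
  have h1 := perMean_mono (hf.pow l) ((hg.pow l).add hR) (fun x => by linarith [(abs_le.1 (hpt x)).2]) L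
  have h2 := perMean_mono (hg.pow l) ((hf.pow l).add hR) (fun x => by linarith [(abs_le.1 (hpt x)).1]) L
  rw [perMean_add (hg.pow l) hR] at h1
  rw [perMean_add (hf.pow l) hR] at h2
  rw [abs_le]; constructor <;> linarith

lemma abs_sawSum_Icc_le (V : ℕ) (u : ℝ) : |sawSum (Finset.Icc 1 V) u| ≤ 1 + Real.log V := by
  have h1 := abs_sawSum_le_sum_inv (Finset.Icc 1 V) u
  have h2 := sum_Icc_inv_le V
  have h3 := Real.log_natCast_nonneg V
  linarith

lemma abs_MRfin_two_mul_sub_le {V : ℕ} (hV : 1 ≤ V) (l : ℕ) :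
    |MRfin l (Finset.Icc 1 (2 * V)) - MRfin l (Finset.Icc 1 V)| ≤
      l * (1 + Real.log (2 * V)) ^ l * Real.sqrt (8 / V) := by
  have hV0 : (0:ℝ) < V := by exact_mod_cast hV
  have hdvd : ∀ d, 1 ≤ d → d ≤ 2 * V → d ∣ (2 * V).factorial := fun d h1 h2 => Nat.dvd_factorial h1 h2
  have hL := Nat.factorial_ne_zero (2 * V)
  have hlog : Real.log V ≤ Real.log (2 * V) := Real.log_le_log hV0 (by linarith)
  have hlog0 := Real.log_natCast_nonneg V
  rw [← perMean_sawSum_pow (fun d hd => by rw [Finset.mem_Icc] at hd; omega) l hL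
      (fun d hd => by rw [Finset.mem_Icc] at hd; exact hdvd d hd.1 hd.2),
    ← perMean_sawSum_pow (D := Finset.Icc 1 V) (fun d hd => by rw [Finset.mem_Icc] at hd; omega) l hL
      (fun d hd => by rw [Finset.mem_Icc] at hd; exact hdvd d hd.1 (by omega))]
  refine abs_perMean_pow_sub_le (tame_sawSum _) (tame_sawSum _) (tame_sawSum (Finset.Ioc V (2 * V)))
    (fun x => sawSum_Icc_add_Ioc (by omega) x) (by linarith) (fun x => ?_) (fun x => ?_) (by positivity) hL ?_ l
  · have := abs_sawSum_Icc_le (2 * V) x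
    push_cast at this; exact this
  · linarith [abs_sawSum_Icc_le V x]
  · rw [Real.sq_sqrt (by positivity), perMean_sawSum_pow (fun d hd => by rw [Finset.mem_Ioc] at hd; omega) 2 hL
      (fun d hd => by rw [Finset.mem_Ioc] at hd; exact hdvd d (by omega) hd.2)]
    exact MRfin_two_Ioc_le hV

lemma pow_le_mul_pow_mul_exp {x : ℝ} (hx : 0 ≤ x) (l : ℕ) : x ^ l ≤ (4 * l : ℝ) ^ l * Real.exp (x / 4) := by
  have h := Real.pow_div_factorial_le_exp (x := x / 4) (by positivity) l
  rw [div_le_iff₀ (by positivity)] at h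
  have h1 : (l.factorial : ℝ) ≤ (l:ℝ) ^ l := by exact_mod_cast Nat.factorial_le_pow l
  calc x ^ l = 4 ^ l * (x / 4) ^ l := by rw [← mul_pow]; congr 1; ring
    _ ≤ 4 ^ l * (Real.exp (x / 4) * (l:ℝ) ^ l) := by
        refine mul_le_mul_of_nonneg_left (h.trans ?_) (by positivity)
        gcongr
    _ = _ := by rw [mul_pow]; ring

lemma abs_MRfin_two_mul_sub_le' {V : ℕ} (hV : 1 ≤ V) (l : ℕ) :
    |MRfin l (Finset.Icc 1 (2 * V)) - MRfin l (Finset.Icc 1 V)| ≤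
      6 * (l * (4 * l : ℝ) ^ l) * Real.exp (-(Real.log V / 4)) := by
  have hV0 : (0:ℝ) < V := by exact_mod_cast hV
  refine (abs_MRfin_two_mul_sub_le hV l).trans ?_
  have hlog0 := Real.log_natCast_nonneg V
  have e0 : Real.log (2 * V) = Real.log 2 + Real.log V := Real.log_mul (by norm_num) hV0.ne'
  have hl2 : Real.log 2 ≤ 1 := by linarith [Real.log_two_lt_d9]
  have hl20 : 0 ≤ Real.log 2 := Real.log_nonneg (by norm_num)
  have h1 := pow_le_mul_pow_mul_exp (x := 1 + Real.log (2 * V)) (by linarith) l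
  have h2 : Real.exp ((1 + Real.log (2 * V)) / 4) ≤ 2 * Real.exp (Real.log V / 4) := by
    have h3 : Real.exp ((1 + Real.log (2 * V)) / 4) ≤ Real.exp (1 / 2 + Real.log V / 4) :=
      Real.exp_le_exp.2 (by linarith)
    rw [Real.exp_add] at h3
    have h4 : Real.exp (1 / 2) ≤ 2 := by
      have : Real.exp (1 / 2) ^ 2 = Real.exp 1 := by rw [← Real.exp_nat_mul]; norm_num
      nlinarith [Real.exp_one_lt_d9, Real.exp_pos (1 / 2)]
    exact h3.trans (by gcongr)
  have h5 : Real.sqrt (8 / V) ≤ 3 * Real.exp (-(Real.log V / 2)) := by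
    rw [Real.sqrt_le_left (by positivity), mul_pow, ← Real.exp_nat_mul]
    have : Real.exp ((2:ℕ) * -(Real.log V / 2)) = 1 / V := by
      rw [show ((2:ℕ):ℝ) * -(Real.log V / 2) = -Real.log V by push_cast; ring, Real.exp_neg, Real.exp_log hV0, one_div]
    rw [this]
    calc 8 / (V:ℝ) ≤ 9 / V := by gcongr; norm_num
      _ = _ := by ring
  calc (l:ℝ) * (1 + Real.log (2 * V)) ^ l * Real.sqrt (8 / V)
      ≤ l * ((4 * l : ℝ) ^ l * (2 * Real.exp (Real.log V / 4))) * (3 * Real.exp (-(Real.log V / 2))) := by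
        refine mul_le_mul (mul_le_mul_of_nonneg_left (h1.trans ?_) (by positivity)) h5 (by positivity) (by positivity)
        gcongr
    _ = 6 * (l * (4 * l : ℝ) ^ l) * (Real.exp (Real.log V / 4) * Real.exp (-(Real.log V / 2))) := by ring
    _ = _ := by rw [← Real.exp_add]; congr 2; ring

lemma exists_abs_MRfin_sub_MR_le :
    ∃ C : ℝ, 0 ≤ C ∧ ∀ z : ℕ, 1 ≤ z → ∀ l : ℕ,
      |MRfin l (Finset.Icc 1 z) - MR l| ≤ C * (l * (4 * l : ℝ) ^ l) * Real.exp (-(Real.log z / 4)) := by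
  set r := Real.exp (-(Real.log 2 / 4)) with hr
  have hr0 : 0 < r := Real.exp_pos _
  have hr1 : r < 1 := by
    rw [hr, Real.exp_lt_one_iff]
    linarith [Real.log_pos (show (1:ℝ) < 2 by norm_num)]
  refine ⟨6 * (1 - r)⁻¹, by have : 0 < 1 - r := by linarith
                            positivity, fun z hz l => ?_⟩
  have hz0 : (0:ℝ) < z := by exact_mod_cast hz
  set X : ℝ := 6 * (l * (4 * l : ℝ) ^ l) * Real.exp (-(Real.log z / 4)) with hX
  have hX0 : 0 ≤ X := by positivity
  have hstep : ∀ i : ℕ, |MRfin l (Finset.Icc 1 (z * 2 ^ (i + 1))) - MRfin l (Finset.Icc 1 (z * 2 ^ i))| ≤ X * r ^ i := by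
    intro i
    have h := abs_MRfin_two_mul_sub_le' (V := z * 2 ^ i) (Nat.mul_pos hz (by positivity)) l
    rw [show 2 * (z * 2 ^ i) = z * 2 ^ (i + 1) by ring] at h
    refine h.trans (le_of_eq ?_)
    rw [hX, hr, ← Real.exp_nat_mul, mul_assoc _ (Real.exp _) (Real.exp _), ← Real.exp_add]
    congr 2
    push_cast
    rw [Real.log_mul hz0.ne' (by positivity), Real.log_pow]
    ring
  have hk : ∀ k : ℕ, |MRfin l (Finset.Icc 1 z) - MRfin l (Finset.Icc 1 (z * 2 ^ k))| ≤ X * ∑ i ∈ Finset.range k, r ^ i := by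
    intro k
    induction k with
    | zero => simp
    | succ k ih =>
      rw [Finset.sum_range_succ, mul_add]
      refine (abs_sub_le _ (MRfin l (Finset.Icc 1 (z * 2 ^ k))) _).trans (add_le_add ih ?_)
      rw [abs_sub_comm]; exact hstep k
  have hlim := tendsto_MRfin l (D := fun k => Finset.Icc 1 (z * 2 ^ k))
    (fun a b hab => Finset.Icc_subset_Icc_right (Nat.mul_le_mul_left z (Nat.pow_le_pow_right (by norm_num) hab)))
    (fun n hn => ⟨n, Finset.mem_Icc.2 ⟨Nat.pos_of_ne_zero hn.ne_zero,
      (Nat.lt_two_pow_self).le.trans (Nat.le_mul_of_pos_left _ hz)⟩⟩)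
  refine le_of_tendsto (hlim.const_sub _).abs (Filter.Eventually.of_forall fun k => (hk k).trans ?_)
  have hg : ∑ i ∈ Finset.range k, r ^ i ≤ (1 - r)⁻¹ := by
    rw [← tsum_geometric_of_lt_one hr0.le hr1]
    exact (summable_geometric_of_lt_one hr0.le hr1).sum_le_tsum _ fun i _ => by positivity
  refine (mul_le_mul_of_nonneg_left hg hX0).trans (le_of_eq ?_)
  rw [hX]; ring

lemma Tame.abs {f : ℝ → ℝ} (hf : Tame f) : Tame (fun x => |f x|) := by
  obtain ⟨C, hC, h⟩ := hf.bdd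
  exact ⟨hf.meas.abs, C, hC, fun x => by rw [abs_abs]; exact h x⟩

lemma abs_integral_pow_sub_integral_pow_le {f g : ℝ → ℝ} (hf : Tame f) (hg : Tame g) {K Y : ℝ} (hK : 1 ≤ K)
    (hfK : ∀ x, |f x| ≤ K) (hgK : ∀ x, |g x| ≤ K) (hY : 0 ≤ Y) (l : ℕ) :
    |(∫ u in (0:ℝ)..Y, f u ^ l) - ∫ u in (0:ℝ)..Y, g u ^ l| ≤
      l * K ^ l * ∫ u in (0:ℝ)..Y, |f u - g u| := by
  have hd : Tame (fun u => |f u - g u|) := by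
    have : Tame (fun u => f u + (-1) * g u) := hf.add ((Tame.const (-1)).mul hg)
    convert this.abs using 3; ring
  rw [← intervalIntegral.integral_sub ((hf.pow l).intervalIntegrable _ _) ((hg.pow l).intervalIntegrable _ _),
    ← intervalIntegral.integral_const_mul]
  refine (intervalIntegral.abs_integral_le_integral_abs hY).trans
    (intervalIntegral.integral_mono_on hY ?_ ?_ fun u _ => abs_pow_sub_pow_le_of_abs_le hK (hfK u) (hgK u) l)
  · exact (((hf.pow l).intervalIntegrable _ _).sub ((hg.pow l).intervalIntegrable _ _)).abs
  · exact (hd.intervalIntegrable _ _).const_mul _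

lemma integral_abs_le_of_integral_sq_le {f : ℝ → ℝ} (hf : Tame f) {Y t : ℝ} (hY : 0 ≤ Y) (ht : 0 < t)
    (h : ∫ u in (0:ℝ)..Y, f u ^ 2 ≤ Y * t ^ 2) : ∫ u in (0:ℝ)..Y, |f u| ≤ Y * t := by
  have h1 : ∫ u in (0:ℝ)..Y, |f u| ≤ ∫ u in (0:ℝ)..Y, (t / 2 + f u ^ 2 * (1 / (2 * t))) :=
    intervalIntegral.integral_mono_on hY (hf.abs.intervalIntegrable _ _)
      ((((Tame.const _).add ((hf.pow 2).mul (Tame.const _)))).intervalIntegrable _ _)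
      fun u _ => abs_le_half_add_sq_div ht (f u)
  rw [intervalIntegral.integral_add ((Tame.const _).intervalIntegrable _ _)
    (((hf.pow 2).mul (Tame.const _)).intervalIntegrable _ _), intervalIntegral.integral_mul_const,
    intervalIntegral.integral_const, smul_eq_mul, sub_zero] at h1
  have h2 : (∫ u in (0:ℝ)..Y, f u ^ 2) * (1 / (2 * t)) ≤ Y * t ^ 2 * (1 / (2 * t)) := by gcongr
  have h3 : Y * t ^ 2 * (1 / (2 * t)) = Y * (t / 2) := by field_simp
  linarith

lemma integral_abs_le_of_ae {f : ℝ → ℝ} (hf : Tame f) {x₀ Y K ε : ℝ} (hx₀ : 0 ≤ x₀) (hY : x₀ ≤ Y)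
    (hK : ∀ u, |f u| ≤ K) (hε : 0 ≤ ε) (h : ∀ᵐ u : ℝ, x₀ ≤ u → u ≤ Y → |f u| ≤ ε) :
    ∫ u in (0:ℝ)..Y, |f u| ≤ K * x₀ + ε * Y := by
  rw [← intervalIntegral.integral_add_adjacent_intervals (hf.abs.intervalIntegrable 0 x₀) (hf.abs.intervalIntegrable x₀ Y)]
  have h1 : ∫ u in (0:ℝ)..x₀, |f u| ≤ K * x₀ := by
    have := intervalIntegral.integral_mono_on hx₀ (hf.abs.intervalIntegrable _ _)
      ((Tame.const K).intervalIntegrable _ _) fun u _ => hK u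
    rw [intervalIntegral.integral_const, smul_eq_mul, sub_zero] at this
    linarith
  have h2 : ∫ u in x₀..Y, |f u| ≤ ε * Y := by
    have := intervalIntegral.integral_mono_ae_restrict hY (hf.abs.intervalIntegrable _ _)
      ((Tame.const ε).intervalIntegrable _ _)
      ((ae_restrict_iff' measurableSet_Icc).2 (h.mono fun u hu hm => hu hm.1 hm.2))
    rw [intervalIntegral.integral_const, smul_eq_mul] at this
    nlinarith
  exact add_le_add h1 h2

lemma abs_clamp_le {K : ℝ} (hK : 0 ≤ K) (x : ℝ) : |max (-K) (min K x)| ≤ K :=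
  abs_le.2 ⟨le_max_left _ _, max_le (by linarith) (min_le_left _ _)⟩

lemma clamp_eq_self {K x : ℝ} (h : |x| ≤ K) : max (-K) (min K x) = x := by
  rw [min_eq_right (abs_le.1 h).2, max_eq_right (abs_le.1 h).1]

lemma abs_integral_Rtilde_pow_sub_le {y K ε t x₀ : ℝ} {z N : ℕ} (hz : 1 ≤ z) (hzN : z ≤ N) (hNy : (N:ℝ) ≤ y) (hx₀ : 0 ≤ x₀)
    (hx₀y : x₀ ≤ y) (hKy : 12 + Real.log y ≤ K) (hε : 0 ≤ ε) (ht : 0 < t)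
    (hR : ∀ u, Int.fract u ≠ 0 → x₀ ≤ u → u ≤ y → |Rtilde u + sawSum (Finset.Icc 1 N) u| ≤ ε)
    (hI : ∫ u in (0:ℝ)..y, (sawSum (Finset.Icc 1 N) u - sawSum (Finset.Icc 1 z) u) ^ 2 ≤ y * t ^ 2) (l : ℕ) :
    |(∫ u in (0:ℝ)..y, Rtilde u ^ l) - (-1) ^ l * ∫ u in (0:ℝ)..y, sawSum (Finset.Icc 1 z) u ^ l| ≤
      l * K ^ l * (2 * K * x₀ + ε * y + y * t) := by
  have hz0 : (1:ℝ) ≤ z := by exact_mod_cast hz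
  have hzN' : (z:ℝ) ≤ N := by exact_mod_cast hzN
  have hN0 : (1:ℝ) ≤ N := hz0.trans hzN'
  have hy1 : 1 ≤ y := hN0.trans hNy
  have hlogy : 0 ≤ Real.log y := Real.log_nonneg hy1
  have hK1 : 1 ≤ K := by linarith
  set G : ℝ → ℝ := fun u => max (-K) (min K (Rtilde u)) with hG
  have hGK : ∀ u, |G u| ≤ K := fun u => abs_clamp_le (by linarith) _
  have hGt : Tame G := ⟨measurable_const.max (measurable_const.min measurable_Rtilde), K, by linarith, hGK⟩
  have hGR : ∀ u, Int.fract u ≠ 0 → 0 ≤ u → u ≤ y → G u = Rtilde u := by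
    intro u hu h0 huy
    have hu0 : 0 < u := lt_of_le_of_ne h0 fun h => hu (by rw [← h]; simp)
    exact clamp_eq_self ((abs_Rtilde_le hu hu0 huy hy1).trans hKy)
  have hS : ∀ V : ℕ, 1 ≤ V → V ≤ N → ∀ u, |sawSum (Finset.Icc 1 V) u| ≤ K := by
    intro V hV hVN u
    have hV' : (V:ℝ) ≤ y := le_trans (by exact_mod_cast hVN) hNy
    have := Real.log_le_log (by exact_mod_cast hV) hV'
    linarith [abs_sawSum_Icc_le V u]
  have hcongr : ∫ u in (0:ℝ)..y, Rtilde u ^ l = ∫ u in (0:ℝ)..y, G u ^ l := by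
    refine intervalIntegral.integral_congr_ae (ae_fract_ne_zero.mono fun u hu hm => ?_)
    rw [Set.uIoc_of_le (by linarith)] at hm
    rw [hGR u hu hm.1.le hm.2]
  have hneg : Tame (fun u => -1 * sawSum (Finset.Icc 1 z) u) := (Tame.const (-1)).mul (tame_sawSum _)
  have hfN : Tame (fun u => G u + sawSum (Finset.Icc 1 N) u) := hGt.add (tame_sawSum _)
  have hNz : Tame (fun u => sawSum (Finset.Icc 1 N) u - sawSum (Finset.Icc 1 z) u) := by
    convert (tame_sawSum (Finset.Icc 1 N)).add hneg using 2; ring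
  have h1 : ∫ u in (0:ℝ)..y, |G u + sawSum (Finset.Icc 1 N) u| ≤ 2 * K * x₀ + ε * y := by
    refine integral_abs_le_of_ae hfN hx₀ hx₀y (fun u => ?_) hε (ae_fract_ne_zero.mono fun u hu h1 h2 => ?_)
    · exact (abs_add_le _ _).trans (by linarith [hGK u, hS N (hz.trans hzN) le_rfl u])
    · rw [hGR u hu (hx₀.trans h1) h2]; exact hR u hu h1 h2
  have h2 := integral_abs_le_of_integral_sq_le hNz (by linarith) ht hI
  have h3 : ∫ u in (0:ℝ)..y, |G u - -1 * sawSum (Finset.Icc 1 z) u| ≤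
      (∫ u in (0:ℝ)..y, |G u + sawSum (Finset.Icc 1 N) u|) +
        ∫ u in (0:ℝ)..y, |sawSum (Finset.Icc 1 N) u - sawSum (Finset.Icc 1 z) u| := by
    rw [← intervalIntegral.integral_add (hfN.abs.intervalIntegrable _ _) (hNz.abs.intervalIntegrable _ _)]
    have ht' : Tame (fun u => |G u - -1 * sawSum (Finset.Icc 1 z) u|) := by
      convert (hGt.add (tame_sawSum (Finset.Icc 1 z))).abs using 3; ring
    refine intervalIntegral.integral_mono_on (by linarith) (ht'.intervalIntegrable _ _)
      ((hfN.abs.add hNz.abs).intervalIntegrable _ _) fun u _ => ?_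
    rw [show G u - -1 * sawSum (Finset.Icc 1 z) u =
      (G u + sawSum (Finset.Icc 1 N) u) - (sawSum (Finset.Icc 1 N) u - sawSum (Finset.Icc 1 z) u) by ring]
    exact abs_sub _ _
  have h4 := abs_integral_pow_sub_integral_pow_le hGt hneg hK1 hGK
    (fun u => by rw [neg_one_mul, abs_neg]; exact hS z hz hzN u) (show 0 ≤ y by linarith) l
  have h5 : ∫ u in (0:ℝ)..y, (-1 * sawSum (Finset.Icc 1 z) u) ^ l =
      (-1) ^ l * ∫ u in (0:ℝ)..y, sawSum (Finset.Icc 1 z) u ^ l := by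
    rw [← intervalIntegral.integral_const_mul]; simp only [mul_pow]
  rw [hcongr, ← h5]
  refine h4.trans (mul_le_mul_of_nonneg_left (by linarith) (by positivity))

set_option maxHeartbeats 1000000 in
lemma exists_sawSum_approx_Rtilde {c₀ C₀ κ : ℝ} (hC₀ : 0 < C₀)
    (hM : ∀ N : ℕ, 1 ≤ N → |∑ n ∈ Finset.Icc 1 N, (ArithmeticFunction.moebius n : ℝ)| ≤
      C₀ * N * Real.exp (-c₀ * Real.sqrt (Real.log N)))
    (hκ : 0 < κ) (hκ8 : κ ≤ 1 / 8) (hκc : 6 * κ ≤ c₀) {w : ℝ} (hw : 13 ≤ w) :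
    ∃ z : ℕ, 1 ≤ z ∧ Real.exp w ≤ z ∧ (z : ℝ) ≤ Real.exp (2 * w) ∧ ∀ l : ℕ,
      |(∫ u in (0:ℝ)..Real.exp (w ^ 2), Rtilde u ^ l) -
          (-1) ^ l * ∫ u in (0:ℝ)..Real.exp (w ^ 2), sawSum (Finset.Icc 1 z) u ^ l| ≤
        l * (13 * w ^ 2) ^ l *
          ((27 + 10 * C₀ + 240 * Real.exp Real.pi) * w ^ 2 * Real.exp (-(κ * w)) * Real.exp (w ^ 2)) := by
  set y := Real.exp (w ^ 2) with hy
  set e := Real.exp (-(κ * w)) with he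
  have hy0 : 0 < y := Real.exp_pos _
  have he0 : 0 < e := Real.exp_pos _
  have hκw : κ * w ≤ w / 8 := by nlinarith
  have hκw0 : 0 < κ * w := by positivity
  have he1 : e ≤ 1 := by rw [he, Real.exp_le_one_iff]; linarith
  have he2 : e ^ 2 = Real.exp (-(2 * (κ * w))) := by rw [he, ← Real.exp_nat_mul]; congr 1; push_cast; ring
  have he3 : e ^ 3 = Real.exp (-(3 * (κ * w))) := by rw [he, ← Real.exp_nat_mul]; congr 1; push_cast; ring
  set z := ⌈Real.exp w⌉₊ with hz
  have hzl : Real.exp w ≤ z := Nat.le_ceil _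
  have hz1 : (1:ℝ) ≤ z := (Real.one_le_exp (by linarith)).trans hzl
  have hzN1 : 1 ≤ z := by exact_mod_cast hz1
  have hzu : (z:ℝ) ≤ Real.exp (2 * w) := by
    have h1 : (z:ℝ) < Real.exp w + 1 := Nat.ceil_lt_add_one (Real.exp_pos _).le
    have h2 : Real.exp (2 * w) = Real.exp w ^ 2 := by rw [← Real.exp_nat_mul]; norm_num
    have h3 := Real.add_one_le_exp w
    nlinarith
  have hzy : (z:ℝ) ≤ y * e ^ 2 := by
    refine hzu.trans ?_
    rw [he2, hy, ← Real.exp_add]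
    exact Real.exp_le_exp.2 (by nlinarith)
  obtain ⟨k, hk1, hk2⟩ := exists_nat_pow_near (x := y * e ^ 2 / z) (y := 2)
    (by rw [le_div_iff₀ (by linarith)]; linarith) (by norm_num)
  rw [le_div_iff₀ (by linarith)] at hk1
  rw [div_lt_iff₀ (by linarith)] at hk2
  set N := z * 2 ^ k with hN
  have hNc : (N:ℝ) = z * 2 ^ k := by rw [hN]; push_cast; ring
  have hzN : z ≤ N := Nat.le_mul_of_pos_right _ (by positivity)
  have hN1 : 1 ≤ N := hzN1.trans hzN
  have hN0 : (0:ℝ) < N := by exact_mod_cast hN1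
  have hNu : (N:ℝ) ≤ y * e ^ 2 := by rw [hNc]; linarith
  have hNl : y * e ^ 2 ≤ 2 * N := by rw [hNc]; rw [pow_succ (2:ℝ) k] at hk2; linarith
  have he2e : e ^ 2 ≤ e := by nlinarith
  have hNye : (N:ℝ) ≤ y * e := hNu.trans (by gcongr)
  have hyey : y * e ≤ y := by nlinarith
  have hNy : (N:ℝ) ≤ y := hNye.trans hyey
  have hlogy : Real.log y = w ^ 2 := Real.log_exp _
  have hlogN : Real.log N ≤ w ^ 2 := by rw [← hlogy]; exact Real.log_le_log hN0 hNy
  have hk : (k:ℝ) ≤ 2 * w ^ 2 := by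
    have h1 : Real.log ((2:ℝ) ^ k) ≤ Real.log y := by
      refine Real.log_le_log (by positivity) (le_trans ?_ hNy)
      rw [hNc]; exact le_mul_of_one_le_left (by positivity) hz1
    rw [Real.log_pow, hlogy] at h1
    have := Real.log_two_gt_d9
    have hk0 : (0:ℝ) ≤ k := Nat.cast_nonneg k
    nlinarith
  have hlogN' : (w / 2) ^ 2 ≤ Real.log N := by
    rw [Real.le_log_iff_exp_le hN0]
    have h1 : Real.exp ((w / 2) ^ 2) * 2 ≤ y * e ^ 2 := by
      have h2 : (2:ℝ) ≤ Real.exp 1 := by linarith [Real.add_one_le_exp (1:ℝ)]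
      calc Real.exp ((w / 2) ^ 2) * 2 ≤ Real.exp ((w / 2) ^ 2) * Real.exp 1 := by gcongr
        _ ≤ y * e ^ 2 := by
          rw [he2, hy, ← Real.exp_add, ← Real.exp_add]
          exact Real.exp_le_exp.2 (by nlinarith)
    linarith
  have hδ : ∀ j, N ≤ j → |∑ n ∈ Finset.Icc 1 j, (ArithmeticFunction.moebius n : ℝ)| ≤ (C₀ * e ^ 3) * j := by
    intro j hj
    refine (hM j (hN1.trans hj)).trans ?_
    have h1 : w / 2 ≤ Real.sqrt (Real.log j) :=
      Real.le_sqrt_of_sq_le (hlogN'.trans (Real.log_le_log hN0 (by exact_mod_cast hj)))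
    have h2 : Real.exp (-c₀ * Real.sqrt (Real.log j)) ≤ e ^ 3 := by
      rw [he3]; exact Real.exp_le_exp.2 (by nlinarith)
    calc C₀ * j * Real.exp (-c₀ * Real.sqrt (Real.log j)) ≤ C₀ * j * e ^ 3 := by gcongr
      _ = _ := by ring
  have hR : ∀ u, Int.fract u ≠ 0 → y * e ≤ u → u ≤ y →
      |Rtilde u + sawSum (Finset.Icc 1 N) u| ≤ (10 * C₀ + 1) * e := by
    intro u hu h1 h2
    have hu0 : 0 < u := lt_of_lt_of_le (by positivity) h1
    refine (abs_Rtilde_add_sawSum_le hu hN1 (Nat.le_floor (hNye.trans h1)) (by positivity) hδ).trans ?_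
    have h3 : 5 * (C₀ * e ^ 3) * u / N ≤ 10 * C₀ * e := by
      rw [div_le_iff₀ hN0]
      calc 5 * (C₀ * e ^ 3) * u ≤ 5 * (C₀ * e ^ 3) * y := by gcongr
        _ = 5 * C₀ * e * (y * e ^ 2) := by ring
        _ ≤ 5 * C₀ * e * (2 * N) := by gcongr
        _ = _ := by ring
    have h4 : N / (8 * u) ≤ e := by
      rw [div_le_iff₀ (by positivity)]
      nlinarith [mul_le_mul_of_nonneg_left h1 he0.le]
    linarith
  have hE : (1:ℝ) ≤ Real.exp Real.pi := Real.one_le_exp Real.pi_pos.le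
  have hw2 : 169 ≤ w ^ 2 := by nlinarith
  have hI : ∫ u in (0:ℝ)..y, (sawSum (Finset.Icc 1 N) u - sawSum (Finset.Icc 1 z) u) ^ 2 ≤
      y * (240 * Real.exp Real.pi * w ^ 2 * e) ^ 2 := by
    refine (integral_sq_sawSum_sub_le hzN1 k hy0.le).trans ?_
    have h1 : 2 * y / z ≤ 2 * y * e ^ 2 := by
      rw [div_le_iff₀ (by linarith)]
      have : 1 ≤ e ^ 2 * z := by
        refine le_trans ?_ (mul_le_mul_of_nonneg_left hzl (by positivity))
        rw [he2, ← Real.exp_add]; exact Real.one_le_exp (by linarith)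
      calc 2 * y ≤ 2 * y * (e ^ 2 * z) := le_mul_of_one_le_right (by positivity) this
        _ = _ := by ring
    have h2 : 4 * (N:ℝ) * (1 + Real.log N) ≤ 4 * (y * e ^ 2) * (2 * w ^ 2) := by
      have : 1 + Real.log N ≤ 2 * w ^ 2 := by linarith
      gcongr
    calc 12 * Real.exp Real.pi * k * (2 * y / z + 4 * (N:ℝ) * (1 + Real.log N))
        ≤ 12 * Real.exp Real.pi * (2 * w ^ 2) * (2 * y * e ^ 2 * w ^ 2 + 4 * (y * e ^ 2) * (2 * w ^ 2)) := by
          have h3 : 2 * y / z + 4 * (N:ℝ) * (1 + Real.log N) ≤ 2 * y * e ^ 2 * w ^ 2 + 4 * (y * e ^ 2) * (2 * w ^ 2) :=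
            add_le_add (h1.trans (le_mul_of_one_le_right (by positivity) (by linarith))) h2
          refine mul_le_mul (mul_le_mul_of_nonneg_left hk (by positivity)) h3 ?_ (by positivity)
          have := Real.log_natCast_nonneg N
          positivity
      _ = y * (w ^ 2 * e) ^ 2 * (240 * Real.exp Real.pi) := by ring
      _ ≤ y * (w ^ 2 * e) ^ 2 * (240 * Real.exp Real.pi) ^ 2 :=
          mul_le_mul_of_nonneg_left (by nlinarith) (by positivity)
      _ = _ := by ring
  refine ⟨z, hzN1, hzl, hzu, fun l => ?_⟩
  refine (abs_integral_Rtilde_pow_sub_le (K := 13 * w ^ 2) hzN1 hzN hNy (by positivity) hyey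
    (by rw [hlogy]; linarith) (by positivity) (by positivity) hR hI l).trans ?_
  refine mul_le_mul_of_nonneg_left ?_ (by positivity)
  have h1 : (10 * C₀ + 1) * e * y ≤ (10 * C₀ + 1) * e * y * w ^ 2 :=
    le_mul_of_one_le_right (by positivity) (by linarith)
  calc 2 * (13 * w ^ 2) * (y * e) + (10 * C₀ + 1) * e * y + y * (240 * Real.exp Real.pi * w ^ 2 * e)
      ≤ 2 * (13 * w ^ 2) * (y * e) + (10 * C₀ + 1) * e * y * w ^ 2 + y * (240 * Real.exp Real.pi * w ^ 2 * e) := by linarith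
    _ = _ := by ring

set_option maxHeartbeats 1000000 in
lemma exists_moment_approx :
    ∃ c : ℝ, 0 < c ∧ c < 1 ∧ ∃ A : ℝ, ∃ y₀ : ℝ, ∀ y : ℝ, y₀ ≤ y → ∀ l : ℕ, 2 ≤ l →
      (l : ℝ) ≤ c / 9 * Real.sqrt (Real.log y) / Real.log (Real.log y) →
        |(1 / y) * (∫ u in (0 : ℝ)..y, Rtilde u ^ l) - MR l| ≤
          A * Real.exp (-(c / 8 * Real.sqrt (Real.log y))) := by
  obtain ⟨c₀, C₀, hc₀, hC₀, hM⟩ := exists_mertens_bound_nat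
  obtain ⟨C₁, hC₁, hM₁⟩ := exists_abs_MRfin_sub_MR_le
  set κ := min (c₀ / 6) (1 / 8) with hκdef
  have hκ : 0 < κ := lt_min (by positivity) (by norm_num)
  have hκ8 : κ ≤ 1 / 8 := min_le_right _ _
  have hκc : 6 * κ ≤ c₀ := by linarith [min_le_left (c₀ / 6) (1 / 8 : ℝ)]
  set C₂ := 27 + 10 * C₀ + 240 * Real.exp Real.pi with hC₂
  have hC₂0 : 0 < C₂ := by positivity
  have hev : ∀ᶠ w : ℝ in Filter.atTop, w ^ 3 ≤ Real.exp (κ / 8 * w) := by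
    have h := (isLittleO_pow_exp_pos_mul_atTop 3 (show 0 < κ / 8 by positivity)).bound one_pos
    filter_upwards [h, Filter.eventually_ge_atTop 0] with w hw h0
    rwa [one_mul, Real.norm_of_nonneg (by positivity), Real.norm_of_nonneg (Real.exp_pos _).le] at hw
  obtain ⟨w₀, hw₀⟩ := Filter.eventually_atTop.1 hev
  refine ⟨κ, hκ, by linarith, C₂ + 2 + C₁, Real.exp (max w₀ 13 ^ 2), fun y hy l hl hly => ?_⟩
  have hy0 : 0 < y := (Real.exp_pos _).trans_le hy
  set w := Real.sqrt (Real.log y) with hw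
  have hmax : 13 ≤ max w₀ 13 := le_max_right _ _
  have hwm : max w₀ 13 ≤ w := Real.le_sqrt_of_sq_le ((Real.le_log_iff_exp_le hy0).2 hy)
  have hw13 : 13 ≤ w := hmax.trans hwm
  have hlogy : Real.log y = w ^ 2 := by
    rw [hw, Real.sq_sqrt ((sq_nonneg _).trans ((Real.le_log_iff_exp_le hy0).2 hy))]
  have hyw : Real.exp (w ^ 2) = y := by rw [← hlogy, Real.exp_log hy0]
  have hw3 : w ^ 3 ≤ Real.exp (κ / 8 * w) := hw₀ w ((le_max_left _ _).trans hwm)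
  have hL1 : 1 ≤ Real.log w := by
    rw [Real.le_log_iff_exp_le (by linarith)]; linarith [Real.exp_one_lt_d9]
  rw [hlogy, Real.log_pow, le_div_iff₀ (by push_cast; linarith)] at hly
  push_cast at hly
  have hllog : l * Real.log w ≤ κ * w / 18 := by linarith
  have hl0 : (0:ℝ) ≤ l := Nat.cast_nonneg l
  have hlw : (l:ℝ) ≤ κ * w / 18 := by nlinarith
  have hκw : κ * w ≤ w / 8 := by nlinarith
  have hwl : (w ^ 3) ^ l ≤ Real.exp (κ / 6 * w) := by
    have : (w ^ 3) ^ l = Real.exp (3 * (l * Real.log w)) := by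
      rw [← Real.exp_log (show (0:ℝ) < w by linarith), ← Real.exp_nat_mul, ← Real.exp_nat_mul, Real.log_exp]
      congr 1; push_cast; ring
    rw [this]; exact Real.exp_le_exp.2 (by linarith)
  obtain ⟨z, hz1, hzl, hzu, hz⟩ := exists_sawSum_approx_Rtilde hC₀ hM hκ hκ8 hκc hw13
  specialize hz l
  rw [hyw, ← hC₂] at hz
  set E := Real.exp (-(κ / 8 * w)) with hE
  have hE0 : 0 < E := Real.exp_pos _
  have b1 : |(1 / y) * (∫ u in (0 : ℝ)..y, Rtilde u ^ l) -
      (1 / y) * ((-1) ^ l * ∫ u in (0:ℝ)..y, sawSum (Finset.Icc 1 z) u ^ l)| ≤ C₂ * E := by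
    rw [← mul_sub, abs_mul, abs_of_pos (show 0 < 1 / y by positivity), one_div, inv_mul_le_iff₀ hy0]
    refine hz.trans ?_
    have h1 : (13 * w ^ 2) ^ l ≤ Real.exp (κ / 6 * w) :=
      (pow_le_pow_left₀ (by positivity) (by nlinarith [sq_nonneg w]) l).trans hwl
    have h2 : (l:ℝ) * w ^ 2 ≤ Real.exp (κ / 8 * w) := by
      refine le_trans ?_ hw3
      have : (l:ℝ) ≤ w := by linarith
      calc (l:ℝ) * w ^ 2 ≤ w * w ^ 2 := by gcongr
        _ = _ := by ring
    calc l * (13 * w ^ 2) ^ l * (C₂ * w ^ 2 * Real.exp (-(κ * w)) * y)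
        = C₂ * y * ((13 * w ^ 2) ^ l * (l * w ^ 2) * Real.exp (-(κ * w))) := by ring
      _ ≤ C₂ * y * (Real.exp (κ / 6 * w) * Real.exp (κ / 8 * w) * Real.exp (-(κ * w))) := by gcongr
      _ ≤ C₂ * y * E := by
        refine mul_le_mul_of_nonneg_left ?_ (by positivity)
        rw [← Real.exp_add, ← Real.exp_add]
        exact Real.exp_le_exp.2 (by nlinarith)
      _ = _ := by ring
  have hsign : (-1) ^ l * MRfin l (Finset.Icc 1 z) = MRfin l (Finset.Icc 1 z) := by
    rcases Nat.even_or_odd l with h | h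
    · rw [h.neg_one_pow, one_mul]
    · rw [MRfin_odd h fun d hd => by rw [Finset.mem_Icc] at hd; omega, mul_zero]
  have b2 : |(1 / y) * ((-1) ^ l * ∫ u in (0:ℝ)..y, sawSum (Finset.Icc 1 z) u ^ l) - MRfin l (Finset.Icc 1 z)| ≤ 2 * E := by
    have h1 := abs_integral_sawSum_pow_sub_le (D := Finset.Icc 1 z)
      (fun d hd => by rw [Finset.mem_Icc] at hd; omega) l hy0.le
    have h2 : (1 / y) * ((-1) ^ l * ∫ u in (0:ℝ)..y, sawSum (Finset.Icc 1 z) u ^ l) - MRfin l (Finset.Icc 1 z) =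
        (1 / y) * ((-1) ^ l * ((∫ u in (0:ℝ)..y, sawSum (Finset.Icc 1 z) u ^ l) - y * MRfin l (Finset.Icc 1 z))) := by
      have h : (-1) ^ l * ((∫ u in (0:ℝ)..y, sawSum (Finset.Icc 1 z) u ^ l) - y * MRfin l (Finset.Icc 1 z)) =
          (-1) ^ l * (∫ u in (0:ℝ)..y, sawSum (Finset.Icc 1 z) u ^ l) - y * MRfin l (Finset.Icc 1 z) := by
        linear_combination (-y) * hsign
      rw [h, mul_sub, one_div, inv_mul_cancel_left₀ hy0.ne']
    rw [h2, abs_mul, abs_mul, abs_pow, abs_neg, abs_one, one_pow, one_mul, abs_of_pos (show 0 < 1 / y by positivity),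
      one_div, inv_mul_le_iff₀ hy0]
    refine h1.trans ?_
    rw [Nat.card_Icc, Nat.add_sub_cancel]
    have h3 : (z:ℝ) ^ l ≤ Real.exp (l * (2 * w)) := by
      rw [Real.exp_nat_mul]; exact pow_le_pow_left₀ (by positivity) hzu l
    have h4 : Real.exp (l * (2 * w)) ≤ y * E := by
      rw [← hyw, hE, ← Real.exp_add]
      refine Real.exp_le_exp.2 ?_
      have h5 : (l:ℝ) * (2 * w) ≤ w / 144 * (2 * w) := mul_le_mul_of_nonneg_right (by linarith) (by linarith)
      have h6 : 13 * w ≤ w ^ 2 := by rw [sq]; exact mul_le_mul_of_nonneg_right hw13 (by linarith)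
      linarith
    linarith
  have b3 : |MRfin l (Finset.Icc 1 z) - MR l| ≤ C₁ * E := by
    refine (hM₁ z hz1 l).trans ?_
    have h1 : (4 * l : ℝ) ^ l ≤ Real.exp (κ / 6 * w) :=
      (pow_le_pow_left₀ (by positivity) (by nlinarith [sq_nonneg w]) l).trans hwl
    have h2 : (l:ℝ) ≤ Real.exp (κ / 8 * w) := by
      refine le_trans ?_ hw3
      nlinarith [sq_nonneg w]
    have h3 : w ≤ Real.log z := (Real.le_log_iff_exp_le (by exact_mod_cast hz1)).2 hzl
    calc C₁ * (l * (4 * l : ℝ) ^ l) * Real.exp (-(Real.log z / 4))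
        ≤ C₁ * (Real.exp (κ / 8 * w) * Real.exp (κ / 6 * w)) * Real.exp (-(w / 4)) := by gcongr
      _ = C₁ * (Real.exp (κ / 8 * w) * Real.exp (κ / 6 * w) * Real.exp (-(w / 4))) := by ring
      _ ≤ C₁ * E := by
        refine mul_le_mul_of_nonneg_left ?_ hC₁
        rw [← Real.exp_add, ← Real.exp_add]
        exact Real.exp_le_exp.2 (by nlinarith)
  refine ((abs_sub_le _ _ _).trans (add_le_add b1 ((abs_sub_le _ _ _).trans (add_le_add b2 b3)))).trans (le_of_eq ?_)
  ring

/-- Moments of `R̃(u)` (Theorem 7.1). -/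
theorem moments_of_Rtilde :
    (∃ c : ℝ, 0 < c ∧ c < 1 ∧ ∃ A : ℝ, ∃ y₀ : ℝ, ∀ y : ℝ, y₀ ≤ y →
      ∀ l : ℕ, 2 ≤ l →
        (l : ℝ) ≤ c / 9 * Real.sqrt (Real.log y) / Real.log (Real.log y) →
        |(1 / y) * (∫ u in (0 : ℝ)..y, Rtilde u ^ l) - MR l| ≤
          A * Real.exp (-(c / 8 * Real.sqrt (Real.log y)))) ∧
    (∀ l : ℕ, Odd l → MR l = 0) ∧ MR 2 = 1 / (2 * Real.pi ^ 2) ∧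
    ∃ A' : ℝ, ∀ l : ℕ, Even l → 4 ≤ l →
      MR l ≤ (3 * Real.exp Real.eulerMascheroniConstant / Real.pi ^ 2 * Real.log l + A') ^ l :=
  ⟨exists_moment_approx, fun _ hl => MR_odd hl, MR_two, exists_MR_even_le⟩
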